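/- For any convex polyhedron, the intrinsic radius is strictly smaller than the intrinsic diameter, which is at most twice the intrinsic radius: Rad(P) < Diam(P) ≤ 2 · Rad(P). -/

import Mathlib

open scoped ENNReal

/-- The intrinsic (geodesic) distance on a subset `T` of `ℝ³`: the infimum of the lengths of
continuous paths from `x` to `y` staying in `T`. -/
noncomputable def rho (T : Set (EuclideanSpace ℝ (Fin 3)))
    (x y : EuclideanSpace ℝ (Fin 3)) : ℝ≥0∞ :=
  ⨅ (γ : ℝ → EuclideanSpace ℝ (Fin 3)) (_ : Continuous γ) (_ : γ 0 = x) (_ : γ 1 = y)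
    (_ : ∀ t ∈ Set.Icc (0 : ℝ) 1, γ t ∈ T), eVariationOn γ (Set.Icc 0 1)

/-- Intrinsic diameter. -/
noncomputable def intrinsicDiam (T : Set (EuclideanSpace ℝ (Fin 3))) : ℝ≥0∞ :=
  ⨆ x ∈ T, ⨆ y ∈ T, rho T x y

/-- Intrinsic radius. -/
noncomputable def intrinsicRad (T : Set (EuclideanSpace ℝ (Fin 3))) : ℝ≥0∞ :=
  ⨅ x ∈ T, ⨆ y ∈ T, rho T x y

/-- Extrinsic radius. -/
noncomputable def extrinsicRad (T : Set (EuclideanSpace ℝ (Fin 3))) : ℝ≥0∞ :=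
  ⨅ x ∈ T, ⨆ y ∈ T, edist x y

local notation "E" => EuclideanSpace ℝ (Fin 3)

namespace IntrinsicMetric
open scoped RealInnerProductSpace Topology
open Filter
set_option linter.unusedSectionVars false

theorem rho_le_eVariationOn {T : Set E} {γ : ℝ → E} (hc : Continuous γ)
    (hT : ∀ t ∈ Set.Icc (0 : ℝ) 1, γ t ∈ T) :
    rho T (γ 0) (γ 1) ≤ eVariationOn γ (Set.Icc 0 1) :=
  iInf_le_of_le γ <| iInf_le_of_le hc <| iInf_le_of_le rfl <| iInf_le_of_le rfl <|
    iInf_le_of_le hT le_rfl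

theorem exists_path_of_rho_lt {T : Set E} {x y : E} {c : ℝ≥0∞} (h : rho T x y < c) :
    ∃ γ : ℝ → E, Continuous γ ∧ γ 0 = x ∧ γ 1 = y ∧ (∀ t ∈ Set.Icc (0 : ℝ) 1, γ t ∈ T) ∧
      eVariationOn γ (Set.Icc 0 1) < c := by
  simp only [rho, iInf_lt_iff] at h
  obtain ⟨γ, h1, h2, h3, h4, h5⟩ := h
  exact ⟨γ, h1, h2, h3, h4, h5⟩

theorem rho_le_eVariationOn_Icc {T : Set E} {γ : ℝ → E} {a b : ℝ} (hab : a ≤ b)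
    (hc : ContinuousOn γ (Set.Icc a b)) (hT : ∀ t ∈ Set.Icc a b, γ t ∈ T) :
    rho T (γ a) (γ b) ≤ eVariationOn γ (Set.Icc a b) := by
  set φ : ℝ → ℝ := fun t => a + (b - a) * max 0 (min 1 t) with hφ
  have hmem : ∀ t, φ t ∈ Set.Icc a b := by
    intro t
    have h0 : 0 ≤ max 0 (min 1 t) := le_max_left _ _
    have h1 : max 0 (min 1 t) ≤ 1 := max_le zero_le_one (min_le_left _ _)
    constructor <;> simp only [hφ] <;> nlinarith
  have hmono : Monotone φ := by
    intro s t hst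
    have : max 0 (min 1 s) ≤ max 0 (min 1 t) := max_le_max le_rfl (min_le_min le_rfl hst)
    simp only [hφ]
    nlinarith
  have hcont : Continuous (γ ∘ φ) :=
    hc.comp_continuous (by simp only [hφ]; fun_prop) hmem
  have := rho_le_eVariationOn (T := T) hcont (fun t _ => hT _ (hmem t))
  have h0 : φ 0 = a := by simp [hφ]
  have h1 : φ 1 = b := by simp [hφ]
  simp only [Function.comp, h0, h1] at this
  exact this.trans
    (eVariationOn.comp_le_of_monotoneOn γ φ (hmono.monotoneOn _) (fun t _ => hmem t))

theorem rho_comm_le (T : Set E) (x y : E) : rho T y x ≤ rho T x y := by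
  refine le_iInf fun γ => le_iInf fun hc => le_iInf fun h0 => le_iInf fun h1 => le_iInf fun hT => ?_
  have hT' : ∀ t ∈ Set.Icc (0 : ℝ) 1, (γ ∘ fun t => 1 - t) t ∈ T := fun t ht =>
    hT _ ⟨by linarith [ht.2], by linarith [ht.1]⟩
  have := rho_le_eVariationOn (T := T) (hc.comp (by fun_prop)) hT'
  have hanti : AntitoneOn (fun t : ℝ => 1 - t) (Set.Icc 0 1) := fun s _ t _ h => by
    simp only; linarith
  rw [eVariationOn.comp_eq_of_antitoneOn γ _ hanti] at this
  simpa [h0, h1] using this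

theorem rho_comm (T : Set E) (x y : E) : rho T x y = rho T y x :=
  le_antisymm (rho_comm_le T y x) (rho_comm_le T x y)

theorem rho_triangle (T : Set E) (x y z : E) : rho T x z ≤ rho T x y + rho T y z := by
  refine ENNReal.le_of_forall_pos_le_add fun ε hε hfin => ?_
  have hε' : (0 : ℝ≥0∞) < (ε / 2 : NNReal) := ENNReal.coe_pos.2 (half_pos hε)
  have hx : rho T x y ≠ ⊤ := ne_top_of_le_ne_top hfin.ne le_self_add
  have hy : rho T y z ≠ ⊤ := ne_top_of_le_ne_top hfin.ne le_add_self
  obtain ⟨γ, hc, h0, h1, hT, hl⟩ := exists_path_of_rho_lt (ENNReal.lt_add_right hx hε'.ne')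
  obtain ⟨δ, hc', h0', h1', hT', hl'⟩ := exists_path_of_rho_lt (ENNReal.lt_add_right hy hε'.ne')
  set η : ℝ → E := fun t => if t ≤ 1 then γ t else δ (t - 1) with hη
  have hηc : Continuous η := by
    refine Continuous.if_le hc (by fun_prop) continuous_id continuous_const ?_
    rintro t rfl
    simp [h1, h0']
  have hηT : ∀ t ∈ Set.Icc (0 : ℝ) 2, η t ∈ T := by
    intro t ht
    by_cases h : t ≤ 1
    · simpa [hη, h] using hT t ⟨ht.1, h⟩
    · simpa [hη, h] using hT' (t - 1) ⟨by linarith, by linarith [ht.2]⟩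
  have key := rho_le_eVariationOn_Icc (T := T) (by norm_num) hηc.continuousOn hηT
  have e0 : η 0 = x := by simp [hη, h0]
  have e2 : η 2 = z := by
    have h2 : ¬ ((2 : ℝ) ≤ 1) := by norm_num
    have h3 : (2 : ℝ) - 1 = 1 := by norm_num
    simp [hη, h2, h3, h1']
  rw [e0, e2] at key
  have hsplit := eVariationOn.Icc_add_Icc η (s := Set.univ) (a := 0) (b := 1) (c := 2)
    (by norm_num) (by norm_num) trivial
  simp only [Set.univ_inter] at hsplit
  have hA : eVariationOn η (Set.Icc 0 1) = eVariationOn γ (Set.Icc 0 1) :=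
    eVariationOn.eq_of_eqOn fun t ht => by simp [hη, ht.2]
  have hB : eVariationOn η (Set.Icc 1 2) ≤ eVariationOn δ (Set.Icc 0 1) := by
    have : eVariationOn η (Set.Icc 1 2) = eVariationOn (δ ∘ fun t => t - 1) (Set.Icc 1 2) := by
      refine eVariationOn.eq_of_eqOn fun t ht => ?_
      rcases eq_or_lt_of_le ht.1 with h | h
      · simp [hη, ← h, h1, h0']
      · simp [hη, not_le.2 h]
    rw [this]
    refine eVariationOn.comp_le_of_monotoneOn δ _ (fun s _ t _ h => by simpa using h) ?_
    intro t ht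
    exact ⟨by linarith [ht.1], by linarith [ht.2]⟩
  calc rho T x z ≤ _ := key
    _ ≤ eVariationOn γ (Set.Icc 0 1) + eVariationOn δ (Set.Icc 0 1) := by
        rw [← hsplit, hA]; gcongr
    _ ≤ (rho T x y + (ε / 2 : NNReal)) + (rho T y z + (ε / 2 : NNReal)) := add_le_add hl.le hl'.le
    _ = rho T x y + rho T y z + ε := by
        rw [add_add_add_comm, ← ENNReal.coe_add, add_halves]

theorem edist_le_rho (T : Set E) (x y : E) : edist x y ≤ rho T x y := by
  refine le_iInf fun γ => le_iInf fun hc => le_iInf fun h0 => le_iInf fun h1 => le_iInf fun hT => ?_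
  rw [← h0, ← h1]
  exact eVariationOn.edist_le γ (by simp) (by simp)

theorem intrinsicDiam_le_two_mul_intrinsicRad (T : Set E) :
    intrinsicDiam T ≤ 2 * intrinsicRad T := by
  have key : ∀ c ∈ T, intrinsicDiam T ≤ 2 * ⨆ y ∈ T, rho T c y := by
    intro c hc
    refine iSup₂_le fun x hx => iSup₂_le fun y hy => ?_
    have hle : ∀ z ∈ T, rho T c z ≤ ⨆ y ∈ T, rho T c y := fun z hz =>
      le_iSup₂_of_le z hz le_rfl
    calc rho T x y ≤ rho T x c + rho T c y := rho_triangle T x c y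
      _ ≤ (⨆ y ∈ T, rho T c y) + ⨆ y ∈ T, rho T c y := by
          rw [rho_comm T x c]; exact add_le_add (hle x hx) (hle y hy)
      _ = _ := (two_mul _).symm
  rw [intrinsicRad, ENNReal.mul_iInf_of_ne (by norm_num) (by norm_num)]
  refine le_iInf fun c => ?_
  by_cases hc : c ∈ T
  · simpa [hc] using key c hc
  · simp [hc]

theorem rho_comp_lineMap_le {T : Set E} {f : E → E} {x y : E}
    (hf : LipschitzWith 1 f) (h : ∀ z ∈ segment ℝ x y, f z ∈ T) :
    rho T (f x) (f y) ≤ edist x y := by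
  have hL : LipschitzWith (nndist x y) (fun t : ℝ => AffineMap.lineMap x y t) :=
    lipschitzWith_lineMap x y
  have hfL := hf.comp hL
  have h1 := rho_le_eVariationOn_Icc (T := T) zero_le_one hfL.continuous.continuousOn (fun t ht =>
    h _ (by rw [segment_eq_image_lineMap]; exact ⟨t, ht, rfl⟩))
  simp only [Function.comp, AffineMap.lineMap_apply_zero, AffineMap.lineMap_apply_one] at h1
  refine h1.trans ?_
  have h2 := (hfL.lipschitzOnWith (s := Set.univ)).comp_eVariationOn_le
    (g := (id : ℝ → ℝ)) (s := Set.Icc 0 1) (fun _ _ => trivial)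
  have h3 := (monotoneOn_id (s := Set.Icc (0 : ℝ) 1)).eVariationOn_eq
    (a := (0 : ℝ)) (b := 1) (by simp) (by simp)
  simp only [Set.inter_self, id, sub_zero, ENNReal.ofReal_one] at h3
  refine h2.trans ?_
  calc _ ≤ ((1 * nndist x y : NNReal) : ℝ≥0∞) * 1 := by gcongr; exact h3.le
    _ = edist x y := by rw [one_mul, mul_one, edist_nndist]

/-- A bounded polyhedron in `ℝ³` with an interior point `o`, given by finitely many half-spaces
with unit outer normals. -/
structure HPolyhedron (ι : Type) where
  n : ι → E
  h : ι → ℝ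
  o : E
  norm_n : ∀ i, ‖n i‖ = 1
  inner_o_lt : ∀ i, ⟪n i, o⟫ < h i
  isBounded : Bornology.IsBounded {x | ∀ i, ⟪n i, x⟫ ≤ h i}

namespace HPolyhedron

variable {ι : Type} (H : HPolyhedron ι)

/-- The solid polyhedron. -/
def body : Set E := {x | ∀ i, ⟪H.n i, x⟫ ≤ H.h i}

/-- The part of the body lying in the `i`-th supporting plane. -/
def facet (i : ι) : Set E := {x | x ∈ H.body ∧ ⟪H.n i, x⟫ = H.h i}

/-- The polyhedral surface. -/
def surface : Set E := {x | ∃ i, x ∈ H.facet i}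

theorem inner_n_self (i : ι) : ⟪H.n i, H.n i⟫ = 1 := by
  rw [real_inner_self_eq_norm_sq, H.norm_n]; norm_num

theorem isClosed_body : IsClosed H.body := by
  simp only [body, Set.ofPred_forall]
  exact isClosed_iInter fun i => isClosed_le (by fun_prop) continuous_const

theorem isCompact_body : IsCompact H.body :=
  Metric.isCompact_of_isClosed_isBounded H.isClosed_body H.isBounded

theorem isClosed_facet (i : ι) : IsClosed (H.facet i) :=
  H.isClosed_body.inter (isClosed_eq (by fun_prop) continuous_const)

theorem isCompact_facet (i : ι) : IsCompact (H.facet i) :=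
  H.isCompact_body.of_isClosed_subset (H.isClosed_facet i) fun _ hx => hx.1

theorem convex_body : Convex ℝ H.body := by
  intro x hx y hy a b ha hb hab i
  rw [inner_add_right, inner_smul_right, inner_smul_right]
  calc _ ≤ a * H.h i + b * H.h i := by gcongr; exacts [hx i, hy i]
    _ = H.h i := by rw [← add_mul, hab, one_mul]

theorem convex_facet (i : ι) : Convex ℝ (H.facet i) := by
  intro x hx y hy a b ha hb hab
  refine ⟨H.convex_body hx.1 hy.1 ha hb hab, ?_⟩
  rw [inner_add_right, inner_smul_right, inner_smul_right, hx.2, hy.2, ← add_mul, hab, one_mul]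

theorem interior_body [Finite ι] : interior H.body = {x | ∀ i, ⟪H.n i, x⟫ < H.h i} := by
  apply Set.Subset.antisymm
  · intro x hx i
    have hx' : x ∈ H.body := interior_subset hx
    refine lt_of_le_of_ne (hx' i) fun heq => ?_
    have hcont : Tendsto (fun t : ℝ => x + t • H.n i) (𝓝[>] 0) (𝓝 x) := by
      have : Continuous fun t : ℝ => x + t • H.n i := by fun_prop
      have h2 := this.tendsto 0
      simp only [zero_smul, add_zero] at h2
      exact h2.mono_left nhdsWithin_le_nhds
    obtain ⟨t, ht, ht0⟩ := ((hcont.eventually (mem_interior_iff_mem_nhds.1 hx)).and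
      self_mem_nhdsWithin).exists
    have := ht i
    rw [inner_add_right, inner_smul_right, H.inner_n_self, heq] at this
    have ht0' : (0 : ℝ) < t := ht0
    linarith
  · refine interior_maximal (fun x hx i => (hx i).le) ?_
    simp only [Set.ofPred_forall]
    exact isOpen_iInter_of_finite fun i => isOpen_lt (by fun_prop) continuous_const

theorem frontier_body [Finite ι] : frontier H.body = H.surface := by
  rw [frontier, H.isClosed_body.closure_eq, H.interior_body]
  ext x
  simp only [Set.mem_sdiff, Set.mem_ofPred_eq, surface, facet, not_forall, not_lt]
  constructor
  · rintro ⟨hx, i, hi⟩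
    exact ⟨i, hx, le_antisymm (hx i) hi⟩
  · rintro ⟨i, hx, hi⟩
    exact ⟨hx, i, hi.ge⟩

end HPolyhedron

theorem finite_extremePoints_polar {V : Set E} (hV : V.Finite) :
    (Set.extremePoints ℝ {f : E | ∀ v ∈ V, ⟪f, v⟫ ≤ 1}).Finite := by
  refine Set.Finite.of_finite_image (f := fun f : E => {v ∈ V | ⟪f, v⟫ = 1})
    (hV.finite_subsets.subset ?_) ?_
  · rintro _ ⟨f, -, rfl⟩
    exact Set.sep_subset _ _
  · intro f hf g hg hfg
    simp only at hfg
    by_contra hne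
    have hev : ∀ s : ℝ, ∀ᶠ ε : ℝ in 𝓝 0, ∀ v ∈ V, ⟪f + (s * ε) • (g - f), v⟫ ≤ 1 := by
      intro s
      refine (Set.Finite.eventually_all hV).2 ?_
      intro v hv
      rcases (hf.1 v hv).lt_or_eq with h | h
      · have hc : Continuous fun ε : ℝ => ⟪f + (s * ε) • (g - f), v⟫ := by fun_prop
        have := (hc.tendsto 0).eventually (gt_mem_nhds (a := (1 : ℝ)) (by simpa using h))
        exact this.mono fun ε h => h.le
      · have hg1 : ⟪g, v⟫ = 1 := by
          have : v ∈ {v ∈ V | ⟪f, v⟫ = 1} := ⟨hv, h⟩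
          rw [hfg] at this
          exact this.2
        refine Eventually.of_forall fun ε => ?_
        rw [inner_add_left, inner_smul_left, inner_sub_left, h, hg1]
        simp
    have hev2 : ∀ᶠ ε : ℝ in 𝓝[>] 0, (∀ v ∈ V, ⟪f + (1 * ε) • (g - f), v⟫ ≤ 1) ∧
        (∀ v ∈ V, ⟪f + (-1 * ε) • (g - f), v⟫ ≤ 1) :=
      ((hev 1).and (hev (-1))).filter_mono nhdsWithin_le_nhds
    obtain ⟨ε, ⟨h1, h2⟩, hε⟩ := (hev2.and self_mem_nhdsWithin).exists
    have hε' : (0 : ℝ) < ε := hε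
    have hmid : f ∈ openSegment ℝ (f + (1 * ε) • (g - f)) (f + (-1 * ε) • (g - f)) := by
      refine ⟨1 / 2, 1 / 2, by norm_num, by norm_num, by norm_num, ?_⟩
      module
    have := hf.2 h1 h2 hmid
    have h3 : ε • (g - f) = 0 := by simpa using this
    rcases smul_eq_zero.1 h3 with h | h
    · exact hε'.ne' h
    · exact hne (sub_eq_zero.1 h).symm

theorem mem_convexHull_iff_extremePoints_polar {V : Set E} (hV : V.Finite)
    (h0 : (0 : E) ∈ interior (convexHull ℝ V)) (x : E) :
    x ∈ convexHull ℝ V ↔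
      ∀ f ∈ Set.extremePoints ℝ {f : E | ∀ v ∈ V, ⟪f, v⟫ ≤ 1}, ⟪f, x⟫ ≤ 1 := by
  set Q : Set E := {f : E | ∀ v ∈ V, ⟪f, v⟫ ≤ 1} with hQ
  have hQC : ∀ f ∈ Q, ∀ y ∈ convexHull ℝ V, ⟪f, y⟫ ≤ 1 := by
    intro f hf y hy
    have hconv : Convex ℝ {y : E | ⟪f, y⟫ ≤ 1} :=
      convex_halfSpace_le (innerSL ℝ f).isLinear 1
    exact convexHull_min (s := V) (t := {y : E | ⟪f, y⟫ ≤ 1}) hf hconv hy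
  refine ⟨fun hx f hf => hQC f hf.1 x hx, fun hx => ?_⟩
  by_contra hxC
  have hQconv : Convex ℝ Q := by
    intro f hf g hg a b ha hb hab v hv
    rw [inner_add_left, inner_smul_left, inner_smul_left]
    simp only [conj_trivial]
    nlinarith [hf v hv, hg v hv]
  have hQclosed : IsClosed Q := by
    simp only [hQ, Set.ofPred_forall]
    exact isClosed_iInter fun v => isClosed_iInter fun _ => isClosed_le (by fun_prop)
      continuous_const
  have hQbdd : Bornology.IsBounded Q := by
    obtain ⟨r, hr, hball⟩ := Metric.mem_nhds_iff.1 (mem_interior_iff_mem_nhds.1 h0)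
    refine (Metric.isBounded_closedBall (x := (0 : E)) (r := 2 / r)).subset fun f hf => ?_
    rw [mem_closedBall_zero_iff]
    by_cases hf0 : f = 0
    · rw [hf0, norm_zero]; positivity
    have hfn : 0 < ‖f‖ := norm_pos_iff.2 hf0
    have hy : (r / 2 / ‖f‖) • f ∈ Metric.ball (0 : E) r := by
      rw [mem_ball_zero_iff, norm_smul, Real.norm_of_nonneg (by positivity),
        div_mul_cancel₀ _ hfn.ne']
      linarith
    have := hQC f hf _ (hball hy)
    rw [inner_smul_right, real_inner_self_eq_norm_sq] at this
    rw [le_div_iff₀ hr]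
    have h3 : r / 2 / ‖f‖ * ‖f‖ ^ 2 = r / 2 * ‖f‖ := by field_simp
    rw [h3] at this
    linarith
  have hQcomp : IsCompact Q := Metric.isCompact_of_isClosed_isBounded hQclosed hQbdd
  have hsub : Q ⊆ {f : E | ⟪f, x⟫ ≤ 1} := by
    rw [← closure_convexHull_extremePoints hQcomp hQconv]
    refine closure_minimal (convexHull_min hx ?_) (isClosed_le (by fun_prop) continuous_const)
    intro f hf g hg a b ha hb hab
    simp only [Set.mem_ofPred_eq] at *
    rw [inner_add_left, inner_smul_left, inner_smul_left]
    simp only [conj_trivial]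
    nlinarith
  obtain ⟨g, u, hg1, hg2⟩ := geometric_hahn_banach_closed_point (convex_convexHull ℝ V)
    (hV.isCompact_convexHull (𝕜 := ℝ)).isClosed hxC
  have hu : 0 < u := by simpa using hg1 0 (interior_subset h0)
  set f0 : E := (InnerProductSpace.toDual ℝ E).symm g with hf0
  have hin : ∀ y, ⟪f0, y⟫ = g y := fun y => InnerProductSpace.toDual_symm_apply
  have hfQ : u⁻¹ • f0 ∈ Q := by
    intro v hv
    rw [inner_smul_left, hin]
    have := hg1 v (subset_convexHull ℝ V hv)
    simp only [conj_trivial]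
    rw [inv_mul_le_iff₀ hu]
    linarith
  have := hsub hfQ
  simp only [Set.mem_ofPred_eq] at this
  rw [inner_smul_left, hin] at this
  simp only [conj_trivial] at this
  rw [inv_mul_le_iff₀ hu] at this
  linarith

theorem exists_hPolyhedron {V : Set E} (hV : V.Finite)
    (hint : (interior (convexHull ℝ V)).Nonempty) :
    ∃ (ι : Type) (_ : Finite ι) (H : HPolyhedron ι), H.body = convexHull ℝ V := by
  obtain ⟨o, ho⟩ := hint
  set W : Set E := (fun v => v - o) '' V with hW
  have hWf : W.Finite := hV.image _
  have hshift : convexHull ℝ W = (fun v => v - o) '' convexHull ℝ V := by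
    have : (fun v : E => v - o) = (AffineEquiv.constVAdd ℝ E (-o)).toAffineMap := by
      ext v; simp [sub_eq_neg_add]
    rw [hW, this]
    exact (AffineMap.image_convexHull _ _).symm
  have hmem : ∀ x, x ∈ convexHull ℝ V ↔ x - o ∈ convexHull ℝ W := by
    intro x
    rw [hshift]
    exact ⟨fun h => ⟨x, h, rfl⟩, fun ⟨y, hy, hyx⟩ => by
      rwa [sub_left_inj.1 hyx] at hy⟩
  have h0 : (0 : E) ∈ interior (convexHull ℝ W) := by
    rw [mem_interior_iff_mem_nhds] at ho ⊢
    have hc : Tendsto (fun y : E => y + o) (𝓝 0) (𝓝 o) := by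
      have : Continuous fun y : E => y + o := by fun_prop
      simpa using this.tendsto 0
    filter_upwards [hc ho] with y hy
    have := (hmem _).1 hy
    simpa using this
  set X := Set.extremePoints ℝ {f : E | ∀ v ∈ W, ⟪f, v⟫ ≤ 1} with hX
  have hXf : X.Finite := finite_extremePoints_polar hWf
  have hiff := mem_convexHull_iff_extremePoints_polar hWf h0
  let ι : Type := {f : E // f ∈ X ∧ f ≠ 0}
  have hfin : Finite ι := (hXf.subset fun f (hf : f ∈ X ∧ f ≠ 0) => hf.1).to_subtype
  have hpos : ∀ f : ι, 0 < ‖f.1‖ := fun f => norm_pos_iff.2 f.2.2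
  have hbody : {x : E | ∀ i : ι, ⟪‖i.1‖⁻¹ • i.1, x⟫ ≤ ‖i.1‖⁻¹ + ⟪‖i.1‖⁻¹ • i.1, o⟫} =
      convexHull ℝ V := by
    ext x
    rw [hmem, hiff]
    simp only [Set.mem_ofPred_eq]
    have hstep : ∀ f : ι, ⟪‖f.1‖⁻¹ • f.1, x⟫ ≤ ‖f.1‖⁻¹ + ⟪‖f.1‖⁻¹ • f.1, o⟫ ↔
        ⟪f.1, x - o⟫ ≤ 1 := by
      intro f
      have hp := inv_pos.2 (hpos f)
      rw [inner_smul_left, inner_smul_left, inner_sub_right]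
      simp only [conj_trivial]
      rw [← sub_nonneg, show ‖f.1‖⁻¹ + ‖f.1‖⁻¹ * ⟪f.1, o⟫ - ‖f.1‖⁻¹ * ⟪f.1, x⟫ =
        ‖f.1‖⁻¹ * (1 - (⟪f.1, x⟫ - ⟪f.1, o⟫)) by ring, mul_nonneg_iff_of_pos_left hp, sub_nonneg]
    constructor
    · intro h f hf
      by_cases hf0 : f = 0
      · simp [hf0]
      · exact (hstep ⟨f, hf, hf0⟩).1 (h ⟨f, hf, hf0⟩)
    · intro h f
      exact (hstep f).2 (h f.1 f.2.1)
  refine ⟨ι, hfin, ⟨fun f => ‖f.1‖⁻¹ • f.1, fun f => ‖f.1‖⁻¹ + ⟪‖f.1‖⁻¹ • f.1, o⟫, o, ?_, ?_, ?_⟩,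
    hbody⟩
  · intro f
    rw [norm_smul, norm_inv, norm_norm, inv_mul_cancel₀ (hpos f).ne']
  · intro f
    have := inv_pos.2 (hpos f)
    linarith
  · rw [hbody]
    exact (hV.isCompact_convexHull (𝕜 := ℝ)).isBounded

theorem exists_lipschitz_retraction {K : Set E} (hne : K.Nonempty) (hcl : IsClosed K)
    (hconv : Convex ℝ K) :
    ∃ f : E → E, LipschitzWith 1 f ∧ (∀ x ∈ K, f x = x) ∧ ∀ x ∉ interior K, f x ∈ frontier K := by
  have hex : ∀ x : E, ∃ v ∈ K, ∀ w ∈ K, ⟪x - v, w - v⟫ ≤ 0 := by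
    intro x
    obtain ⟨v, hv, h⟩ := exists_norm_eq_iInf_of_complete_convex hne hcl.isComplete hconv x
    exact ⟨v, hv, (norm_eq_iInf_iff_real_inner_le_zero hconv hv).1 h⟩
  choose f hfK hf using hex
  refine ⟨f, ?_, ?_, ?_⟩
  · refine LipschitzWith.of_dist_le_mul fun x y => ?_
    rw [NNReal.coe_one, one_mul, dist_eq_norm, dist_eq_norm]
    have h1 := hf x (f y) (hfK y)
    have h2 := hf y (f x) (hfK x)
    have h3 : ‖f x - f y‖ ^ 2 ≤ ⟪x - y, f x - f y⟫ := by
      have e1 : ⟪x - f x, f y - f x⟫ = -⟪x - f x, f x - f y⟫ := by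
        rw [← inner_neg_right, neg_sub]
      have e2 : ⟪x - y, f x - f y⟫ =
          ⟪x - f x, f x - f y⟫ - ⟪y - f y, f x - f y⟫ + ⟪f x - f y, f x - f y⟫ := by
        rw [← inner_sub_left, ← inner_add_left]
        congr 1
        abel
      rw [← real_inner_self_eq_norm_sq]
      linarith
    have h4 := real_inner_le_norm (x - y) (f x - f y)
    by_contra hlt
    push Not at hlt
    nlinarith [norm_nonneg (x - y), norm_nonneg (f x - f y)]
  · intro x hx
    have := hf x x hx
    rw [real_inner_self_eq_norm_sq] at this
    have h0 : ‖x - f x‖ = 0 := by nlinarith [norm_nonneg (x - f x)]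
    exact (sub_eq_zero.1 (norm_eq_zero.1 h0)).symm
  · intro x hx
    rw [frontier, hcl.closure_eq]
    refine ⟨hfK x, fun hint => ?_⟩
    have hcont : Tendsto (fun t : ℝ => f x + t • (x - f x)) (𝓝[>] 0) (𝓝 (f x)) := by
      have : Continuous fun t : ℝ => f x + t • (x - f x) := by fun_prop
      have h2 := this.tendsto 0
      simp only [zero_smul, add_zero] at h2
      exact h2.mono_left nhdsWithin_le_nhds
    obtain ⟨t, ht, ht0⟩ := ((hcont.eventually (mem_interior_iff_mem_nhds.1 hint)).and
      self_mem_nhdsWithin).exists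
    have h1 := hf x _ ht
    rw [add_sub_cancel_left, inner_smul_right, real_inner_self_eq_norm_sq] at h1
    have ht0' : (0 : ℝ) < t := ht0
    have h0 : ‖x - f x‖ = 0 := by
      by_contra hne
      have : 0 < ‖x - f x‖ ^ 2 := by positivity
      nlinarith
    rw [← sub_eq_zero.1 (norm_eq_zero.1 h0)] at hint
    exact hx hint

theorem exists_ne_zero_inner_eq_zero (a b : E) : ∃ q : E, q ≠ 0 ∧ ⟪a, q⟫ = 0 ∧ ⟪b, q⟫ = 0 := by
  have hne : (Submodule.span ℝ (Set.range ![a, b]))ᗮ ≠ ⊥ := by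
    intro h
    have h1 := Submodule.finrank_add_finrank_orthogonal (Submodule.span ℝ (Set.range ![a, b]))
    have h2 := finrank_range_le_card (R := ℝ) ![a, b]
    rw [h, finrank_bot, finrank_euclideanSpace_fin] at h1
    rw [Set.finrank, Fintype.card_fin] at h2
    omega
  obtain ⟨q, hq, hq0⟩ := Submodule.exists_mem_ne_zero_of_ne_bot hne
  exact ⟨q, hq0, hq a (Submodule.subset_span ⟨0, rfl⟩), hq b (Submodule.subset_span ⟨1, rfl⟩)⟩

namespace HPolyhedron

variable {ι : Type} [Finite ι] (H : HPolyhedron ι)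

theorem o_mem_body : H.o ∈ H.body := fun i => (H.inner_o_lt i).le

theorem mem_body_of_mem_surface {x : E} (hx : x ∈ H.surface) : x ∈ H.body := hx.choose_spec.1

theorem exists_pos_inner {u : E} (hu : u ≠ 0) : ∃ i, 0 < ⟪H.n i, u⟫ := by
  by_contra! hcon
  obtain ⟨C, hC⟩ := H.isBounded.exists_norm_le
  have hmem : ∀ t : ℝ, 0 ≤ t → ‖H.o + t • u‖ ≤ C := by
    intro t ht
    refine hC _ fun i => ?_
    rw [inner_add_right, inner_smul_right]
    have := H.inner_o_lt i
    nlinarith [hcon i]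
  have hun : 0 < ‖u‖ := norm_pos_iff.2 hu
  have hC0 : 0 ≤ C := (norm_nonneg _).trans (hmem 0 le_rfl)
  have h1 := hmem ((C + ‖H.o‖ + 1) / ‖u‖) (by positivity)
  have h2 := norm_sub_le (H.o + ((C + ‖H.o‖ + 1) / ‖u‖) • u) H.o
  rw [add_sub_cancel_left, norm_smul, Real.norm_of_nonneg (by positivity),
    div_mul_cancel₀ _ hun.ne'] at h2
  linarith

theorem exists_ray_mem_surface {u : E} (hu : u ≠ 0) : ∃ t : ℝ, 0 < t ∧ H.o + t • u ∈ H.surface := by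
  obtain ⟨i, hi⟩ := H.exists_pos_inner hu
  set S : Set ℝ := {t | 0 ≤ t ∧ H.o + t • u ∈ H.body} with hS
  have hScl : IsClosed S := isClosed_Ici.inter (H.isClosed_body.preimage (by fun_prop))
  have hSb : S ⊆ Set.Icc 0 ((H.h i - ⟪H.n i, H.o⟫) / ⟪H.n i, u⟫) := by
    rintro t ⟨ht, htK⟩
    refine ⟨ht, ?_⟩
    have := htK i
    rw [inner_add_right, inner_smul_right] at this
    rw [le_div_iff₀ hi]
    linarith
  have hSc : IsCompact S := isCompact_Icc.of_isClosed_subset hScl hSb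
  have h0S : (0 : ℝ) ∈ S := ⟨le_rfl, by simpa using H.o_mem_body⟩
  obtain ⟨t, htS, hmax⟩ := hSc.exists_isMaxOn ⟨0, h0S⟩ continuous_id.continuousOn
  have hnot : H.o + t • u ∉ interior H.body := by
    intro hint
    have hcont : Tendsto (fun s : ℝ => H.o + s • u) (𝓝[>] t) (𝓝 (H.o + t • u)) :=
      ((by fun_prop : Continuous fun s : ℝ => H.o + s • u).tendsto t).mono_left nhdsWithin_le_nhds
    obtain ⟨s, hs, hst⟩ := ((hcont.eventually (mem_interior_iff_mem_nhds.1 hint)).and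
      self_mem_nhdsWithin).exists
    have hst' : t < s := hst
    have := hmax (show s ∈ S from ⟨htS.1.trans hst'.le, hs⟩)
    simp only [id, Set.mem_ofPred_eq] at this
    linarith
  have hsurf : H.o + t • u ∈ H.surface := by
    rw [← H.frontier_body, frontier, H.isClosed_body.closure_eq]
    exact ⟨htS.2, hnot⟩
  refine ⟨t, lt_of_le_of_ne htS.1 fun h => hnot ?_, hsurf⟩
  rw [← h, zero_smul, add_zero, H.interior_body]
  exact H.inner_o_lt

theorem not_mem_interior_of_mem_segment {x y z : E} (i : ι) (hx : H.h i ≤ ⟪H.n i, x⟫)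
    (hy : H.h i ≤ ⟪H.n i, y⟫) (hz : z ∈ segment ℝ x y) : z ∉ interior H.body := by
  rw [H.interior_body]
  intro hlt
  obtain ⟨a, b, ha, hb, hab, rfl⟩ := hz
  have := hlt i
  rw [inner_add_right, inner_smul_right, inner_smul_right] at this
  have h2 : a * H.h i + b * H.h i = H.h i := by rw [← add_mul, hab, one_mul]
  nlinarith

/-- A 1-Lipschitz retraction onto the body sending the complement of its interior to the
surface. -/
noncomputable def proj : E → E :=
  (exists_lipschitz_retraction ⟨H.o, H.o_mem_body⟩ H.isClosed_body H.convex_body).choose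

theorem lipschitz_proj : LipschitzWith 1 H.proj :=
  (exists_lipschitz_retraction ⟨H.o, H.o_mem_body⟩ H.isClosed_body H.convex_body).choose_spec.1

theorem proj_eq_self {x : E} (hx : x ∈ H.body) : H.proj x = x :=
  (exists_lipschitz_retraction ⟨H.o, H.o_mem_body⟩ H.isClosed_body
    H.convex_body).choose_spec.2.1 x hx

theorem proj_mem_surface {x : E} (hx : x ∉ interior H.body) : H.proj x ∈ H.surface := by
  rw [← H.frontier_body]
  exact (exists_lipschitz_retraction ⟨H.o, H.o_mem_body⟩ H.isClosed_body
    H.convex_body).choose_spec.2.2 x hx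

theorem rho_proj_le {x y : E} (i : ι) (hx : H.h i ≤ ⟪H.n i, x⟫) (hy : H.h i ≤ ⟪H.n i, y⟫) :
    rho H.surface (H.proj x) (H.proj y) ≤ edist x y :=
  rho_comp_lineMap_le H.lipschitz_proj fun _ hz =>
    H.proj_mem_surface (H.not_mem_interior_of_mem_segment i hx hy hz)

theorem exists_common_outside {i j : ι} (hij : H.n i ≠ -H.n j) :
    ∃ c : E, H.h i ≤ ⟪H.n i, c⟫ ∧ H.h j ≤ ⟪H.n j, c⟫ := by
  have hpos : 0 < 1 + ⟪H.n i, H.n j⟫ := by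
    have h1 : 0 < ‖H.n i + H.n j‖ ^ 2 := by
      have : H.n i + H.n j ≠ 0 := fun h => hij (eq_neg_of_add_eq_zero_left h)
      have := norm_pos_iff.2 this
      positivity
    rw [norm_add_sq_real, H.norm_n, H.norm_n] at h1
    linarith
  set t := (|H.h i| + |H.h j|) / (1 + ⟪H.n i, H.n j⟫) with ht
  have htt : t * (1 + ⟪H.n i, H.n j⟫) = |H.h i| + |H.h j| := div_mul_cancel₀ _ hpos.ne'
  refine ⟨t • (H.n i + H.n j), ?_, ?_⟩
  · rw [inner_smul_right, inner_add_right, H.inner_n_self, htt]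
    linarith [le_abs_self (H.h i), abs_nonneg (H.h j)]
  · rw [inner_smul_right, inner_add_right, H.inner_n_self, real_inner_comm, add_comm _ (1 : ℝ), htt]
    linarith [le_abs_self (H.h j), abs_nonneg (H.h i)]

theorem rho_ne_top {x y : E} (hx : x ∈ H.surface) (hy : y ∈ H.surface) :
    rho H.surface x y ≠ ⊤ := by
  have step : ∀ {x y : E} (i : ι), H.h i ≤ ⟪H.n i, x⟫ → H.h i ≤ ⟪H.n i, y⟫ →
      rho H.surface (H.proj x) (H.proj y) ≠ ⊤ := fun i h1 h2 =>
    ne_top_of_le_ne_top (edist_ne_top _ _) (H.rho_proj_le i h1 h2)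
  have tri : ∀ {x y z : E}, rho H.surface x y ≠ ⊤ → rho H.surface y z ≠ ⊤ →
      rho H.surface x z ≠ ⊤ := fun h1 h2 =>
    ne_top_of_le_ne_top (ENNReal.add_ne_top.2 ⟨h1, h2⟩) (rho_triangle _ _ _ _)
  obtain ⟨i, hi⟩ := hx
  obtain ⟨j, hj⟩ := hy
  rw [← H.proj_eq_self hi.1, ← H.proj_eq_self hj.1]
  by_cases hij : H.n i = -H.n j
  · obtain ⟨q, hq0, hq, -⟩ := exists_ne_zero_inner_eq_zero (H.n j) (H.n j)
    obtain ⟨k, hk⟩ := H.exists_pos_inner hq0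
    have hik : H.n i ≠ -H.n k := by
      intro h
      have h1 : H.n k = H.n j := by rw [hij] at h; exact (neg_injective h).symm
      rw [h1, hq] at hk
      exact hk.false
    have hkj : H.n k ≠ -H.n j := by
      intro h
      rw [h, inner_neg_left, hq] at hk
      simp at hk
    obtain ⟨c, hc1, hc2⟩ := H.exists_common_outside hik
    obtain ⟨c', hc1', hc2'⟩ := H.exists_common_outside hkj
    exact tri (step i hi.2.ge hc1) (tri (step k hc2 hc1') (step j hc2' hj.2.ge))
  · obtain ⟨c, hc1, hc2⟩ := H.exists_common_outside hij
    exact tri (step i hi.2.ge hc1) (step j hc2 hj.2.ge)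

/-- The intrinsic distance of the surface, as a real number. -/
noncomputable def d (x y : E) : ℝ := (rho H.surface x y).toReal

theorem d_comm (x y : E) : H.d x y = H.d y x := by rw [d, d, rho_comm]

theorem d_triangle {x y z : E} (hx : x ∈ H.surface) (hy : y ∈ H.surface) (hz : z ∈ H.surface) :
    H.d x z ≤ H.d x y + H.d y z := by
  rw [d, d, d, ← ENNReal.toReal_add (H.rho_ne_top hx hy) (H.rho_ne_top hy hz)]
  exact ENNReal.toReal_mono (ENNReal.add_ne_top.2 ⟨H.rho_ne_top hx hy, H.rho_ne_top hy hz⟩)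
    (rho_triangle _ _ _ _)

theorem norm_sub_le_d {x y : E} (hx : x ∈ H.surface) (hy : y ∈ H.surface) :
    ‖x - y‖ ≤ H.d x y := by
  rw [← dist_eq_norm, dist_edist, d]
  exact ENNReal.toReal_mono (H.rho_ne_top hx hy) (edist_le_rho _ _ _)

theorem d_proj_le {x y : E} (i : ι) (hx : H.h i ≤ ⟪H.n i, x⟫) (hy : H.h i ≤ ⟪H.n i, y⟫) :
    H.d (H.proj x) (H.proj y) ≤ ‖x - y‖ := by
  rw [← dist_eq_norm, dist_edist, d]
  exact ENNReal.toReal_mono (edist_ne_top _ _) (H.rho_proj_le i hx hy)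

theorem d_eq_of_mem_facet {x y : E} {i : ι} (hx : x ∈ H.facet i) (hy : y ∈ H.facet i) :
    H.d x y = ‖x - y‖ := by
  refine le_antisymm ?_ (H.norm_sub_le_d ⟨i, hx⟩ ⟨i, hy⟩)
  have := H.d_proj_le i hx.2.ge hy.2.ge
  rwa [H.proj_eq_self hx.1, H.proj_eq_self hy.1] at this

theorem proj_mem_surface_of_le {x : E} (i : ι) (hx : H.h i ≤ ⟪H.n i, x⟫) :
    H.proj x ∈ H.surface :=
  H.proj_mem_surface (H.not_mem_interior_of_mem_segment i hx hx (left_mem_segment ℝ x x))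

theorem d_le_two_segments {x y z : E} {i j : ι} (hx : x ∈ H.facet i) (hy : y ∈ H.facet j)
    (hi : H.h i ≤ ⟪H.n i, z⟫) (hj : H.h j ≤ ⟪H.n j, z⟫) : H.d x y ≤ ‖x - z‖ + ‖z - y‖ := by
  have h1 := H.d_proj_le i hx.2.ge hi
  have h2 := H.d_proj_le j hj hy.2.ge
  rw [H.proj_eq_self hx.1] at h1
  rw [H.proj_eq_self hy.1] at h2
  have := H.d_triangle ⟨i, hx⟩ (H.proj_mem_surface_of_le i hi) ⟨j, hy⟩
  linarith

theorem d_le_three_segments {x y z w : E} {i j k : ι} (hx : x ∈ H.facet i) (hy : y ∈ H.facet j)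
    (hi : H.h i ≤ ⟪H.n i, z⟫) (hk : H.h k ≤ ⟪H.n k, z⟫) (hk' : H.h k ≤ ⟪H.n k, w⟫)
    (hj : H.h j ≤ ⟪H.n j, w⟫) : H.d x y ≤ ‖x - z‖ + ‖z - w‖ + ‖w - y‖ := by
  have h1 := H.d_proj_le i hx.2.ge hi
  have h2 := H.d_proj_le k hk hk'
  have h3 := H.d_proj_le j hj hy.2.ge
  rw [H.proj_eq_self hx.1] at h1
  rw [H.proj_eq_self hy.1] at h3
  have hz := H.proj_mem_surface_of_le i hi
  have hw := H.proj_mem_surface_of_le j hj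
  have t1 := H.d_triangle ⟨i, hx⟩ hz ⟨j, hy⟩
  have t2 := H.d_triangle hz hw ⟨j, hy⟩
  linarith

theorem d_nonneg (x y : E) : 0 ≤ H.d x y := ENNReal.toReal_nonneg

end HPolyhedron

namespace HPolyhedron

variable {ι : Type} [Finite ι] (H : HPolyhedron ι)

/-- The polygon `p 0, …, p m` runs on the surface, its `k`-th segment lying in the facet `σ k`, and
its end point lying in the facet `σ m`. -/
def IsChain (m : ℕ) (σ : ℕ → ι) (p : ℕ → E) : Prop :=
  (∀ k ≤ m, p k ∈ H.facet (σ k)) ∧ ∀ k < m, p (k + 1) ∈ H.facet (σ k)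

/-- The length of the polygon `p 0, …, p m`. -/
noncomputable def len (m : ℕ) (p : ℕ → E) : ℝ := ∑ k ∈ Finset.range m, ‖p (k + 1) - p k‖

/-- Facet sequences which are constant from index `m` on. -/
def types (ι : Type) (m : ℕ) : Set (ℕ → ι) := {σ | ∀ k, m ≤ k → σ k = σ m}

theorem finite_types (m : ℕ) : (types ι m).Finite := by
  refine Set.Finite.of_finite_image (f := fun σ => fun k : Fin (m + 1) => σ k) (Set.toFinite _) ?_
  intro σ hσ τ hτ h
  funext k
  have hfin : ∀ k ≤ m, σ k = τ k := fun k hk => congrFun h ⟨k, by omega⟩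
  rcases le_total k m with hk | hk
  · exact hfin k hk
  · rw [hσ k hk, hτ k hk, hfin m le_rfl]

theorem len_nonneg (m : ℕ) (p : ℕ → E) : 0 ≤ len m p :=
  Finset.sum_nonneg fun _ _ => norm_nonneg _

variable {H}

theorem IsChain.mem_surface {m : ℕ} {σ : ℕ → ι} {p : ℕ → E} (h : H.IsChain m σ p) {k : ℕ}
    (hk : k ≤ m) : p k ∈ H.surface := ⟨_, h.1 k hk⟩

theorem IsChain.norm_eq_d {m : ℕ} {σ : ℕ → ι} {p : ℕ → E} (h : H.IsChain m σ p) {k : ℕ}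
    (hk : k < m) : ‖p (k + 1) - p k‖ = H.d (p k) (p (k + 1)) := by
  rw [norm_sub_rev, H.d_eq_of_mem_facet (h.1 k hk.le) (h.2 k hk)]

theorem IsChain.d_le_sum {m : ℕ} {σ : ℕ → ι} {p : ℕ → E} (h : H.IsChain m σ p) {k l : ℕ}
    (hkl : k ≤ l) (hl : l ≤ m) :
    H.d (p k) (p l) ≤ ∑ r ∈ Finset.Ico k l, ‖p (r + 1) - p r‖ := by
  induction l, hkl using Nat.le_induction with
  | base => simp [H.d_eq_of_mem_facet (h.1 k hl) (h.1 k hl)]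
  | succ l hkl ih =>
    rw [Finset.sum_Ico_succ_top hkl]
    have := H.d_triangle (h.mem_surface (hkl.trans (Nat.le_of_succ_le hl)))
      (h.mem_surface (Nat.le_of_succ_le hl)) (h.mem_surface hl)
    rw [h.norm_eq_d hl]
    exact this.trans (by gcongr; exact ih (Nat.le_of_succ_le hl))

theorem IsChain.d_le_len {m : ℕ} {σ : ℕ → ι} {p : ℕ → E} (h : H.IsChain m σ p) :
    H.d (p 0) (p m) ≤ len m p := by
  have := h.d_le_sum (Nat.zero_le m) le_rfl
  rwa [← Finset.range_eq_Ico] at this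

theorem IsChain.cons {m : ℕ} {σ : ℕ → ι} {p : ℕ → E} (h : H.IsChain m σ p) {i : ι} {x : E}
    (hx : x ∈ H.facet i) (hp : p 0 ∈ H.facet i) :
    ∃ σ' p', H.IsChain (m + 1) σ' p' ∧ p' 0 = x ∧ p' (m + 1) = p m ∧ σ' 0 = i ∧
      σ' (m + 1) = σ m ∧ len (m + 1) p' = len m p + ‖p 0 - x‖ := by
  refine ⟨fun k => k.casesOn i σ, fun k => k.casesOn x p, ⟨?_, ?_⟩, rfl, rfl, rfl, rfl, ?_⟩
  · rintro (_ | k) hk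
    · exact hx
    · exact h.1 k (by omega)
  · rintro (_ | k) hk
    · exact hp
    · exact h.2 k (by omega)
  · rw [len, Finset.sum_range_succ']; rfl

theorem IsChain.extend {m m' : ℕ} (hm : m ≤ m') {σ : ℕ → ι} {p : ℕ → E} (h : H.IsChain m σ p) :
    ∃ σ' p', H.IsChain m' σ' p' ∧ (∀ k ≤ m, p' k = p k) ∧ (∀ k, m ≤ k → p' k = p m) ∧
      (∀ k ≤ m, σ' k = σ k) ∧ (∀ k, m ≤ k → σ' k = σ m) ∧ len m' p' = len m p := by
  refine ⟨fun k => σ (min k m), fun k => p (min k m), ⟨?_, ?_⟩, ?_, ?_, ?_, ?_, ?_⟩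
  · intro k _
    exact h.1 _ (min_le_right _ _)
  · intro k _
    rcases lt_or_ge k m with hk | hk
    · simp only [min_eq_left hk.le, min_eq_left (Nat.succ_le_of_lt hk)]
      exact h.2 k hk
    · simp only [min_eq_right hk, min_eq_right (hk.trans (Nat.le_succ k))]
      exact h.1 m le_rfl
  · intro k hk; simp [hk]
  · intro k hk; simp [hk]
  · intro k hk; simp [hk]
  · intro k hk; simp [hk]
  · rw [len, len, ← Finset.sum_range_add_sum_Ico _ hm]
    rw [Finset.sum_eq_zero (s := Finset.Ico m m'), add_zero]
    · refine Finset.sum_congr rfl fun k hk => ?_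
      have hk' : k < m := Finset.mem_range.1 hk
      rw [min_eq_left hk'.le, min_eq_left (Nat.succ_le_of_lt hk')]
    · intro k hk
      have hk' := (Finset.mem_Ico.1 hk).1
      rw [min_eq_right hk', min_eq_right (hk'.trans (Nat.le_succ k)), sub_self, norm_zero]

theorem exists_chain_of_path (γ : ℝ → E) (b : ℝ) {j : ι} (hj : γ b ∈ H.facet j) (s : ℕ) :
    ∀ (S : Finset ι), S.card = s → ∀ a ≤ b, ContinuousOn γ (Set.Icc a b) →
      (∀ t ∈ Set.Icc a b, ∃ i ∈ S, γ t ∈ H.facet i) →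
      ∃ m ≤ s, ∃ σ p, H.IsChain m σ p ∧ p 0 = γ a ∧ p m = γ b ∧ σ m = j ∧
        ENNReal.ofReal (len m p) ≤ eVariationOn γ (Set.Icc a b) := by
  classical
  induction s with
  | zero =>
    intro S hS a hab _ hT
    obtain ⟨i, hi, -⟩ := hT a ⟨le_rfl, hab⟩
    rw [Finset.card_eq_zero.1 hS] at hi
    simp at hi
  | succ s ih =>
    intro S hS a hab hc hT
    obtain ⟨i, hiS, hia⟩ := hT a ⟨le_rfl, hab⟩
    have hcomp : IsCompact (Set.Icc a b ∩ γ ⁻¹' H.facet i) :=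
      isCompact_Icc.of_isClosed_subset
        (hc.preimage_isClosed_of_isClosed isClosed_Icc (H.isClosed_facet i)) Set.inter_subset_left
    obtain ⟨t, ht, hmax⟩ := hcomp.exists_isMaxOn ⟨a, ⟨le_rfl, hab⟩, hia⟩ continuous_id.continuousOn
    have hlast : ∀ r ∈ Set.Icc a b, γ r ∈ H.facet i → r ≤ t := fun r hr hri => hmax ⟨hr, hri⟩
    have hsplit := eVariationOn.Icc_add_Icc γ (s := Set.univ) ht.1.1 ht.1.2 trivial
    simp only [Set.univ_inter] at hsplit
    have hfirst : ENNReal.ofReal ‖γ t - γ a‖ ≤ eVariationOn γ (Set.Icc a t) := by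
      rw [← dist_eq_norm, ← edist_dist]
      exact eVariationOn.edist_le γ ⟨ht.1.1, le_rfl⟩ ⟨le_rfl, ht.1.1⟩
    rcases eq_or_lt_of_le ht.1.2 with htb | htb
    · subst htb
      have h0 : H.IsChain 0 (fun _ => j) (fun _ => γ t) :=
        ⟨fun _ _ => hj, fun _ h => absurd h (Nat.not_lt_zero _)⟩
      obtain ⟨σ', p', h1, h2, h3, -, h5, h6⟩ := h0.cons hia ht.2
      refine ⟨1, by omega, σ', p', h1, h2, h3, h5, ?_⟩
      rw [h6, len, Finset.range_zero, Finset.sum_empty, zero_add]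
      exact hfirst
    · have hS' : ∀ r ∈ Set.Icc t b, ∃ k ∈ S.erase i, γ r ∈ H.facet k := by
        have hopen : ∀ r ∈ Set.Ioc t b, ∃ k ∈ S.erase i, γ r ∈ H.facet k := by
          intro r hr
          have hr' : r ∈ Set.Icc a b := ⟨ht.1.1.trans hr.1.le, hr.2⟩
          obtain ⟨k, hk, hkr⟩ := hT r hr'
          refine ⟨k, Finset.mem_erase.2 ⟨?_, hk⟩, hkr⟩
          rintro rfl
          exact absurd (hlast r hr' hkr) (not_le.2 hr.1)
        intro r hr
        rcases eq_or_lt_of_le hr.1 with h | h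
        · subst h
          have hclosed : IsClosed (⋃ k ∈ S.erase i, H.facet k) :=
            (S.erase i).finite_toSet.isClosed_biUnion fun k _ => H.isClosed_facet k
          have hlim : Tendsto γ (𝓝[>] t) (𝓝 (γ t)) := by
            have := (hc t ht.1).mono (Set.Ioc_subset_Icc_self.trans (Set.Icc_subset_Icc_left ht.1.1))
            rwa [ContinuousWithinAt, nhdsWithin_Ioc_eq_nhdsGT htb] at this
          have hmem := hclosed.mem_of_tendsto hlim (by
            filter_upwards [Ioc_mem_nhdsGT htb] with r hr
            simpa using hopen r hr)
          simpa using hmem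
        · exact hopen r ⟨h, hr.2⟩
      obtain ⟨m, hm, σ, p, hch, hp0, hpm, hσ, hlen⟩ := ih (S.erase i)
        (by rw [Finset.card_erase_of_mem hiS, hS]; rfl) t htb.le
        (hc.mono (Set.Icc_subset_Icc_left ht.1.1)) hS'
      obtain ⟨σ', p', h1, h2, h3, -, h5, h6⟩ := hch.cons hia (by rw [hp0]; exact ht.2)
      refine ⟨m + 1, by omega, σ', p', h1, h2, by rw [h3, hpm], by rw [h5, hσ], ?_⟩
      rw [h6, hp0, ENNReal.ofReal_add (len_nonneg _ _) (norm_nonneg _), ← hsplit, add_comm]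
      exact add_le_add hfirst hlen

theorem IsChain.congr {m : ℕ} {σ σ' : ℕ → ι} {p p' : ℕ → E} (h : H.IsChain m σ p)
    (hσ : ∀ k ≤ m, σ' k = σ k) (hp : ∀ k ≤ m, p' k = p k) : H.IsChain m σ' p' :=
  ⟨fun k hk => by rw [hσ k hk, hp k hk]; exact h.1 k hk,
   fun k hk => by rw [hσ k hk.le, hp (k + 1) hk]; exact h.2 k hk⟩

variable (H)

/-- There is a chain of type `σ` from `x` to `y` of length at most `L`. -/
def Reach (m : ℕ) (σ : ℕ → ι) (L : ℝ) (x y : E) : Prop :=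
  ∃ p, H.IsChain m σ p ∧ p 0 = x ∧ p m = y ∧ len m p ≤ L

variable {H}

theorem continuous_len (m : ℕ) : Continuous (len m) := by
  unfold len
  fun_prop

theorem isCompact_setOf_isChain (m : ℕ) (σ : ℕ → ι) :
    IsCompact {p : ℕ → E | (∀ k, p k ∈ H.body) ∧ H.IsChain m σ p} := by
  refine (isCompact_univ_pi fun _ : ℕ => H.isCompact_body).of_isClosed_subset ?_
    fun p hp k _ => hp.1 k
  have h1 : IsClosed {p : ℕ → E | ∀ k, p k ∈ H.body} := by
    simp only [Set.ofPred_forall]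
    exact isClosed_iInter fun k => H.isClosed_body.preimage (continuous_apply k)
  have h2 : IsClosed {p : ℕ → E | ∀ k ≤ m, p k ∈ H.facet (σ k)} := by
    simp only [Set.ofPred_forall]
    exact isClosed_iInter fun k => isClosed_iInter fun _ =>
      (H.isClosed_facet _).preimage (continuous_apply k)
  have h3 : IsClosed {p : ℕ → E | ∀ k < m, p (k + 1) ∈ H.facet (σ k)} := by
    simp only [Set.ofPred_forall]
    exact isClosed_iInter fun k => isClosed_iInter fun _ =>
      (H.isClosed_facet _).preimage (continuous_apply (k + 1))
  exact h1.inter (h2.inter h3)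

theorem Reach.exists_mem {m : ℕ} {σ : ℕ → ι} {L : ℝ} {x y : E} (h : H.Reach m σ L x y) :
    ∃ p : ℕ → E, ((∀ k, p k ∈ H.body) ∧ H.IsChain m σ p) ∧ p 0 = x ∧ p m = y ∧ len m p ≤ L := by
  obtain ⟨p, hp, h0, hm, hl⟩ := h
  refine ⟨fun k => p (min k m), ⟨fun k => (hp.1 _ (min_le_right _ _)).1,
    hp.congr (fun _ _ => rfl) fun k hk => by rw [min_eq_left hk]⟩, by simpa using h0,
    by simpa using hm, ?_⟩
  refine le_of_eq_of_le (Finset.sum_congr rfl fun k hk => ?_) hl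
  have hk' : k < m := Finset.mem_range.1 hk
  simp only [min_eq_left hk'.le, min_eq_left (Nat.succ_le_of_lt hk')]

theorem isClosed_setOf_reach (m : ℕ) (σ : ℕ → ι) (L : ℝ) :
    IsClosed {z : E × E | H.Reach m σ L z.1 z.2} := by
  have hc : IsCompact ({p : ℕ → E | (∀ k, p k ∈ H.body) ∧ H.IsChain m σ p} ∩
      {p | len m p ≤ L}) :=
    (isCompact_setOf_isChain m σ).inter_right (isClosed_le (continuous_len m) continuous_const)
  have himg := (hc.image (f := fun p : ℕ → E => (p 0, p m)) (by fun_prop)).isClosed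
  convert himg using 1
  ext ⟨x, y⟩
  constructor
  · intro h
    obtain ⟨p, hp, h0, hm, hl⟩ := Reach.exists_mem h
    exact ⟨p, ⟨hp, hl⟩, Prod.ext h0 hm⟩
  · rintro ⟨p, ⟨hp, hl⟩, h⟩
    exact ⟨p, hp.2, congrArg Prod.fst h, congrArg Prod.snd h, hl⟩

variable (H)

theorem exists_reach [Fintype ι] {x y : E} {i j : ι} (hx : x ∈ H.facet i) (hy : y ∈ H.facet j) :
    ∃ σ ∈ types ι (Fintype.card ι + 1), σ 0 = i ∧ σ (Fintype.card ι + 1) = j ∧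
      H.Reach (Fintype.card ι + 1) σ (H.d x y) x y := by
  classical
  set N := Fintype.card ι + 1 with hN
  have hpath : ∀ c : ℝ, H.d x y < c →
      ∃ σ ∈ types ι N, σ 0 = i ∧ σ N = j ∧ H.Reach N σ c x y := by
    intro c hc
    have hc0 : 0 ≤ c := (H.d_nonneg x y).trans hc.le
    have hlt : rho H.surface x y < ENNReal.ofReal c :=
      (ENNReal.lt_ofReal_iff_toReal_lt (H.rho_ne_top ⟨i, hx⟩ ⟨j, hy⟩)).2 hc
    obtain ⟨γ, hγ, h0, h1, hT, hl⟩ := exists_path_of_rho_lt hlt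
    obtain ⟨m, hm, σ, p, hch, hp0, hpm, hσ, hlen⟩ := exists_chain_of_path (H := H) γ 1 (j := j)
      (by rw [h1]; exact hy) (Fintype.card ι) Finset.univ rfl 0 zero_le_one hγ.continuousOn
      (fun t ht => by
        obtain ⟨k, hk⟩ := hT t ht
        exact ⟨k, Finset.mem_univ _, hk⟩)
    obtain ⟨σ₁, p₁, hch₁, h10, h1m, h1i, h1j, h1l⟩ := hch.cons hx (by rw [hp0, h0]; exact hx)
    obtain ⟨σ₂, p₂, hch₂, h2p, h2p', h2σ, h2σ', h2l⟩ :=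
      hch₁.extend (show m + 1 ≤ N by omega)
    refine ⟨σ₂, fun k hk => ?_, ?_, ?_, p₂, hch₂, ?_, ?_, ?_⟩
    · rw [h2σ' k (by omega), h2σ' N (by omega)]
    · rw [h2σ 0 (by omega), h1i]
    · rw [h2σ' N (by omega), h1j, hσ]
    · rw [h2p 0 (by omega), h10]
    · rw [h2p' N (by omega), h1m, hpm, h1]
    · rw [h2l, h1l, hp0, h0, sub_self, norm_zero, add_zero]
      exact ((ENNReal.ofReal_lt_ofReal_iff_of_nonneg (len_nonneg _ _)).1 (hlen.trans_lt hl)).le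
  by_contra! hcon
  set S := {σ ∈ types ι N | σ 0 = i ∧ σ N = j} with hS
  have hSf : S.Finite := (finite_types N).subset fun σ h => h.1
  have hex : ∀ σ ∈ S, ∃ c > H.d x y, ¬ H.Reach N σ c x y := by
    rintro σ ⟨h1, h2, h3⟩
    by_contra! hall
    apply hcon σ h1 h2 h3
    set X := {p : ℕ → E | (∀ k, p k ∈ H.body) ∧ H.IsChain N σ p} ∩ {p | p 0 = x ∧ p N = y}
    have hXc : IsCompact X := (isCompact_setOf_isChain N σ).inter_right
      ((isClosed_eq (by fun_prop) continuous_const).inter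
        (isClosed_eq (by fun_prop) continuous_const))
    obtain ⟨p₀, hp₀, h00, h0N, -⟩ := (hall (H.d x y + 1) (by linarith)).exists_mem
    obtain ⟨p, hp, hmin⟩ := hXc.exists_isMinOn ⟨p₀, hp₀, h00, h0N⟩ (continuous_len N).continuousOn
    refine ⟨p, hp.1.2, hp.2.1, hp.2.2, le_of_forall_gt_imp_ge_of_dense fun c hc => ?_⟩
    obtain ⟨q, hq, hq0, hqN, hql⟩ := (hall c hc).exists_mem
    exact (hmin ⟨hq, hq0, hqN⟩ : len N p ≤ len N q).trans hql
  choose! c hc hcR using hex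
  obtain ⟨c₀, hc₀, hc₀'⟩ : ∃ c₀, H.d x y < c₀ ∧ ∀ σ ∈ S, c₀ ≤ c σ := by
    obtain ⟨σ₀, hσ₀, h1, h2, -⟩ := hpath (H.d x y + 1) (by linarith)
    obtain ⟨σ, hσ, hmin⟩ := hSf.exists_minimalFor c S ⟨σ₀, hσ₀, h1, h2⟩
    exact ⟨c σ, hc σ hσ, fun τ hτ => (le_total (c σ) (c τ)).elim id (hmin hτ)⟩
  obtain ⟨σ, hσ, h1, h2, p, hp, h3, h4, h5⟩ := hpath c₀ hc₀
  exact hcR σ ⟨hσ, h1, h2⟩ ⟨p, hp, h3, h4, h5.trans (hc₀' σ ⟨hσ, h1, h2⟩)⟩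

end HPolyhedron

/-! ### Rotations taking one unit vector to another -/

theorem eq_zero_of_inner_eq_zero {a b c x : E} (ha : a ≠ 0) (hb : b ≠ 0) (hc : c ≠ 0)
    (hab : ⟪a, b⟫ = 0) (hac : ⟪a, c⟫ = 0) (hbc : ⟪b, c⟫ = 0)
    (hax : ⟪a, x⟫ = 0) (hbx : ⟪b, x⟫ = 0) (hcx : ⟪c, x⟫ = 0) : x = 0 := by
  by_contra hx
  have hli : LinearIndependent ℝ ![a, b, c, x] := by
    refine linearIndependent_of_ne_zero_of_inner_eq_zero ?_ ?_
    · intro i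
      fin_cases i <;> simpa
    · intro i j hij
      fin_cases i <;> fin_cases j <;> simp_all [real_inner_comm]
  have := hli.fintype_card_le_finrank
  simp at this

theorem eq_smul_of_inner_eq_zero {a b c x : E} (ha : a ≠ 0) (hb : b ≠ 0) (hc : c ≠ 0)
    (hab : ⟪a, b⟫ = 0) (hac : ⟪a, c⟫ = 0) (hbc : ⟪b, c⟫ = 0)
    (hax : ⟪a, x⟫ = 0) (hbx : ⟪b, x⟫ = 0) : x = (⟪c, x⟫ / ‖c‖ ^ 2) • c := by
  have hc' : ‖c‖ ^ 2 ≠ 0 := by positivity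
  refine sub_eq_zero.1 (eq_zero_of_inner_eq_zero ha hb hc hab hac hbc ?_ ?_ ?_)
  · rw [inner_sub_right, inner_smul_right, hax, hac]; simp
  · rw [inner_sub_right, inner_smul_right, hbx, hbc]; simp
  · rw [inner_sub_right, inner_smul_right, real_inner_self_eq_norm_sq, div_mul_cancel₀ _ hc',
      sub_self]

/-- Orientation preserving linear isometries. -/
def IsRotation (S : E ≃ₗᵢ[ℝ] E) : Prop := LinearMap.det S.toLinearEquiv.toLinearMap = 1

theorem isRotation_refl : IsRotation (LinearIsometryEquiv.refl ℝ E) := by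
  simp [IsRotation]

theorem IsRotation.trans {S T : E ≃ₗᵢ[ℝ] E} (hS : IsRotation S) (hT : IsRotation T) :
    IsRotation (S.trans T) := by
  unfold IsRotation at *
  have : (S.trans T).toLinearEquiv.toLinearMap =
      T.toLinearEquiv.toLinearMap ∘ₗ S.toLinearEquiv.toLinearMap := rfl
  rw [this, LinearMap.det_comp, hS, hT, one_mul]

theorem IsRotation.symm {S : E ≃ₗᵢ[ℝ] E} (hS : IsRotation S) : IsRotation S.symm := by
  unfold IsRotation at *
  have h : S.toLinearEquiv.toLinearMap ∘ₗ S.symm.toLinearEquiv.toLinearMap = LinearMap.id := by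
    ext x; simp
  have := congrArg LinearMap.det h
  rwa [LinearMap.det_comp, hS, one_mul, LinearMap.det_id] at this

theorem LinearIsometryEquiv_eq_of_three {S T : E ≃ₗᵢ[ℝ] E} {a b c : E} (ha : a ≠ 0) (hb : b ≠ 0)
    (hc : c ≠ 0) (hab : ⟪a, b⟫ = 0) (hac : ⟪a, c⟫ = 0) (hbc : ⟪b, c⟫ = 0)
    (hSa : S a = T a) (hSb : S b = T b) (hSc : S c = T c) : S = T := by
  ext1 x
  have key : ∀ y, S y = T y → ⟪S y, S x - T x⟫ = 0 := by
    intro y hy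
    rw [inner_sub_right, S.inner_map_map, hy, T.inner_map_map, sub_self]
  have hne : ∀ y : E, y ≠ 0 → S y ≠ 0 := fun y hy h => hy (S.map_eq_zero_iff.1 h)
  refine sub_eq_zero.1 (eq_zero_of_inner_eq_zero (hne a ha) (hne b hb) (hne c hc) ?_ ?_ ?_
    (key a hSa) (key b hSb) (key c hSc)) <;> rwa [S.inner_map_map]

theorem IsRotation.ext {S T : E ≃ₗᵢ[ℝ] E} (hS : IsRotation S) (hT : IsRotation T) {a b : E}
    (ha : a ≠ 0) (hb : b ≠ 0) (hab : ⟪a, b⟫ = 0) (hSa : S a = T a) (hSb : S b = T b) : S = T := by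
  obtain ⟨c, hc, hac, hbc⟩ := exists_ne_zero_inner_eq_zero a b
  set Q := S.trans T.symm with hQ
  have hQrot : IsRotation Q := hS.trans hT.symm
  have hQa : Q a = a := by simp [hQ, hSa]
  have hQb : Q b = b := by simp [hQ, hSb]
  have hQc : Q c = (⟪c, Q c⟫ / ‖c‖ ^ 2) • c := by
    refine eq_smul_of_inner_eq_zero ha hb hc hab hac hbc ?_ ?_
    · rw [← hQa, Q.inner_map_map, hac]
    · rw [← hQb, Q.inner_map_map, hbc]
  set l := ⟪c, Q c⟫ / ‖c‖ ^ 2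
  have hl : |l| = 1 := by
    have h1 : ‖Q c‖ = ‖c‖ := Q.norm_map c
    rw [hQc, norm_smul, Real.norm_eq_abs] at h1
    exact mul_right_cancel₀ (norm_ne_zero_iff.2 hc) (by rw [h1, one_mul])
  rcases (abs_eq zero_le_one).1 hl with h1 | h1
  · refine LinearIsometryEquiv_eq_of_three ha hb hc hab hac hbc hSa hSb ?_
    rw [h1, one_smul] at hQc
    have := congrArg T hQc
    simpa [hQ] using this
  · exfalso
    have hrefl : Q = (ℝ ∙ c)ᗮ.reflection := by
      refine LinearIsometryEquiv_eq_of_three ha hb hc hab hac hbc ?_ ?_ ?_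
      · rw [hQa, Submodule.reflection_mem_subspace_eq_self]
        rw [Submodule.mem_orthogonal_singleton_iff_inner_right, real_inner_comm, hac]
      · rw [hQb, Submodule.reflection_mem_subspace_eq_self]
        rw [Submodule.mem_orthogonal_singleton_iff_inner_right, real_inner_comm, hbc]
      · rw [hQc, h1, Submodule.reflection_orthogonalComplement_singleton_eq_neg]
        simp
    have hd := hQrot
    rw [IsRotation, hrefl] at hd
    have h2 := Submodule.det_reflection (𝕜 := ℝ) (ℝ ∙ c)ᗮ
    rw [Submodule.orthogonal_orthogonal, finrank_span_singleton hc] at h2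
    have h3 : LinearMap.det (ℝ ∙ c)ᗮ.reflection.toLinearEquiv.toLinearMap = (-1) ^ 1 := h2
    rw [h3] at hd
    norm_num at hd

/-- The rotation taking the unit vector `b` to the unit vector `a`, fixing their orthogonal
complement. -/
noncomputable def rot (a b : E) : E ≃ₗᵢ[ℝ] E :=
  ((ℝ ∙ b).reflection).trans (ℝ ∙ (a + b)).reflection

theorem rot_apply (a b x : E) : rot a b x =
    (ℝ ∙ (a + b)).reflection ((ℝ ∙ b).reflection x) := rfl

theorem isRotation_reflection {u : E} (hu : u ≠ 0) : IsRotation (ℝ ∙ u).reflection := by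
  have h1 := Submodule.det_reflection (𝕜 := ℝ) (ℝ ∙ u)
  have h2 := Submodule.finrank_add_finrank_orthogonal (ℝ ∙ u)
  rw [finrank_span_singleton hu, finrank_euclideanSpace_fin] at h2
  have h3 : Module.finrank ℝ (ℝ ∙ u)ᗮ = 2 := by omega
  rw [h3] at h1
  rw [IsRotation]
  refine Eq.trans h1 (by norm_num)

section rot

variable {a b : E} (ha : ‖a‖ = 1) (hb : ‖b‖ = 1) (hab : a ≠ -b)
include ha hb hab

theorem one_add_inner_pos : 0 < 1 + ⟪a, b⟫ := by
  have h1 : 0 < ‖a + b‖ ^ 2 := by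
    have : a + b ≠ 0 := fun h => hab (eq_neg_of_add_eq_zero_left h)
    have := norm_pos_iff.2 this
    positivity
  rw [norm_add_sq_real, ha, hb] at h1
  linarith

theorem isRotation_rot : IsRotation (rot a b) := by
  refine (isRotation_reflection ?_).trans (isRotation_reflection ?_)
  · rintro rfl; simp at hb
  · exact fun h => hab (eq_neg_of_add_eq_zero_left h)

theorem rot_self_right : rot a b b = a := by
  have hp := one_add_inner_pos ha hb hab
  rw [rot_apply, Submodule.reflection_mem_subspace_eq_self (Submodule.mem_span_singleton_self b),
    Submodule.reflection_singleton_apply]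
  have h1 : ⟪a + b, b⟫ = 1 + ⟪a, b⟫ := by
    rw [inner_add_left, real_inner_self_eq_norm_sq, hb]; ring
  have h2 : ((‖a + b‖ : ℝ)) ^ 2 = 2 * (1 + ⟪a, b⟫) := by
    rw [norm_add_sq_real, ha, hb]; ring
  simp only [RCLike.ofReal_real_eq_id, id, h1, h2]
  rw [show (1 + ⟪a, b⟫) / (2 * (1 + ⟪a, b⟫)) = 1 / 2 by field_simp]
  module

theorem rot_of_orthogonal {x : E} (hax : ⟪a, x⟫ = 0) (hbx : ⟪b, x⟫ = 0) : rot a b x = x := by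
  rw [rot_apply, Submodule.reflection_singleton_apply b x, hbx,
    Submodule.reflection_singleton_apply (a + b)]
  simp [inner_add_left, hax, hbx]

theorem rot_self_left : rot a b a = (2 * ⟪a, b⟫) • a - b := by
  by_cases h : a = b
  · have h1 := rot_self_right ha hb hab
    rw [← h] at h1 ⊢
    rw [h1, real_inner_self_eq_norm_sq, ha]
    module
  · have hb0 : b ≠ 0 := by rintro rfl; simp at hb
    have hp := one_add_inner_pos ha hb hab
    have h2 : (‖a + b‖ : ℝ) ^ 2 = 2 * (1 + ⟪a, b⟫) := by
      rw [norm_add_sq_real, ha, hb]; ring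
    rw [rot_apply, Submodule.reflection_singleton_apply, Submodule.reflection_singleton_apply]
    have h3 : ⟪a + b, 2 • (⟪b, a⟫ / (‖b‖ : ℝ) ^ 2) • b - a⟫ =
        (2 * ⟪a, b⟫ - 1) * (1 + ⟪a, b⟫) := by
      rw [inner_sub_right, inner_smul_right_eq_smul, inner_smul_right, inner_add_left,
        inner_add_left, real_inner_self_eq_norm_sq, real_inner_self_eq_norm_sq, ha, hb,
        real_inner_comm a b]
      simp only [nsmul_eq_mul]
      push_cast
      ring
    simp only [RCLike.ofReal_real_eq_id, id]
    rw [h3, h2, hb, real_inner_comm a b]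
    rw [show (2 * ⟪a, b⟫ - 1) * (1 + ⟪a, b⟫) / (2 * (1 + ⟪a, b⟫)) = (2 * ⟪a, b⟫ - 1) / 2 by
      field_simp]
    module

end rot

theorem rot_self (a : E) (ha : ‖a‖ = 1) : rot a a = LinearIsometryEquiv.refl ℝ E := by
  have haa : a ≠ -a := by
    intro h
    have h1 : ⟪a, a⟫ = 1 := by rw [real_inner_self_eq_norm_sq, ha, one_pow]
    have h2 : ⟪a, a⟫ = -1 := by nth_rw 2 [h]; rw [inner_neg_right, h1]
    linarith
  have ha0 : a ≠ 0 := by rintro rfl; simp at ha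
  obtain ⟨q, hq, haq, -⟩ := exists_ne_zero_inner_eq_zero a a
  exact (isRotation_rot ha ha haa).ext isRotation_refl ha0 hq haq
    (by simpa using rot_self_right ha ha haa) (by simpa using rot_of_orthogonal ha ha haa haq haq)

theorem rot_trans_rot {a b c q : E} (ha : ‖a‖ = 1) (hb : ‖b‖ = 1) (hc : ‖c‖ = 1) (hab : a ≠ -b)
    (hbc : b ≠ -c) (hac : a ≠ -c) (hq : q ≠ 0) (haq : ⟪a, q⟫ = 0) (hbq : ⟪b, q⟫ = 0)
    (hcq : ⟪c, q⟫ = 0) : (rot b c).trans (rot a b) = rot a c := by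
  have hc0 : c ≠ 0 := by rintro rfl; simp at hc
  refine ((isRotation_rot hb hc hbc).trans (isRotation_rot ha hb hab)).ext
    (isRotation_rot ha hc hac) hc0 hq hcq ?_ ?_
  · rw [LinearIsometryEquiv.trans_apply, rot_self_right hb hc hbc, rot_self_right ha hb hab,
      rot_self_right ha hc hac]
  · rw [LinearIsometryEquiv.trans_apply, rot_of_orthogonal hb hc hbc hbq hcq,
      rot_of_orthogonal ha hb hab haq hbq, rot_of_orthogonal ha hc hac haq hcq]

/-- The composition of the rotations taking `ν k` to `ν (k - 1)`, …, `ν 1` to `ν 0`. -/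
noncomputable def transport (ν : ℕ → E) : ℕ → (E ≃ₗᵢ[ℝ] E)
  | 0 => LinearIsometryEquiv.refl ℝ E
  | k + 1 => (rot (ν k) (ν (k + 1))).trans (transport ν k)

theorem transport_succ_apply (ν : ℕ → E) (k : ℕ) (x : E) :
    transport ν (k + 1) x = transport ν k (rot (ν k) (ν (k + 1)) x) := rfl

theorem isRotation_transport {ν : ℕ → E} (h1 : ∀ k, ‖ν k‖ = 1) {m : ℕ}
    (h2 : ∀ k < m, ν k ≠ -ν (k + 1)) : IsRotation (transport ν m) := by
  induction m with
  | zero => exact isRotation_refl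
  | succ m ih =>
    exact (isRotation_rot (h1 _) (h1 _) (h2 m (Nat.lt_succ_self m))).trans
      (ih fun k hk => h2 k (Nat.lt_succ_of_lt hk))

theorem transport_apply_normal {ν : ℕ → E} (h1 : ∀ k, ‖ν k‖ = 1) {m : ℕ}
    (h2 : ∀ k < m, ν k ≠ -ν (k + 1)) : transport ν m (ν m) = ν 0 := by
  induction m with
  | zero => rfl
  | succ m ih =>
    rw [transport_succ_apply, rot_self_right (h1 _) (h1 _) (h2 m (Nat.lt_succ_self m)),
      ih fun k hk => h2 k (Nat.lt_succ_of_lt hk)]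

theorem transport_congr {ν ν' : ℕ → E} {m : ℕ} (h : ∀ k ≤ m, ν k = ν' k) :
    transport ν m = transport ν' m := by
  induction m with
  | zero => rfl
  | succ m ih =>
    rw [transport, transport, h m (Nat.le_succ m), h (m + 1) le_rfl,
      ih fun k hk => h k (hk.trans (Nat.le_succ m))]

theorem transport_add (ν : ℕ → E) (k l : ℕ) :
    transport ν (k + l) = (transport (fun r => ν (k + r)) l).trans (transport ν k) := by
  induction l with
  | zero => ext1 x; simp [transport]
  | succ l ih =>
    ext1 x
    rw [← add_assoc, transport_succ_apply, ih, LinearIsometryEquiv.trans_apply,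
      LinearIsometryEquiv.trans_apply, transport_succ_apply, add_assoc]

theorem transport_of_const (ν : ℕ → E) (h1 : ∀ k, ‖ν k‖ = 1) {m : ℕ} (h : ∀ k ≤ m, ν k = ν 0) :
    transport ν m = LinearIsometryEquiv.refl ℝ E := by
  induction m with
  | zero => rfl
  | succ m ih =>
    rw [transport, h m (Nat.le_succ m), h (m + 1) le_rfl, rot_self _ (h1 0),
      ih fun k hk => h k (hk.trans (Nat.le_succ m))]
    rfl

theorem transport_of_axis {ν : ℕ → E} (h1 : ∀ k, ‖ν k‖ = 1) {m : ℕ}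
    (h2 : ∀ k ≤ m, ∀ l ≤ m, ν k ≠ -ν l) {q : E} (hq : q ≠ 0) (hνq : ∀ k ≤ m, ⟪ν k, q⟫ = 0) :
    transport ν m = rot (ν 0) (ν m) := by
  induction m with
  | zero => rw [rot_self _ (h1 0)]; rfl
  | succ m ih =>
    rw [transport, ih (fun k hk l hl => h2 k (hk.trans (Nat.le_succ m)) l (hl.trans (Nat.le_succ m)))
      fun k hk => hνq k (hk.trans (Nat.le_succ m))]
    exact rot_trans_rot (h1 _) (h1 _) (h1 _) (h2 _ (by omega) _ (by omega))
      (h2 _ (by omega) _ (by omega)) (h2 _ (by omega) _ (by omega)) hq (hνq _ (by omega))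
      (hνq _ (by omega)) (hνq _ (by omega))

/-! ### Minimal chains unfold to straight segments -/

theorem norm_smul_add_le {u w : E} (hu : ‖u‖ = 1) {ε : ℝ} (hε : 0 < ε) :
    ‖ε • u + w‖ ≤ ε + ⟪u, w⟫ + ‖w‖ ^ 2 / (2 * ε) := by
  set X := ⟪u, w⟫ + ‖w‖ ^ 2 / (2 * ε) with hX
  have h1 : ‖ε • u + w‖ ^ 2 = ε ^ 2 + 2 * ε * X := by
    rw [norm_add_sq_real, norm_smul, hu, Real.norm_of_nonneg hε.le, inner_smul_left, hX]
    simp only [conj_trivial]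
    field_simp
    ring
  have h2 : 0 ≤ ε + X := by
    have : 0 ≤ 2 * ε * (ε + X) := by nlinarith [sq_nonneg ‖ε • u + w‖]
    exact nonneg_of_mul_nonneg_right this (by positivity)
  have h3 : ‖ε • u + w‖ ≤ ε + X := by
    refine abs_le_of_sq_le_sq' ?_ h2 |>.2
    nlinarith [sq_nonneg X]
  rw [hX] at h3
  linarith

theorem nonneg_of_quadratic_nonneg {B C : ℝ} (hC : 0 ≤ C)
    (h : ∀ t > 0, 0 ≤ t * B + t ^ 2 * C) : 0 ≤ B := by
  by_contra hB
  push Not at hB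
  have h1 := h (-B / (C + 1)) (by apply div_pos <;> linarith)
  have h2 : -B / (C + 1) * B + (-B / (C + 1)) ^ 2 * C = -(B ^ 2 / (C + 1) ^ 2) := by
    field_simp; ring
  rw [h2] at h1
  have : 0 < B ^ 2 / (C + 1) ^ 2 := by
    have := sq_pos_of_neg hB
    positivity
  linarith

theorem norm_add_lt_two {u v : E} (hu : ‖u‖ = 1) (hv : ‖v‖ = 1) (h : u ≠ v) : ‖u + v‖ < 2 := by
  have h1 : 0 < ‖u - v‖ ^ 2 := by
    have := norm_pos_iff.2 (sub_ne_zero.2 h)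
    positivity
  have h2 := norm_add_sq_real u v
  have h3 := norm_sub_sq_real u v
  rw [hu, hv] at h2 h3
  nlinarith [norm_nonneg (u + v)]

namespace HPolyhedron

variable {ι : Type} [Finite ι] {H : HPolyhedron ι}

theorem n_ne_neg {x : E} {i j : ι} (hi : x ∈ H.facet i) (hj : x ∈ H.facet j) :
    H.n i ≠ -H.n j := by
  intro h
  have h1 := H.inner_o_lt i
  have h2 := H.inner_o_lt j
  have h3 := hi.2
  rw [h, inner_neg_left] at h1 h3
  have h4 := hj.2
  linarith

theorem facet_eq_of_n_eq {x : E} {i j : ι} (hi : x ∈ H.facet i) (hj : x ∈ H.facet j)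
    (h : H.n i = H.n j) : H.facet i = H.facet j := by
  have h1 : H.h i = H.h j := by rw [← hi.2, ← hj.2, h]
  ext y
  simp only [facet, h, h1]

theorem inner_sub_eq_zero {x y : E} {i : ι} (hx : x ∈ H.facet i) (hy : y ∈ H.facet i) :
    ⟪H.n i, x - y⟫ = 0 := by rw [inner_sub_right, hx.2, hy.2, sub_self]

section local_straight

variable {z u v : E} {a b : ι} {ε : ℝ} (hu : ‖u‖ = 1) (hv : ‖v‖ = 1) (hε : 0 < ε)
  (hza : z ∈ H.facet a) (hzb : z ∈ H.facet b) (hx : z - ε • u ∈ H.facet a)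
  (hy : z + ε • v ∈ H.facet b) (hd : 2 * ε ≤ H.d (z - ε • u) (z + ε • v))
include hu hv hε hza hzb hx hy hd

theorem inner_eq_of_two_le_d {q : E} (haq : ⟪H.n a, q⟫ = 0) (hbq : ⟪H.n b, q⟫ = 0) :
    0 ≤ ⟪u, q⟫ - ⟪v, q⟫ := by
  refine nonneg_of_quadratic_nonneg (C := ‖q‖ ^ 2 / ε) (by positivity) fun t _ => ?_
  have h1 := H.d_le_two_segments (z := z + t • q) hx hy
    (by rw [inner_add_right, inner_smul_right, haq, hza.2]; simp)
    (by rw [inner_add_right, inner_smul_right, hbq, hzb.2]; simp)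
  have h2 : ‖z - ε • u - (z + t • q)‖ = ‖ε • u + t • q‖ := by
    rw [← norm_neg]; congr 1; module
  have h3 : ‖z + t • q - (z + ε • v)‖ = ‖ε • v + (-t) • q‖ := by
    rw [← norm_neg]; congr 1; module
  have h4 := norm_smul_add_le (w := t • q) hu hε
  have h5 := norm_smul_add_le (w := (-t) • q) hv hε
  rw [inner_smul_right, norm_smul, mul_pow, Real.norm_eq_abs, sq_abs] at h4 h5
  rw [h2, h3] at h1
  have h6 : t ^ 2 * (‖q‖ ^ 2 / ε) = t ^ 2 * ‖q‖ ^ 2 / (2 * ε) + (-t) ^ 2 * ‖q‖ ^ 2 / (2 * ε) := by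
    field_simp; ring
  rw [h6]
  linarith

theorem inner_nonpos_of_two_le_d (huv : u ≠ v) {q : E} (haq : ⟪H.n a, q⟫ = 0)
    (hbq : ⟪H.n b, q⟫ = 0) (huq : ⟪u, q⟫ = ⟪v, q⟫) {c : ι} (hzc : z ∈ H.facet c) :
    ⟪H.n c, q⟫ ≤ 0 := by
  by_contra hγ
  push Not at hγ
  have hau : ⟪H.n a, u⟫ = 0 := by
    have := inner_sub_eq_zero hza hx
    rw [sub_sub_cancel, inner_smul_right] at this
    exact (mul_eq_zero.1 this).resolve_left hε.ne'
  have hbv : ⟪H.n b, v⟫ = 0 := by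
    have := inner_sub_eq_zero hy hzb
    rw [add_sub_cancel_left, inner_smul_right] at this
    exact (mul_eq_zero.1 this).resolve_left hε.ne'
  set δ := ⟪H.n c, q⟫ / 2 with hδ
  have hδ0 : 0 < δ := by positivity
  have hcu : |⟪H.n c, u⟫| ≤ 1 := by
    have := abs_real_inner_le_norm (H.n c) u
    rwa [H.norm_n, hu, one_mul] at this
  have hcv : |⟪H.n c, v⟫| ≤ 1 := by
    have := abs_real_inner_le_norm (H.n c) v
    rwa [H.norm_n, hv, one_mul] at this
  have hlt := norm_add_lt_two hu hv huv
  have key : 0 ≤ δ * (‖u + v‖ - 2) := by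
    refine nonneg_of_quadratic_nonneg
      (C := ‖q - δ • u‖ ^ 2 / (2 * ε) + ‖-(q + δ • v)‖ ^ 2 / (2 * ε)) (by positivity)
      fun t ht => ?_
    have hc1 : 0 ≤ t * (⟪H.n c, q⟫ - δ * ⟪H.n c, u⟫) := by
      refine mul_nonneg ht.le ?_
      have := (abs_le.1 hcu).2
      nlinarith
    have hc2 : 0 ≤ t * (⟪H.n c, q⟫ + δ * ⟪H.n c, v⟫) := by
      refine mul_nonneg ht.le ?_
      have := (abs_le.1 hcv).1
      nlinarith
    have h1 := H.d_le_three_segments (z := z + t • (q - δ • u)) (w := z + t • (q + δ • v)) (k := c)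
      hx hy
      (by simp only [inner_add_right, inner_sub_right, inner_smul_right, haq, hau, hza.2]; simp)
      (by simp only [inner_add_right, inner_sub_right, inner_smul_right, hzc.2]; linarith)
      (by simp only [inner_add_right, inner_smul_right, hzc.2]; linarith)
      (by simp only [inner_add_right, inner_smul_right, hbq, hbv, hzb.2]; simp)
    have h2 : ‖z - ε • u - (z + t • (q - δ • u))‖ = ‖ε • u + t • (q - δ • u)‖ := by
      rw [← norm_neg]; congr 1; module
    have h3 : ‖z + t • (q + δ • v) - (z + ε • v)‖ = ‖ε • v + t • (-(q + δ • v))‖ := by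
      rw [← norm_neg]; congr 1; module
    have h4 : ‖z + t • (q - δ • u) - (z + t • (q + δ • v))‖ = t * δ * ‖u + v‖ := by
      rw [show z + t • (q - δ • u) - (z + t • (q + δ • v)) = -((t * δ) • (u + v)) by module,
        norm_neg, norm_smul, Real.norm_of_nonneg (by positivity)]
    have h5 := norm_smul_add_le (w := t • (q - δ • u)) hu hε
    have h6 := norm_smul_add_le (w := t • (-(q + δ • v))) hv hε
    rw [inner_smul_right, norm_smul, mul_pow, Real.norm_eq_abs, sq_abs] at h5 h6
    rw [inner_sub_right, inner_smul_right, real_inner_self_eq_norm_sq, hu] at h5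
    rw [inner_neg_right, inner_add_right, inner_smul_right, real_inner_self_eq_norm_sq, hv] at h6
    rw [h2, h3, h4] at h1
    rw [huq] at h5
    have h7 : t ^ 2 * (‖q - δ • u‖ ^ 2 / (2 * ε) + ‖-(q + δ • v)‖ ^ 2 / (2 * ε)) =
        t ^ 2 * ‖q - δ • u‖ ^ 2 / (2 * ε) + t ^ 2 * ‖-(q + δ • v)‖ ^ 2 / (2 * ε) := by ring
    rw [h7]
    linarith
  nlinarith

/-- If two segments of facets meeting at `z` make up a shortest path, then the second one
continues the first one after unfolding, and some line through `z` is parallel to all facets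
through `z`. -/
theorem rot_eq_of_two_le_d : rot (H.n a) (H.n b) v = u ∧
    ∃ q : E, q ≠ 0 ∧ ∀ c, z ∈ H.facet c → ⟪H.n c, q⟫ = 0 := by
  have hau : ⟪H.n a, u⟫ = 0 := by
    have := inner_sub_eq_zero hza hx
    rw [sub_sub_cancel, inner_smul_right] at this
    exact (mul_eq_zero.1 this).resolve_left hε.ne'
  have hbv : ⟪H.n b, v⟫ = 0 := by
    have := inner_sub_eq_zero hy hzb
    rw [add_sub_cancel_left, inner_smul_right] at this
    exact (mul_eq_zero.1 this).resolve_left hε.ne'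
  have hcu : ∀ c, z ∈ H.facet c → 0 ≤ ⟪H.n c, u⟫ := by
    intro c hc
    have := hx.1 c
    rw [inner_sub_right, inner_smul_right, hc.2] at this
    exact nonneg_of_mul_nonneg_right (by linarith) hε
  have hcv : ∀ c, z ∈ H.facet c → ⟪H.n c, v⟫ ≤ 0 := by
    intro c hc
    have := hy.1 c
    rw [inner_add_right, inner_smul_right, hc.2] at this
    exact nonpos_of_mul_nonpos_right (by linarith) hε
  have hab := n_ne_neg hza hzb
  by_cases huv : u = v
  · subst huv
    refine ⟨rot_of_orthogonal (H.norm_n a) (H.norm_n b) hab hau hbv, u, ?_, fun c hc =>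
      le_antisymm (hcv c hc) (hcu c hc)⟩
    rintro rfl
    simp at hu
  have hnab : H.n a ≠ H.n b := by
    intro h
    have hf := facet_eq_of_n_eq hza hzb h
    rw [H.d_eq_of_mem_facet hx (hf ▸ hy), show z - ε • u - (z + ε • v) = -(ε • (u + v)) by module,
      norm_neg, norm_smul, Real.norm_of_nonneg hε.le] at hd
    have := norm_add_lt_two hu hv huv
    nlinarith
  obtain ⟨q, hq, haq, hbq⟩ := exists_ne_zero_inner_eq_zero (H.n a) (H.n b)
  have huq : ⟪u, q⟫ = ⟪v, q⟫ := by
    have h1 := inner_eq_of_two_le_d hu hv hε hza hzb hx hy hd haq hbq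
    have h2 := inner_eq_of_two_le_d (q := -q) hu hv hε hza hzb hx hy hd (by simpa) (by simpa)
    rw [inner_neg_right, inner_neg_right] at h2
    linarith
  refine ⟨?_, q, hq, fun c hc => le_antisymm
    (inner_nonpos_of_two_le_d hu hv hε hza hzb hx hy hd huv haq hbq huq hc) ?_⟩
  swap
  · have := inner_nonpos_of_two_le_d (q := -q) hu hv hε hza hzb hx hy hd huv (by simpa) (by simpa)
      (by simpa) hc
    rw [inner_neg_right] at this
    linarith
  set R := rot (H.n a) (H.n b)
  have hRb : R (H.n b) = H.n a := rot_self_right (H.norm_n a) (H.norm_n b) hab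
  have hRa : R (H.n a) = (2 * ⟪H.n a, H.n b⟫) • H.n a - H.n b :=
    rot_self_left (H.norm_n a) (H.norm_n b) hab
  have hRq : R q = q := rot_of_orthogonal (H.norm_n a) (H.norm_n b) hab haq hbq
  have haRv : ⟪H.n a, R v⟫ = 0 := by rw [← hRb, R.inner_map_map, hbv]
  have hqRv : ⟪q, R v⟫ = ⟪q, u⟫ := by
    nth_rw 1 [← hRq]
    rw [R.inner_map_map, real_inner_comm v q, real_inner_comm u q, huq]
  have hbRv : 0 ≤ ⟪H.n b, R v⟫ := by
    have h1 : H.n b = (2 * ⟪H.n a, H.n b⟫) • H.n a - R (H.n a) := by rw [hRa]; module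
    rw [h1, inner_sub_left, inner_smul_left, haRv, R.inner_map_map]
    have := hcv a hza
    simpa
  set m := H.n b - ⟪H.n a, H.n b⟫ • H.n a with hm
  have hna : ⟪H.n a, H.n a⟫ = 1 := H.inner_n_self a
  have ham : ⟪H.n a, m⟫ = 0 := by rw [hm, inner_sub_right, inner_smul_right, hna]; ring
  have hqm : ⟪q, m⟫ = 0 := by
    rw [hm, inner_sub_right, inner_smul_right, real_inner_comm (H.n a) q,
      real_inner_comm (H.n b) q, haq, hbq]; ring
  have hm0 : m ≠ 0 := by
    intro h
    have h1 : H.n b = ⟪H.n a, H.n b⟫ • H.n a := sub_eq_zero.1 h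
    have h2 : |⟪H.n a, H.n b⟫| = 1 := by
      have := congrArg norm h1
      rw [norm_smul, H.norm_n, H.norm_n, mul_one] at this
      exact this.symm
    rcases (abs_eq zero_le_one).1 h2 with h3 | h3
    · rw [h3, one_smul] at h1; exact hnab h1.symm
    · rw [h3, neg_one_smul] at h1; exact hab (by rw [h1, neg_neg])
  have hna0 : H.n a ≠ 0 := by
    intro h; rw [h, inner_zero_left] at hna; exact zero_ne_one hna
  have hmu : 0 ≤ ⟪m, u⟫ := by
    rw [hm, inner_sub_left, inner_smul_left, hau, mul_zero, sub_zero]; exact hcu b hzb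
  have hmv : 0 ≤ ⟪m, R v⟫ := by
    rw [hm, inner_sub_left, inner_smul_left, haRv, mul_zero, sub_zero]; exact hbRv
  have hκ : R v - u = (⟪m, R v - u⟫ / ‖m‖ ^ 2) • m := by
    refine eq_smul_of_inner_eq_zero hna0 hq hm0 haq ham hqm ?_ ?_
    · rw [inner_sub_right, haRv, hau, sub_zero]
    · rw [inner_sub_right, hqRv, sub_self]
  have horth : ⟪R v - u, R v + u⟫ = 0 := by
    rw [inner_sub_left, inner_add_right, inner_add_right, real_inner_self_eq_norm_sq,
      real_inner_self_eq_norm_sq, R.norm_map, hu, hv, real_inner_comm]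
    ring
  rw [hκ, inner_smul_left, conj_trivial] at horth
  have hzero : ⟪m, R v - u⟫ = 0 := by
    rcases mul_eq_zero.1 horth with h | h
    · have : ‖m‖ ^ 2 ≠ 0 := by positivity
      exact (div_eq_zero_iff.1 h).resolve_right this
    · rw [inner_add_right] at h
      rw [inner_sub_right]
      linarith
  rw [hzero, zero_div, zero_smul] at hκ
  exact sub_eq_zero.1 hκ

end local_straight

theorem IsChain.sum_le_d {m : ℕ} {σ : ℕ → ι} {p : ℕ → E} (h : H.IsChain m σ p)
    (hmin : len m p ≤ H.d (p 0) (p m)) {k l : ℕ} (hkl : k ≤ l) (hl : l ≤ m) :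
    ∑ r ∈ Finset.Ico k l, ‖p (r + 1) - p r‖ ≤ H.d (p k) (p l) := by
  have h1 := h.d_le_sum (Nat.zero_le k) (hkl.trans hl)
  have h2 := h.d_le_sum hl le_rfl
  have h3 := H.d_triangle (h.mem_surface (Nat.zero_le m)) (h.mem_surface (hkl.trans hl))
    (h.mem_surface le_rfl)
  have h4 := H.d_triangle (h.mem_surface (hkl.trans hl)) (h.mem_surface hl)
    (h.mem_surface le_rfl)
  have h5 : len m p = ∑ r ∈ Finset.Ico 0 k, ‖p (r + 1) - p r‖ +
      (∑ r ∈ Finset.Ico k l, ‖p (r + 1) - p r‖ + ∑ r ∈ Finset.Ico l m, ‖p (r + 1) - p r‖) := by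
    rw [len, Finset.range_eq_Ico, Finset.sum_Ico_consecutive _ hkl hl,
      Finset.sum_Ico_consecutive _ (Nat.zero_le k) (hkl.trans hl)]
  linarith

/-- The isometry unfolding the `k`-th facet of the sequence `σ` to the plane of the first one. -/
noncomputable abbrev unfold (H : HPolyhedron ι) (σ : ℕ → ι) (k : ℕ) : E ≃ₗᵢ[ℝ] E :=
  transport (fun r => H.n (σ r)) k

/-- Two successive nontrivial steps of a minimal chain. -/
theorem IsChain.unfold_consecutive {m : ℕ} {σ : ℕ → ι} {p : ℕ → E} (h : H.IsChain m σ p)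
    (hmin : len m p ≤ H.d (p 0) (p m)) {k l : ℕ} (hkl : k < l) (hl : l < m)
    (hk0 : p (k + 1) ≠ p k) (hl0 : p (l + 1) ≠ p l)
    (hz : ∀ r, k < r → r ≤ l → p r = p l) :
    H.unfold σ l = (rot (H.n (σ k)) (H.n (σ l))).trans (H.unfold σ k) ∧
    H.unfold σ l (‖p (l + 1) - p l‖⁻¹ • (p (l + 1) - p l)) =
      H.unfold σ k (‖p (k + 1) - p k‖⁻¹ • (p (k + 1) - p k)) := by
  have hk1 : 0 < ‖p (k + 1) - p k‖ := norm_pos_iff.2 (sub_ne_zero.2 hk0)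
  have hl1 : 0 < ‖p (l + 1) - p l‖ := norm_pos_iff.2 (sub_ne_zero.2 hl0)
  set s := ‖p (k + 1) - p k‖ with hs
  set t := ‖p (l + 1) - p l‖ with ht
  set u := s⁻¹ • (p (k + 1) - p k) with hu
  set v := t⁻¹ • (p (l + 1) - p l) with hv
  have hu1 : ‖u‖ = 1 := by
    rw [hu, norm_smul, norm_inv, norm_norm, ← hs, inv_mul_cancel₀ hk1.ne']
  have hv1 : ‖v‖ = 1 := by
    rw [hv, norm_smul, norm_inv, norm_norm, ← ht, inv_mul_cancel₀ hl1.ne']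
  have hsu : p k = p l - s • u := by
    rw [hu, smul_smul, mul_inv_cancel₀ hk1.ne', one_smul, hz (k + 1) (by omega) (by omega)]
    abel
  have htv : p (l + 1) = p l + t • v := by
    rw [hv, smul_smul, mul_inv_cancel₀ hl1.ne', one_smul]; abel
  have hzf : ∀ r, k ≤ r → r ≤ l → p l ∈ H.facet (σ r) := by
    intro r hkr hrl
    rcases eq_or_lt_of_le hkr with rfl | hkr
    · rw [← hz (k + 1) (by omega) (by omega)]
      exact h.2 k (by omega)
    · rw [← hz r hkr hrl]; exact h.1 r (by omega)
  set ε := min s t with hεdef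
  have hε : 0 < ε := lt_min hk1 hl1
  have hx : p l - ε • u ∈ H.facet (σ k) := by
    have := (H.convex_facet (σ k)) (hzf k le_rfl hkl.le) (h.1 k (by omega))
      (a := 1 - ε / s) (b := ε / s) (by
        have : ε / s ≤ 1 := (div_le_one hk1).2 (min_le_left _ _)
        linarith) (by positivity) (by ring)
    have h1 : (ε / s) • s • u = ε • u := by rw [smul_smul, div_mul_cancel₀ _ hk1.ne']
    rw [hsu, smul_sub, h1] at this
    convert this using 1
    module
  have hy : p l + ε • v ∈ H.facet (σ l) := by
    have := (H.convex_facet (σ l)) (hzf l hkl.le le_rfl) (h.2 l (by omega))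
      (a := 1 - ε / t) (b := ε / t) (by
        have : ε / t ≤ 1 := (div_le_one hl1).2 (min_le_right _ _)
        linarith) (by positivity) (by ring)
    have h1 : (ε / t) • t • v = ε • v := by rw [smul_smul, div_mul_cancel₀ _ hl1.ne']
    rw [htv, smul_add, h1] at this
    convert this using 1
    module
  have hd : 2 * ε ≤ H.d (p l - ε • u) (p l + ε • v) := by
    have h1 := h.sum_le_d hmin (k := k) (l := l + 1) (by omega) (by omega)
    have h2 : ∑ r ∈ Finset.Ico k (l + 1), ‖p (r + 1) - p r‖ = s + t := by
      rw [Finset.sum_Ico_succ_top hkl.le, Finset.sum_eq_sum_Ico_succ_bot hkl,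
        Finset.sum_eq_zero, add_zero]
      intro r hr
      rw [Finset.mem_Ico] at hr
      rw [hz r (by omega) (by omega), hz (r + 1) (by omega) (by omega), sub_self, norm_zero]
    have h3 := H.d_triangle (x := p k) (y := p l - ε • u) (z := p (l + 1)) ⟨_, h.1 k (by omega)⟩
      ⟨_, hx⟩ ⟨_, h.2 l (by omega)⟩
    have h4 := H.d_triangle (x := p l - ε • u) (y := p l + ε • v) (z := p (l + 1)) ⟨_, hx⟩
      ⟨_, hy⟩ ⟨_, h.2 l (by omega)⟩
    have h5 : H.d (p k) (p l - ε • u) = s - ε := by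
      rw [H.d_eq_of_mem_facet (h.1 k (by omega)) hx, hsu,
        show p l - s • u - (p l - ε • u) = -((s - ε) • u) by module, norm_neg, norm_smul, hu1,
        Real.norm_of_nonneg (sub_nonneg.2 (min_le_left _ _)), mul_one]
    have h6 : H.d (p l + ε • v) (p (l + 1)) = t - ε := by
      rw [H.d_eq_of_mem_facet hy (h.2 l (by omega)), htv,
        show p l + ε • v - (p l + t • v) = -((t - ε) • v) by module, norm_neg, norm_smul, hv1,
        Real.norm_of_nonneg (sub_nonneg.2 (min_le_right _ _)), mul_one]
    linarith
  obtain ⟨hR, q, hq, hcq⟩ := rot_eq_of_two_le_d hu1 hv1 hε (hzf k le_rfl hkl.le)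
    (hzf l hkl.le le_rfl) hx hy hd
  have hT : H.unfold σ l = (rot (H.n (σ k)) (H.n (σ l))).trans (H.unfold σ k) := by
    obtain ⟨j, rfl⟩ := Nat.exists_eq_add_of_le hkl.le
    rw [unfold, transport_add, transport_of_axis (q := q) (fun r => H.norm_n _)
      (fun r hr r' hr' => n_ne_neg (hzf _ (by omega) (by omega)) (hzf _ (by omega) (by omega))) hq
      (fun r hr => hcq _ (hzf _ (by omega) (by omega)))]
    rfl
  refine ⟨hT, ?_⟩
  rw [hT, LinearIsometryEquiv.trans_apply, hR]

/-- A minimal chain unfolds to a straight segment. -/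
theorem IsChain.exists_direction {m : ℕ} {σ : ℕ → ι} {p : ℕ → E} (h : H.IsChain m σ p)
    (hmin : len m p ≤ H.d (p 0) (p m)) : ∃ e : E, ‖e‖ = 1 ∧
      ∀ k < m, H.unfold σ k (p (k + 1) - p k) = ‖p (k + 1) - p k‖ • e := by
  suffices ∀ l ≤ m, ∃ e : E, ‖e‖ = 1 ∧
      ∀ k < l, H.unfold σ k (p (k + 1) - p k) = ‖p (k + 1) - p k‖ • e from this m le_rfl
  intro l
  induction l with
  | zero =>
    intro _
    exact ⟨EuclideanSpace.single 0 1, by simp, fun k hk => absurd hk (Nat.not_lt_zero k)⟩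
  | succ l ih =>
    intro hl
    obtain ⟨e, he, hek⟩ := ih (by omega)
    by_cases hl0 : p (l + 1) = p l
    · refine ⟨e, he, fun k hk => ?_⟩
      rcases Nat.lt_succ_iff_lt_or_eq.1 hk with hk | rfl
      · exact hek k hk
      · rw [hl0]; simp
    have hl1 : ‖p (l + 1) - p l‖ ≠ 0 := norm_ne_zero_iff.2 (sub_ne_zero.2 hl0)
    by_cases hall : ∀ k < l, p (k + 1) = p k
    · refine ⟨H.unfold σ l (‖p (l + 1) - p l‖⁻¹ • (p (l + 1) - p l)), ?_, fun k hk => ?_⟩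
      · rw [LinearIsometryEquiv.norm_map, norm_smul, norm_inv, norm_norm, inv_mul_cancel₀ hl1]
      · rcases Nat.lt_succ_iff_lt_or_eq.1 hk with hk | rfl
        · rw [hall k hk]; simp
        · rw [← map_smul, smul_smul, mul_inv_cancel₀ hl1, one_smul]
    push Not at hall
    obtain ⟨k₀, hk₀, hk₀'⟩ := hall
    classical
    set k := Nat.findGreatest (fun k => k < l ∧ p (k + 1) ≠ p k) l with hkdef
    have hk : k < l ∧ p (k + 1) ≠ p k :=
      Nat.findGreatest_spec (P := fun k => k < l ∧ p (k + 1) ≠ p k) hk₀.le ⟨hk₀, hk₀'⟩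
    have hgt : ∀ r, k < r → r < l → p (r + 1) = p r := by
      intro r hkr hrl
      by_contra hne
      exact Nat.findGreatest_is_greatest hkr hrl.le ⟨hrl, hne⟩
    have hz : ∀ r, r ≤ l → k < r → p r = p l := by
      intro r hrl
      induction hrl using Nat.decreasingInduction with
      | self => intro _; rfl
      | of_succ r hr ihr =>
        intro hkr
        rw [← ihr (by omega), hgt r hkr hr]
    have hkey := (h.unfold_consecutive hmin hk.1 (by omega) hk.2 hl0
      (fun r h1 h2 => hz r h2 h1)).2
    have hk1 : ‖p (k + 1) - p k‖ ≠ 0 := norm_ne_zero_iff.2 (sub_ne_zero.2 hk.2)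
    rw [map_smul (H.unfold σ k), hek k hk.1, smul_smul, inv_mul_cancel₀ hk1,
      one_smul] at hkey
    refine ⟨e, he, fun r hr => ?_⟩
    rcases Nat.lt_succ_iff_lt_or_eq.1 hr with hr | rfl
    · exact hek r hr
    · rw [← hkey, ← map_smul, smul_smul, mul_inv_cancel₀ hl1, one_smul]

end HPolyhedron

/-! ### Unfolded displacement of chains -/

theorem exists_inner_ne_zero {α : Type*} [Finite α] (f : α → E) (hf : ∀ a, f a ≠ 0) :
    ∃ u : E, ∀ a, ⟪f a, u⟫ ≠ 0 := by
  obtain ⟨u, -, hu⟩ := Module.Dual.exists_forall_mem_ne_zero_of_forall_exists (K := ℝ)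
    (p := ⊤) (f := fun a => (innerSL ℝ (f a)).toLinearMap) (fun a => ⟨f a, trivial, by simpa using hf a⟩)
  exact ⟨u, fun a => by simpa using hu a⟩

/-- A nonzero vector orthogonal to the unit vector `n` and in general position otherwise. -/
theorem exists_orthogonal_inner_ne_zero {n : E} (hn : ‖n‖ = 1) {α : Type*} [Finite α] (f : α → E)
    (hf : ∀ a, ∀ c : ℝ, f a ≠ c • n) :
    ∃ w : E, w ≠ 0 ∧ ⟪n, w⟫ = 0 ∧ ∀ a, ⟪f a, w⟫ ≠ 0 := by
  have hnn : ⟪n, n⟫ = 1 := by rw [real_inner_self_eq_norm_sq, hn, one_pow]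
  obtain ⟨q, hq, hnq, -⟩ := exists_ne_zero_inner_eq_zero n n
  obtain ⟨u, hu⟩ := exists_inner_ne_zero
    (fun a : Option α => a.elim q fun a => f a - ⟪n, f a⟫ • n) (by
      rintro (_ | a)
      · exact hq
      · exact sub_ne_zero.2 (hf a _))
  have hw : ∀ a, ⟪f a, u - ⟪n, u⟫ • n⟫ ≠ 0 := by
    intro a
    have := hu (some a)
    simp only [Option.elim_some, inner_sub_left, inner_smul_left, conj_trivial] at this
    rw [inner_sub_right, inner_smul_right, real_inner_comm n (f a)]
    rwa [mul_comm ⟪n, u⟫]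
  refine ⟨u - ⟪n, u⟫ • n, ?_, by rw [inner_sub_right, inner_smul_right, hnn]; ring, hw⟩
  intro h
  apply hu none
  have h1 : u = ⟪n, u⟫ • n := sub_eq_zero.1 h
  simp only [Option.elim_none]
  rw [h1, inner_smul_right, real_inner_comm n q, hnq, mul_zero]

namespace HPolyhedron

variable {ι : Type} [Finite ι] {H : HPolyhedron ι}

/-- The displacement of the unfolded chain. -/
noncomputable def disp (H : HPolyhedron ι) (m : ℕ) (σ : ℕ → ι) (p : ℕ → E) : E :=
  ∑ k ∈ Finset.range m, H.unfold σ k (p (k + 1) - p k)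

theorem norm_disp_le_len (m : ℕ) (σ : ℕ → ι) (p : ℕ → E) : ‖H.disp m σ p‖ ≤ len m p :=
  (norm_sum_le _ _).trans_eq (Finset.sum_congr rfl fun k _ => (H.unfold σ k).norm_map _)

theorem IsChain.n_ne_neg {m : ℕ} {σ : ℕ → ι} {p : ℕ → E} (h : H.IsChain m σ p) {k : ℕ}
    (hk : k < m) : H.n (σ k) ≠ -H.n (σ (k + 1)) :=
  HPolyhedron.n_ne_neg (h.2 k hk) (h.1 (k + 1) hk)

theorem IsChain.isRotation_unfold {m : ℕ} {σ : ℕ → ι} {p : ℕ → E} (h : H.IsChain m σ p) {k : ℕ}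
    (hk : k ≤ m) : IsRotation (H.unfold σ k) :=
  isRotation_transport (fun _ => H.norm_n _) fun _ hr => h.n_ne_neg (by omega)

theorem IsChain.unfold_n {m : ℕ} {σ : ℕ → ι} {p : ℕ → E} (h : H.IsChain m σ p) {k : ℕ}
    (hk : k ≤ m) : H.unfold σ k (H.n (σ k)) = H.n (σ 0) :=
  transport_apply_normal (ν := fun r => H.n (σ r)) (fun _ => H.norm_n _)
    fun _ hr => h.n_ne_neg (by omega)

theorem IsChain.unfold_succ_sub {m : ℕ} {σ : ℕ → ι} {p : ℕ → E} (h : H.IsChain m σ p)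
    {k : ℕ} (hk : k < m) {y : E} (hy : y ∈ H.facet (σ k)) (hy' : y ∈ H.facet (σ (k + 1))) :
    H.unfold σ (k + 1) (y - p (k + 1)) = H.unfold σ k (y - p (k + 1)) := by
  rw [unfold, transport_succ_apply, rot_of_orthogonal (H.norm_n _) (H.norm_n _) (h.n_ne_neg hk)]
  · exact inner_sub_eq_zero hy (h.2 k hk)
  · exact inner_sub_eq_zero hy' (h.1 (k + 1) hk)

theorem IsChain.disp_eq {m : ℕ} {σ : ℕ → ι} {p p' : ℕ → E} (h : H.IsChain m σ p)
    (h' : H.IsChain m σ p') {k : ℕ} (hk : k ≤ m) :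
    H.disp k σ p' = H.disp k σ p + H.unfold σ k (p' k - p k) - (p' 0 - p 0) := by
  induction k with
  | zero => simp [disp, unfold, transport]
  | succ k ih =>
    have h1 := ih (by omega)
    rw [h.unfold_succ_sub hk (h'.2 k hk) (h'.1 (k + 1) hk)]
    unfold disp at *
    rw [Finset.sum_range_succ, h1, Finset.sum_range_succ]
    simp only [map_sub]
    abel

theorem IsChain.convexComb {m : ℕ} {σ : ℕ → ι} {p p' : ℕ → E} (h : H.IsChain m σ p)
    (h' : H.IsChain m σ p') {t : ℝ} (ht0 : 0 ≤ t) (ht1 : t ≤ 1) :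
    H.IsChain m σ (fun k => (1 - t) • p k + t • p' k) :=
  ⟨fun k hk => H.convex_facet _ (h.1 k hk) (h'.1 k hk) (by linarith) ht0 (by ring),
    fun k hk => H.convex_facet _ (h.2 k hk) (h'.2 k hk) (by linarith) ht0 (by ring)⟩

theorem len_convexComb_le {m : ℕ} {p p' : ℕ → E} {t : ℝ} (ht0 : 0 ≤ t) (ht1 : t ≤ 1) :
    len m (fun k => (1 - t) • p k + t • p' k) ≤ (1 - t) * len m p + t * len m p' := by
  unfold len
  rw [Finset.mul_sum, Finset.mul_sum, ← Finset.sum_add_distrib]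
  refine Finset.sum_le_sum fun k _ => ?_
  rw [show (1 - t) • p (k + 1) + t • p' (k + 1) - ((1 - t) • p k + t • p' k) =
    (1 - t) • (p (k + 1) - p k) + t • (p' (k + 1) - p' k) by module]
  refine (norm_add_le _ _).trans_eq ?_
  rw [norm_smul, norm_smul, Real.norm_of_nonneg ht0, Real.norm_of_nonneg (by linarith)]

theorem IsChain.disp_eq_smul {m : ℕ} {σ : ℕ → ι} {p : ℕ → E} {e : E}
    (he : ∀ k < m, H.unfold σ k (p (k + 1) - p k) = ‖p (k + 1) - p k‖ • e) :
    H.disp m σ p = len m p • e := by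
  rw [disp, len, Finset.sum_smul]
  exact Finset.sum_congr rfl fun k hk => he k (Finset.mem_range.1 hk)

theorem IsChain.norm_disp_eq {m : ℕ} {σ : ℕ → ι} {p : ℕ → E} (h : H.IsChain m σ p)
    (hmin : len m p ≤ H.d (p 0) (p m)) : ‖H.disp m σ p‖ = H.d (p 0) (p m) := by
  obtain ⟨e, he, hek⟩ := h.exists_direction hmin
  rw [IsChain.disp_eq_smul hek, norm_smul, he, mul_one, Real.norm_of_nonneg (len_nonneg _ _)]
  exact le_antisymm hmin h.d_le_len

theorem Reach.mono {m : ℕ} {σ : ℕ → ι} {L L' : ℝ} {x y : E} (h : H.Reach m σ L x y)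
    (hL : L ≤ L') : H.Reach m σ L' x y := by
  obtain ⟨p, h1, h2, h3, h4⟩ := h
  exact ⟨p, h1, h2, h3, h4.trans hL⟩

/-! ### Points in the relative interior of a facet -/

/-- The only facet through `x` is the facet `i`. -/
def Simple (H : HPolyhedron ι) (i : ι) (x : E) : Prop :=
  x ∈ H.facet i ∧ ∀ c, x ∈ H.facet c → H.n c = H.n i

theorem eventually_of_inner_lt (c : ι) {x : E} (h : ⟪H.n c, x⟫ < H.h c) :
    ∀ᶠ y in 𝓝 x, ⟪H.n c, y⟫ < H.h c := by
  have hc : Continuous fun y : E => ⟪H.n c, y⟫ := continuous_const.inner continuous_id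
  exact hc.continuousAt.eventually_lt continuousAt_const h

theorem eventually_forall_of_inner_lt (H : HPolyhedron ι) (x : E) :
    ∀ᶠ y in 𝓝 x, ∀ c, ⟪H.n c, x⟫ < H.h c → ⟪H.n c, y⟫ < H.h c := by
  rw [eventually_all]
  intro c
  by_cases h : ⟪H.n c, x⟫ < H.h c
  · filter_upwards [eventually_of_inner_lt c h] with y hy _ using hy
  · exact Eventually.of_forall fun y hy => absurd hy h

theorem Simple.eventually {i : ι} {x : E} (h : H.Simple i x) :
    ∀ᶠ y in 𝓝 x, ⟪H.n i, y - x⟫ = 0 → H.Simple i y := by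
  filter_upwards [H.eventually_forall_of_inner_lt x] with y hy hiy
  have hi : ⟪H.n i, y⟫ = H.h i := by
    rw [inner_sub_right, h.1.2] at hiy
    linarith
  have hc : ∀ c, x ∈ H.facet c → ⟪H.n c, y⟫ = H.h c := by
    intro c hc
    rw [h.2 c hc, hi, ← h.1.2, ← hc.2, h.2 c hc]
  refine ⟨⟨fun c => ?_, hi⟩, fun c hcy => ?_⟩
  · rcases eq_or_lt_of_le (h.1.1 c) with h1 | h1
    · exact (hc c ⟨h.1.1, h1⟩).le
    · exact (hy c h1).le
  · rcases eq_or_lt_of_le (h.1.1 c) with h1 | h1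
    · exact h.2 c ⟨h.1.1, h1⟩
    · exact absurd hcy.2 (hy c h1).ne

theorem exists_simple (H : HPolyhedron ι) : ∃ i x, H.Simple i x := by
  set s : ι → ℝ := fun i => H.h i - ⟪H.n i, H.o⟫ with hs
  have hs0 : ∀ i, 0 < s i := fun i => sub_pos.2 (H.inner_o_lt i)
  obtain ⟨u, hu⟩ := exists_inner_ne_zero
    (fun a : {a : ι × ι // H.n a.1 ≠ H.n a.2} => s a.1.2 • H.n a.1.1 - s a.1.1 • H.n a.1.2) (by
      rintro ⟨⟨i, j⟩, hij⟩ h0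
      apply hij
      have h1 : s j • H.n i = s i • H.n j := sub_eq_zero.1 h0
      have h2 := congrArg norm h1
      rw [norm_smul, norm_smul, H.norm_n, H.norm_n, mul_one, mul_one,
        Real.norm_of_nonneg (hs0 _).le, Real.norm_of_nonneg (hs0 _).le] at h2
      rw [h2] at h1
      exact smul_right_injective _ (hs0 i).ne' h1)
  by_cases hu0 : u = 0
  · subst hu0
    have hsub : ∀ i j, H.n i = H.n j := by
      intro i j
      by_contra hne
      exact hu ⟨(i, j), hne⟩ (inner_zero_right _)
    obtain ⟨t, ht, i, hi⟩ := H.exists_ray_mem_surface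
      (u := EuclideanSpace.single (0 : Fin 3) (1 : ℝ)) (by simp)
    exact ⟨i, _, hi, fun c _ => hsub c i⟩
  obtain ⟨t, ht, i, hi⟩ := H.exists_ray_mem_surface hu0
  refine ⟨i, _, hi, fun c hc => ?_⟩
  by_contra hne
  have key : ∀ k, H.o + t • u ∈ H.facet k → t * ⟪H.n k, u⟫ = s k := by
    intro k hk
    have := hk.2
    rw [inner_add_right, inner_smul_right] at this
    rw [hs]
    linarith
  refine hu ⟨(c, i), hne⟩ ?_
  simp only [inner_sub_left, inner_smul_left, conj_trivial]
  rw [← key c hc, ← key i hi]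
  ring

end HPolyhedron

namespace HPolyhedron

variable {ι : Type} [Finite ι] {H : HPolyhedron ι}

/-! ### Generic pairs of antipodes -/

theorem eq_of_norm_le_of_norm_midpoint {a b : E} {D : ℝ} (ha : ‖a‖ ≤ D) (hb : ‖b‖ ≤ D)
    (hab : D ≤ ‖(1 / 2 : ℝ) • (a + b)‖) : a = b := by
  have h1 := parallelogram_law_with_norm ℝ a b
  rw [norm_smul, Real.norm_of_nonneg (by norm_num)] at hab
  have h2 : ‖a - b‖ * ‖a - b‖ ≤ 0 := by nlinarith [norm_nonneg a, norm_nonneg b]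
  exact sub_eq_zero.1 (norm_eq_zero.1 (by nlinarith [norm_nonneg (a - b)]))

theorem Reach.unfold_sub_eq_of_midpoint {m : ℕ} {σ : ℕ → ι} {D : ℝ} {x₀ y₀ x₁ y₁ : E}
    (h₀ : H.Reach m σ D x₀ y₀) (h₁ : H.Reach m σ D x₁ y₁)
    (hd : H.d ((1 / 2 : ℝ) • (x₀ + x₁)) ((1 / 2 : ℝ) • (y₀ + y₁)) = D) :
    H.unfold σ m (y₁ - y₀) = x₁ - x₀ := by
  obtain ⟨p, hp, rfl, rfl, hpl⟩ := h₀
  obtain ⟨q, hq, rfl, rfl, hql⟩ := h₁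
  have hr := hp.convexComb hq (t := 1 / 2) (by norm_num) (by norm_num)
  have hrl := len_convexComb_le (m := m) (p := p) (p' := q) (t := 1 / 2) (by norm_num)
    (by norm_num)
  set r : ℕ → E := fun k => (1 - 1 / 2 : ℝ) • p k + (1 / 2 : ℝ) • q k with hrdef
  have hrk : ∀ k, r k = (1 / 2 : ℝ) • (p k + q k) := by
    intro k; simp only [hrdef]; module
  rw [← hrk, ← hrk] at hd
  have hmin : len m r ≤ H.d (r 0) (r m) := by rw [hd]; linarith
  have h1 := hr.norm_disp_eq hmin
  have h2 := hp.disp_eq hq le_rfl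
  have h3 := hp.disp_eq hr le_rfl
  have h4 : H.disp m σ r = (1 / 2 : ℝ) • (H.disp m σ p + H.disp m σ q) := by
    rw [h3, h2, hrk, hrk, show (1 / 2 : ℝ) • (p m + q m) - p m = (1 / 2 : ℝ) • (q m - p m) by module,
      show (1 / 2 : ℝ) • (p 0 + q 0) - p 0 = (1 / 2 : ℝ) • (q 0 - p 0) by module, map_smul]
    module
  have h5 := eq_of_norm_le_of_norm_midpoint ((norm_disp_le_len m σ p).trans hpl)
    ((norm_disp_le_len m σ q).trans hql) (by rw [← h4, h1, hd])
  rw [h2] at h5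
  have h6 : H.disp m σ p + (H.unfold σ m (q m - p m) - (q 0 - p 0)) = H.disp m σ p + 0 := by
    rw [add_zero, ← add_sub_assoc]; exact h5.symm
  exact sub_eq_zero.1 (add_left_cancel h6)

/-- All points are at the same distance from their antipodes. -/
structure IsAntipodal (H : HPolyhedron ι) (D : ℝ) : Prop where
  pos : 0 < D
  d_le : ∀ x ∈ H.surface, ∀ y ∈ H.surface, H.d x y ≤ D
  exists_eq : ∀ x ∈ H.surface, ∃ y ∈ H.surface, H.d x y = D

/-- The facet sequences of the paths from `x` to `y` of length at most `D`. -/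
def active (H : HPolyhedron ι) (D : ℝ) (i j : ι) (m : ℕ) (x y : E) : Set (ℕ → ι) :=
  {τ | τ ∈ types ι m ∧ τ 0 = i ∧ τ m = j ∧ H.Reach m τ D x y}

theorem finite_active {D : ℝ} {i j : ι} {m : ℕ} {x y : E} : (H.active D i j m x y).Finite :=
  (finite_types m).subset fun _ h => h.1

/-- An antipodal pair of points inside facets all of whose shortest connections induce the same
isometry `T`. -/
structure Good (H : HPolyhedron ι) (D : ℝ) (i j : ι) (T : E ≃ₗᵢ[ℝ] E) (m : ℕ) (x y : E) :
    Prop where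
  simple_left : H.Simple i x
  simple_right : H.Simple j y
  d_eq : H.d x y = D
  map_n : T (H.n j) = H.n i
  unfold_eq : ∀ τ ∈ H.active D i j m x y, H.unfold τ m = T

theorem Reach.extend {m m' : ℕ} {σ : ℕ → ι} {L : ℝ} {x y : E} (h : H.Reach m σ L x y)
    (hm : m ≤ m') : ∃ τ ∈ types ι m', τ 0 = σ 0 ∧ τ m' = σ m ∧ H.Reach m' τ L x y ∧
      H.unfold τ m' = H.unfold σ m := by
  obtain ⟨p, hp, rfl, rfl, hl⟩ := h
  obtain ⟨τ, q, h1, h2, h3, h4, h5, h6⟩ := hp.extend hm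
  refine ⟨τ, fun k hk => by rw [h5 k (hm.trans hk), h5 m' hm], h4 0 (Nat.zero_le _), h5 m' hm,
    ⟨q, h1, h2 0 (Nat.zero_le _), h3 m' hm, h6.trans_le hl⟩, ?_⟩
  obtain ⟨j, rfl⟩ := Nat.exists_eq_add_of_le hm
  have hconst : transport (fun r => H.n (τ (m + r))) j = LinearIsometryEquiv.refl ℝ E :=
    transport_of_const (fun r => H.n (τ (m + r))) (fun _ => H.norm_n _) fun k _ => by
      simp only [h5 (m + k) (by omega), h5 (m + 0) (by omega)]
  have hcongr : H.unfold τ m = H.unfold σ m :=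
    transport_congr fun k hk => by simp only [h4 k hk]
  ext1 v
  rw [unfold, transport_add, LinearIsometryEquiv.trans_apply, hconst, ← hcongr]
  rfl

theorem exists_reach_of_le [Fintype ι] {M : ℕ} (hM : Fintype.card ι + 1 ≤ M) {x y : E} {i j : ι}
    (hx : x ∈ H.facet i) (hy : y ∈ H.facet j) :
    ∃ σ ∈ types ι M, σ 0 = i ∧ σ M = j ∧ H.Reach M σ (H.d x y) x y := by
  obtain ⟨σ, -, h0, h1, h2⟩ := H.exists_reach hx hy
  obtain ⟨τ, hτ, h3, h4, h5, -⟩ := h2.extend hM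
  exact ⟨τ, hτ, h3.trans h0, h4.trans h1, h5⟩

theorem unfold_eq_of_frequently {m : ℕ} {τ : ℕ → ι} {D : ℝ} {x₀ y₀ w w' : E} {s₁ s₂ s₃ : ℝ}
    (h12 : s₁ ≠ s₂) (h13 : s₁ ≠ s₃) (h23 : s₂ ≠ s₃)
    (h : ∀ s ∈ ({s₁, s₂, s₃} : Set ℝ), H.Reach m τ D (x₀ + s • w) (y₀ + s • w') ∧
      H.d (x₀ + s • w) (y₀ + s • w') = D) : H.unfold τ m w' = w := by
  obtain ⟨⟨p, hp, hp0, hpm, hpl⟩, hpd⟩ := h s₁ (by simp)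
  set v := H.unfold τ m w' - w with hv
  have key : ∀ s ∈ ({s₁, s₂, s₃} : Set ℝ), ‖H.disp m τ p + (s - s₁) • v‖ = D := by
    intro s hs
    obtain ⟨⟨q, hq, hq0, hqm, hql⟩, hqd⟩ := h s hs
    have h1 := hq.norm_disp_eq (by rw [hq0, hqm, hqd]; exact hql)
    rw [hq0, hqm, hqd, hp.disp_eq hq le_rfl, hq0, hqm, hp0, hpm] at h1
    rw [← h1, hv, show y₀ + s • w' - (y₀ + s₁ • w') = (s - s₁) • w' by module,
      show x₀ + s • w - (x₀ + s₁ • w) = (s - s₁) • w by module, map_smul]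
    congr 1
    module
  have key2 : ∀ s ∈ ({s₁, s₂, s₃} : Set ℝ), ‖H.disp m τ p‖ ^ 2 +
      2 * (s - s₁) * ⟪H.disp m τ p, v⟫ + (s - s₁) ^ 2 * ‖v‖ ^ 2 = D ^ 2 := by
    intro s hs
    rw [← key s hs, norm_add_sq_real, inner_smul_right, norm_smul, mul_pow, Real.norm_eq_abs,
      sq_abs]
    ring
  have k1 := key2 s₁ (by simp)
  have k2 := key2 s₂ (by simp)
  have k3 := key2 s₃ (by simp)
  have e2 : 2 * ⟪H.disp m τ p, v⟫ + (s₂ - s₁) * ‖v‖ ^ 2 = 0 := by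
    refine mul_left_cancel₀ (sub_ne_zero.2 h12.symm) ?_
    linear_combination k2 - k1
  have e3 : 2 * ⟪H.disp m τ p, v⟫ + (s₃ - s₁) * ‖v‖ ^ 2 = 0 := by
    refine mul_left_cancel₀ (sub_ne_zero.2 h13.symm) ?_
    linear_combination k3 - k1
  have e : (s₂ - s₃) * ‖v‖ ^ 2 = 0 := by linear_combination e2 - e3
  have hv0 : v = 0 := by
    rcases mul_eq_zero.1 e with h | h
    · exact absurd h (sub_ne_zero.2 h23)
    · simpa using h
  exact sub_eq_zero.1 hv0

theorem exists_good [Fintype ι] {D : ℝ} (hA : H.IsAntipodal D) {M : ℕ}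
    (hM : Fintype.card ι + 1 ≤ M) : ∃ i j T x y, H.Good D i j T M x y := by
  obtain ⟨i, x₀, hx₀⟩ := H.exists_simple
  have : Finite (types ι M) := (finite_types M).to_subtype
  obtain ⟨w, hw, hiw, hgen⟩ := exists_orthogonal_inner_ne_zero (H.norm_n i)
    (fun a : {a : types ι M × ι // ∀ c : ℝ, H.unfold a.1 M (H.n a.2) ≠ c • H.n i} =>
      H.unfold a.1.1 M (H.n a.1.2)) fun a => a.2
  set U : Ultrafilter ℝ := Ultrafilter.of (𝓝[>] (0 : ℝ)) with hU
  have hUle : (U : Filter ℝ) ≤ 𝓝[>] (0 : ℝ) := Ultrafilter.of_le _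
  have hpos : ∀ᶠ s in (U : Filter ℝ), 0 < s := hUle self_mem_nhdsWithin
  have hlim : Tendsto (fun s : ℝ => s) U (𝓝 0) := hUle.trans nhdsWithin_le_nhds
  have hxlim : ∀ c : ℝ, Tendsto (fun s : ℝ => x₀ + (c * s) • w) U (𝓝 x₀) := by
    intro c
    have := (tendsto_const_nhds (x := x₀)).add ((hlim.const_mul c).smul_const w)
    simpa using this
  have hxS : ∀ c : ℝ, ∀ᶠ s in (U : Filter ℝ), H.Simple i (x₀ + (c * s) • w) := by
    intro c
    filter_upwards [(hxlim c).eventually hx₀.eventually] with s hs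
    exact hs (by rw [add_sub_cancel_left, inner_smul_right, hiw, mul_zero])
  have hy : ∀ s : ℝ, ∃ y, H.Simple i (x₀ + (1 * s) • w) →
      y ∈ H.surface ∧ H.d (x₀ + (1 * s) • w) y = D := by
    intro s
    by_cases h : H.Simple i (x₀ + (1 * s) • w)
    · obtain ⟨y, h1, h2⟩ := hA.exists_eq _ ⟨i, h.1⟩
      exact ⟨y, fun _ => ⟨h1, h2⟩⟩
    · exact ⟨0, fun h' => absurd h' h⟩
  choose y hy using hy
  have hyj : ∃ j, ∀ᶠ s in (U : Filter ℝ), y s ∈ H.facet j := by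
    rw [← Ultrafilter.eventually_exists_iff]
    filter_upwards [hxS 1] with s hs using (hy s hs).1
  obtain ⟨j, hyj⟩ := hyj
  obtain ⟨y₀, hy₀, hylim⟩ := isCompact_iff_ultrafilter_le_nhds.1 (H.isCompact_facet j) (U.map y)
    (by rw [le_principal_iff]; exact hyj)
  replace hylim : Tendsto y U (𝓝 y₀) := hylim
  set y'' : ℝ → E := fun s => (2 : ℝ) • y s - y₀ with hy''
  have hy''lim : Tendsto y'' U (𝓝 y₀) := by
    have := (hylim.const_smul (2 : ℝ)).sub_const y₀
    rwa [show (2 : ℝ) • y₀ - y₀ = y₀ by module] at this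
  have hy''j : ∀ᶠ s in (U : Filter ℝ), y'' s ∈ H.facet j := by
    filter_upwards [hyj, hy''lim.eventually (H.eventually_forall_of_inner_lt y₀)] with s h1 h2
    have hval : ∀ c, ⟪H.n c, y'' s⟫ = 2 * ⟪H.n c, y s⟫ - ⟪H.n c, y₀⟫ := by
      intro c; rw [hy'', inner_sub_right, inner_smul_right]
    refine ⟨fun c => ?_, ?_⟩
    · rcases eq_or_lt_of_le (hy₀.1 c) with h | h
      · rw [hval, h]
        have := h1.1 c
        linarith
      · exact (h2 c h).le
    · rw [hval, h1.2, hy₀.2]; ring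
  have hσ : ∃ σ ∈ {σ | σ ∈ types ι M ∧ σ 0 = i ∧ σ M = j}, ∀ᶠ s in (U : Filter ℝ),
      H.Reach M σ D (x₀ + (2 * s) • w) (y'' s) := by
    rw [← Ultrafilter.eventually_exists_mem_iff ((finite_types M).subset fun _ h => h.1)]
    filter_upwards [hxS 2, hy''j] with s h1 h2
    obtain ⟨σ, hσ, h3, h4, h5⟩ := exists_reach_of_le hM h1.1 h2
    exact ⟨σ, ⟨hσ, h3, h4⟩, h5.mono (hA.d_le _ ⟨_, h1.1⟩ _ ⟨_, h2⟩)⟩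
  obtain ⟨σ, ⟨hσM, hσ0, hσm⟩, hσr⟩ := hσ
  have hσ₀ : H.Reach M σ D x₀ y₀ :=
    (isClosed_setOf_reach M σ D).mem_of_tendsto ((hxlim 2).prodMk_nhds hy''lim) hσr
  set T := H.unfold σ M with hT
  have hTn : T (H.n j) = H.n i := by
    obtain ⟨p, hp, -⟩ := hσ₀
    rw [← hσ0, ← hσm, hT, hp.unfold_n le_rfl]
  set w' := T.symm w with hw'
  have hys : ∀ᶠ s in (U : Filter ℝ), y s = y₀ + s • w' := by
    filter_upwards [hσr, hxS 1] with s h1 h2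
    have hd : H.d ((1 / 2 : ℝ) • (x₀ + (x₀ + (2 * s) • w))) ((1 / 2 : ℝ) • (y₀ + y'' s)) = D := by
      rw [← (hy s h2).2]
      congr 1
      · module
      · rw [hy'']; module
    have h3 := hσ₀.unfold_sub_eq_of_midpoint h1 hd
    have h4 : T (y s - y₀) = s • w := by
      have h5 : T ((2 : ℝ) • (y s - y₀)) = (2 : ℝ) • s • w := by
        rw [show (2 : ℝ) • (y s - y₀) = y'' s - y₀ by rw [hy'']; module, h3]; module
      rw [map_smul] at h5
      exact smul_right_injective _ (two_ne_zero (α := ℝ)) h5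
    have h6 : y s - y₀ = s • w' := by
      rw [hw', ← map_smul, ← h4, T.symm_apply_apply]
    rw [← h6]; abel
  have hall : ∀ᶠ s in (U : Filter ℝ), ∀ τ ∈ types ι M, H.Reach M τ D (x₀ + s • w) (y₀ + s • w') →
      ∀ᶠ r in (U : Filter ℝ), H.Reach M τ D (x₀ + r • w) (y₀ + r • w') := by
    rw [eventually_all_finite (finite_types M)]
    intro τ _
    rcases U.em (fun r => H.Reach M τ D (x₀ + r • w) (y₀ + r • w')) with h | h
    · exact Eventually.of_forall fun _ _ => h
    · filter_upwards [h] with s hs hs' using absurd hs' hs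
  have hdist : ∀ᶠ s in (U : Filter ℝ), H.d (x₀ + s • w) (y₀ + s • w') = D := by
    filter_upwards [hys, hxS 1] with s h1 h2
    have := (hy s h2).2
    rwa [one_mul, h1] at this
  have hfin := ((((hpos.and hall).and hdist).and (hxS 1)).and (hys.and hyj)).and
    (hylim.eventually (H.eventually_forall_of_inner_lt y₀))
  obtain ⟨s, ⟨⟨⟨⟨hs0, hsall⟩, hsd⟩, hsx⟩, hsy, hsj⟩, hsnear⟩ := hfin.exists
  rw [one_mul] at hsx
  rw [hsy] at hsj hsnear
  refine ⟨i, j, T, x₀ + s • w, y₀ + s • w', hsx, ⟨hsj, fun c hc => ?_⟩, hsd, hTn, ?_⟩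
  · by_contra hne
    have hyc : ⟪H.n c, y₀⟫ = H.h c := by
      rcases eq_or_lt_of_le (hy₀.1 c) with h | h
      · exact h
      · exact absurd hc.2 (hsnear c h).ne
    have h1 := hc.2
    rw [inner_add_right, inner_smul_right, hyc, add_eq_left, mul_eq_zero] at h1
    have h2 : ⟪T (H.n c), w⟫ = 0 := by
      rw [← T.apply_symm_apply w, T.inner_map_map]
      exact h1.resolve_left hs0.ne'
    have h3 : ∃ κ : ℝ, T (H.n c) = κ • H.n i := by
      by_contra hκ
      push Not at hκ
      exact hgen ⟨(⟨σ, hσM⟩, c), hκ⟩ h2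
    obtain ⟨κ, hκ⟩ := h3
    rw [← hTn, ← map_smul] at hκ
    have h4 : H.n c = κ • H.n j := T.injective hκ
    have h5 : |κ| = 1 := by
      have := congrArg norm h4
      rw [norm_smul, H.norm_n, H.norm_n, mul_one] at this
      exact this.symm
    rcases (abs_eq zero_le_one).1 h5 with h | h
    · rw [h, one_smul] at h4; exact hne h4
    · rw [h, neg_one_smul] at h4; exact HPolyhedron.n_ne_neg hc hsj h4
  · rintro τ ⟨hτ, hτ0, hτm, hτr⟩
    have hev := (hsall τ hτ hτr).and hdist
    obtain ⟨s₁, hs₁, hs₁0⟩ := (hev.and hpos).exists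
    obtain ⟨s₂, ⟨hs₂, hs₂0⟩, hs₂1⟩ := ((hev.and hpos).and (hlim.eventually_lt_const hs₁0)).exists
    obtain ⟨s₃, ⟨hs₃, hs₃0⟩, hs₃1⟩ := ((hev.and hpos).and (hlim.eventually_lt_const hs₂0)).exists
    have h1 : H.unfold τ M w' = w := by
      refine unfold_eq_of_frequently (x₀ := x₀) (y₀ := y₀) (D := D) (s₁ := s₁) (s₂ := s₂) (s₃ := s₃) hs₂1.ne'
        (hs₃1.trans hs₂1).ne' hs₃1.ne' ?_
      rintro r (rfl | rfl | rfl)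
      · exact hs₁
      · exact hs₂
      · exact hs₃
    obtain ⟨p, hp, -⟩ := hτr
    obtain ⟨q, hq, -⟩ := hσ₀
    have h2 : H.unfold τ M (H.n j) = H.n i := by rw [← hτ0, ← hτm, hp.unfold_n le_rfl]
    refine (hp.isRotation_unfold le_rfl).ext (hq.isRotation_unfold le_rfl) (a := H.n j) (b := w')
      ?_ ?_ ?_ ?_ ?_
    · rw [← norm_ne_zero_iff, H.norm_n]; exact one_ne_zero
    · rw [hw']; simpa using hw
    · rw [← T.inner_map_map, hTn, hw', T.apply_symm_apply, hiw]
    · rw [h2, ← hTn]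
    · rw [h1, hw']; exact (T.apply_symm_apply w).symm

end HPolyhedron

namespace HPolyhedron

variable {ι : Type} [Finite ι] {H : HPolyhedron ι}

/-! ### Straight chains -/

/-- A chain of length `D` which unfolds to a straight segment of direction `e`. -/
structure Straight (H : HPolyhedron ι) (D : ℝ) (m : ℕ) (σ : ℕ → ι) (p : ℕ → E) (e : E) : Prop where
  chain : H.IsChain m σ p
  norm_e : ‖e‖ = 1
  step : ∀ k < m, H.unfold σ k (p (k + 1) - p k) = ‖p (k + 1) - p k‖ • e
  len_eq : len m p = D

theorem Straight.disp_eq {D : ℝ} {m : ℕ} {σ : ℕ → ι} {p : ℕ → E} {e : E}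
    (h : H.Straight D m σ p e) : H.disp m σ p = D • e := by
  rw [IsChain.disp_eq_smul h.step, h.len_eq]

theorem Reach.exists_straight {D : ℝ} {m : ℕ} {σ : ℕ → ι} {x y : E} (h : H.Reach m σ D x y)
    (hd : H.d x y = D) : ∃ p e, H.Straight D m σ p e ∧ p 0 = x ∧ p m = y := by
  obtain ⟨p, hp, rfl, rfl, hl⟩ := h
  obtain ⟨e, he, hs⟩ := hp.exists_direction (by rwa [hd])
  exact ⟨p, e, ⟨hp, he, hs, le_antisymm hl (hd ▸ hp.d_le_len)⟩, rfl, rfl⟩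

theorem Straight.inner_n {D : ℝ} {m : ℕ} {σ : ℕ → ι} {p : ℕ → E} {e : E}
    (h : H.Straight D m σ p e) (hD : 0 < D) : ⟪H.n (σ 0), e⟫ = 0 := by
  have h1 : ⟪H.n (σ 0), H.disp m σ p⟫ = 0 := by
    rw [disp, inner_sum]
    refine Finset.sum_eq_zero fun k hk => ?_
    have hk := Finset.mem_range.1 hk
    rw [← h.chain.unfold_n hk.le, LinearIsometryEquiv.inner_map_map]
    exact inner_sub_eq_zero (h.chain.2 k hk) (h.chain.1 k hk.le)
  rw [h.disp_eq, inner_smul_right] at h1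
  exact (mul_eq_zero.1 h1).resolve_left hD.ne'

theorem Straight.translate {D : ℝ} {m : ℕ} {σ : ℕ → ι} {p : ℕ → E} {e x y : E}
    (h : H.Straight D m σ p e) (hD : 0 < D) (hr : H.Reach m σ D x y) (hd : H.d x y = D)
    (hxy : H.unfold σ m (y - p m) = x - p 0) :
    ∃ q, H.Straight D m σ q e ∧ q 0 = x ∧ q m = y := by
  obtain ⟨q, e', hq, rfl, rfl⟩ := hr.exists_straight hd
  have h1 := h.chain.disp_eq hq.chain le_rfl
  rw [hxy, h.disp_eq, hq.disp_eq, add_sub_cancel_right] at h1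
  exact ⟨q, smul_right_injective _ hD.ne' h1 ▸ hq, rfl, rfl⟩

theorem Straight.convexComb {D : ℝ} {m : ℕ} {σ : ℕ → ι} {p q : ℕ → E} {e : E}
    (hp : H.Straight D m σ p e) (hq : H.Straight D m σ q e) {t : ℝ} (ht0 : 0 ≤ t) (ht1 : t ≤ 1) :
    H.Straight D m σ (fun k => (1 - t) • p k + t • q k) e ∧
      ∀ k < m, ‖(1 - t) • p (k + 1) + t • q (k + 1) - ((1 - t) • p k + t • q k)‖ =
        (1 - t) * ‖p (k + 1) - p k‖ + t * ‖q (k + 1) - q k‖ := by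
  have hstep : ∀ k < m, H.unfold σ k
      ((1 - t) • p (k + 1) + t • q (k + 1) - ((1 - t) • p k + t • q k)) =
        ((1 - t) * ‖p (k + 1) - p k‖ + t * ‖q (k + 1) - q k‖) • e := by
    intro k hk
    rw [show (1 - t) • p (k + 1) + t • q (k + 1) - ((1 - t) • p k + t • q k) =
      (1 - t) • (p (k + 1) - p k) + t • (q (k + 1) - q k) by module, map_add, map_smul, map_smul,
      hp.step k hk, hq.step k hk]
    module
  have hnorm : ∀ k < m, ‖(1 - t) • p (k + 1) + t • q (k + 1) - ((1 - t) • p k + t • q k)‖ =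
        (1 - t) * ‖p (k + 1) - p k‖ + t * ‖q (k + 1) - q k‖ := by
    intro k hk
    rw [← (H.unfold σ k).norm_map, hstep k hk, norm_smul, hp.norm_e, mul_one,
      Real.norm_of_nonneg]
    have := sub_nonneg.2 ht1
    positivity
  refine ⟨⟨hp.chain.convexComb hq.chain ht0 ht1, hp.norm_e, fun k hk => ?_, ?_⟩, hnorm⟩
  · rw [hstep k hk, hnorm k hk]
  · rw [len, Finset.sum_congr rfl fun k hk => hnorm k (Finset.mem_range.1 hk),
      Finset.sum_add_distrib, ← Finset.mul_sum, ← Finset.mul_sum]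
    change (1 - t) * len m p + t * len m q = D
    rw [hp.len_eq, hq.len_eq]
    ring

/-! ### Three directions -/

theorem eventually_active_subset {D : ℝ} {i j : ι} {m : ℕ} {x y : E} :
    ∀ᶠ z in 𝓝 (x, y), H.active D i j m z.1 z.2 ⊆ H.active D i j m x y := by
  have : ∀ᶠ z in 𝓝 (x, y), ∀ τ ∈ types ι m, H.Reach m τ D z.1 z.2 → H.Reach m τ D x y := by
    rw [eventually_all_finite (finite_types m)]
    intro τ _
    by_cases h : H.Reach m τ D x y
    · exact Eventually.of_forall fun _ _ => h
    · have h1 : ∀ᶠ z in 𝓝 (x, y), ¬ H.Reach m τ D z.1 z.2 :=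
        (isClosed_setOf_reach (H := H) m τ D).isOpen_compl.mem_nhds h
      filter_upwards [h1] with z hz hz' using absurd hz' hz
  filter_upwards [this] with z hz τ hτ
  exact ⟨hτ.1, hτ.2.1, hτ.2.2.1, hz τ hτ.1 hτ.2.2.2⟩

theorem Good.unfold_eq_of_le {D : ℝ} {i j : ι} {T : E ≃ₗᵢ[ℝ] E} {m M : ℕ} {x y : E} {τ : ℕ → ι}
    (h : H.Good D i j T M x y) (hm : m ≤ M) (h0 : τ 0 = i) (hj : τ m = j)
    (hr : H.Reach m τ D x y) : H.unfold τ m = T := by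
  obtain ⟨τ', h1, h2, h3, h4, h5⟩ := hr.extend hm
  rw [← h5]
  exact h.unfold_eq τ' ⟨h1, h2.trans h0, h3.trans hj, h4⟩

/-- The data of three straight chains between antipodes which can be translated in the
direction `w`. -/
structure Config (H : HPolyhedron ι) (D : ℝ) (N : ℕ) (i j : ι) (T : E ≃ₗᵢ[ℝ] E) (x y w : E)
    (σ : Fin 3 → ℕ → ι) (p q : Fin 3 → ℕ → E) (e : Fin 3 → E) : Prop where
  pos : 0 < D
  simple : H.Simple i x
  d_eq : H.d x y = D
  unfold_eq : ∀ m ≤ 2 * N, ∀ τ : ℕ → ι, τ 0 = i → τ m = j → H.Reach m τ D x y → H.unfold τ m = T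
  type_zero : ∀ r, σ r 0 = i
  type_last : ∀ r, σ r N = j
  straight : ∀ r, H.Straight D N (σ r) (p r) (e r)
  zero : ∀ r, p r 0 = x
  last : ∀ r, p r N = y
  straight' : ∀ r, H.Straight D N (σ r) (q r) (e r)
  zero' : ∀ r, q r 0 = x + w
  last' : ∀ r, q r N = y + T.symm w

theorem exists_direction_inner_neg [Fintype ι] {D : ℝ} (hA : H.IsAntipodal D) {i j : ι}
    {T : E ≃ₗᵢ[ℝ] E} {M : ℕ} {x y : E} (hG : H.Good D i j T M x y) {z : E} (hz : z ≠ 0)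
    (hiz : ⟪H.n i, z⟫ = 0) :
    ∃ τ ∈ H.active D i j (Fintype.card ι + 1) x y, ∃ p e,
      H.Straight D (Fintype.card ι + 1) τ p e ∧ p 0 = x ∧ p (Fintype.card ι + 1) = y ∧
      ⟪e, z⟫ < 0 := by
  set N := Fintype.card ι + 1 with hN
  have hlim : Tendsto (fun ε : ℝ => x - ε • z) (𝓝[>] 0) (𝓝 x) := by
    have : Continuous fun ε : ℝ => x - ε • z := by fun_prop
    have := (this.tendsto 0).mono_left (nhdsWithin_le_nhds (s := Set.Ioi 0))
    simpa using this
  have h1 := hlim.eventually hG.simple_left.eventually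
  have h2 := (hlim.prodMk_nhds (tendsto_const_nhds (x := y))).eventually
    (eventually_active_subset (H := H) (D := D) (i := i) (j := j) (m := N))
  obtain ⟨ε, ⟨h1, h2⟩, hε : 0 < ε⟩ := ((h1.and h2).and self_mem_nhdsWithin).exists
  have h3 := h1 (by rw [sub_sub_cancel_left, inner_neg_right, inner_smul_right, hiz]; simp)
  obtain ⟨τ, hτ, hτ0, hτN, hr⟩ := exists_reach_of_le le_rfl h3.1 hG.simple_right.1
  have hr' := hr.mono (hA.d_le _ ⟨_, h3.1⟩ _ ⟨_, hG.simple_right.1⟩)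
  have hτa := h2 ⟨hτ, hτ0, hτN, hr'⟩
  obtain ⟨p, e, hp, hp0, hpN⟩ := hτa.2.2.2.exists_straight hG.d_eq
  refine ⟨τ, hτa, p, e, hp, hp0, hpN, ?_⟩
  obtain ⟨p', hp', hp0', hpN', hl⟩ := hr'
  have h4 := (norm_disp_le_len (H := H) N τ p').trans hl
  rw [hp.chain.disp_eq hp' le_rfl, hp.disp_eq, hpN', hpN, hp0, hp0', sub_self, map_zero, add_zero,
    sub_sub_cancel_left, sub_neg_eq_add] at h4
  have h5 := pow_le_pow_left₀ (norm_nonneg _) h4 2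
  rw [norm_add_sq_real, norm_smul, norm_smul, hp.norm_e, inner_smul_left, inner_smul_right,
    Real.norm_of_nonneg hA.pos.le, Real.norm_of_nonneg hε.le, conj_trivial] at h5
  by_contra! h6
  have h7 : 0 < (ε * ‖z‖) ^ 2 := by have := norm_pos_iff.2 hz; positivity
  have h8 : 0 ≤ 2 * (D * (ε * ⟪e, z⟫)) := by have := hA.pos; positivity
  linarith [mul_one D]

/-- Among the good pairs there is one all of whose shortest connections can be translated. -/
theorem exists_translatable [Fintype ι] {D : ℝ} (hA : H.IsAntipodal D) :
    ∃ i j T x y, H.Good D i j T (2 * (Fintype.card ι + 1)) x y ∧ ∀ᶠ w in 𝓝 (0 : E),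
      ⟪H.n i, w⟫ = 0 → H.d (x + w) (y + T.symm w) = D ∧
        ∀ τ ∈ H.active D i j (Fintype.card ι + 1) x y,
          H.Reach (Fintype.card ι + 1) τ D (x + w) (y + T.symm w) := by
  set N := Fintype.card ι + 1 with hN
  obtain ⟨i, j, T, x₀, y₀, h₀⟩ := exists_good hA (M := 2 * N) (by omega)
  have hex : ∃ c x y, H.Good D i j T (2 * N) x y ∧ (H.active D i j N x y).ncard = c :=
    ⟨_, x₀, y₀, h₀, rfl⟩
  classical
  obtain ⟨x, y, hG, hc⟩ := Nat.find_spec hex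
  have hmin : ∀ x' y', H.Good D i j T (2 * N) x' y' →
      (H.active D i j N x y).ncard ≤ (H.active D i j N x' y').ncard := by
    intro x' y' h'
    rw [hc]
    exact Nat.find_min' hex ⟨x', y', h', rfl⟩
  refine ⟨i, j, T, x, y, hG, ?_⟩
  have hl1 : Tendsto (fun w : E => x + w) (𝓝 0) (𝓝 x) := by
    have : Continuous fun w : E => x + w := by fun_prop
    simpa using this.tendsto 0
  have hl2 : Tendsto (fun w : E => y + T.symm w) (𝓝 0) (𝓝 y) := by
    have : Continuous fun w : E => y + T.symm w := by fun_prop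
    simpa using this.tendsto 0
  have hl := hl1.prodMk_nhds hl2
  filter_upwards [hl1.eventually hG.simple_left.eventually,
    hl2.eventually hG.simple_right.eventually,
    hl.eventually (eventually_active_subset (H := H) (D := D) (i := i) (j := j) (m := N)),
    hl.eventually (eventually_active_subset (H := H) (D := D) (i := i) (j := j) (m := 2 * N))]
    with w h1 h2 h3 h4 hw
  have hx := h1 (by rwa [add_sub_cancel_left])
  have hy := h2 (by
    rw [add_sub_cancel_left, ← T.inner_map_map, hG.map_n, T.apply_symm_apply, hw])
  have hd : H.d (x + w) (y + T.symm w) = D := by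
    refine le_antisymm (hA.d_le _ ⟨_, hx.1⟩ _ ⟨_, hy.1⟩) ?_
    obtain ⟨τ, hτ, hτ0, hτN, hr⟩ := exists_reach_of_le le_rfl hx.1 hy.1
    have hτa := h3 ⟨hτ, hτ0, hτN, hr.mono (hA.d_le _ ⟨_, hx.1⟩ _ ⟨_, hy.1⟩)⟩
    obtain ⟨p, e, hp, hp0, hpN⟩ := hτa.2.2.2.exists_straight hG.d_eq
    obtain ⟨p', hp', hp0', hpN', hle⟩ := hr
    have h5 := (norm_disp_le_len (H := H) N τ p').trans hle
    rwa [hp.chain.disp_eq hp' le_rfl, hp.disp_eq, hpN', hpN, hp0, hp0', add_sub_cancel_left,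
      add_sub_cancel_left, hG.unfold_eq_of_le (by omega) hτ0 hτN hτa.2.2.2, T.apply_symm_apply,
      add_sub_cancel_right, norm_smul, hp.norm_e, mul_one, Real.norm_of_nonneg hA.pos.le] at h5
  have hG' : H.Good D i j T (2 * N) (x + w) (y + T.symm w) :=
    ⟨hx, hy, hd, hG.map_n, fun τ hτ => hG.unfold_eq τ (h4 hτ)⟩
  refine ⟨hd, fun τ hτ => ?_⟩
  rw [← Set.eq_of_subset_of_ncard_le h3 (hmin _ _ hG') finite_active] at hτ
  exact hτ.2.2.2

theorem exists_config [Fintype ι] {D : ℝ} (hA : H.IsAntipodal D) :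
    ∃ N i j T x y w σ p q e, H.Config D N i j T x y w σ p q e ∧
      ∃ (ν : E) (a b : ℝ), 0 < a ∧ 0 < b ∧ w = a • e 1 - b • e 2 ∧
        ⟪e 0, ν⟫ < 0 ∧ 0 < ⟪e 1, ν⟫ ∧ 0 < ⟪e 2, ν⟫ ∧ ⟪w, ν⟫ = 0 ∧ e 1 ≠ e 2 ∧
        ∀ r, ⟪H.n i, e r⟫ = 0 := by
  obtain ⟨i, j, T, x, y, hG, htr⟩ := exists_translatable hA
  set N := Fintype.card ι + 1 with hN
  have hin : ∀ τ ∈ H.active D i j N x y, ∀ p e, H.Straight D N τ p e → ⟪H.n i, e⟫ = 0 :=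
    fun τ hτ p e hp => hτ.2.1 ▸ hp.inner_n hA.pos
  obtain ⟨z₀, hz₀, hiz₀, -⟩ := exists_ne_zero_inner_eq_zero (H.n i) (H.n i)
  obtain ⟨τ₁, hτ₁, p₁, e₁, hp₁, hp₁0, hp₁N, -⟩ := exists_direction_inner_neg hA hG hz₀ hiz₀
  obtain ⟨f, hf, hif, hef⟩ := exists_ne_zero_inner_eq_zero (H.n i) e₁
  obtain ⟨τ₀, hτ₀, p₀, e₀, hp₀, hp₀0, hp₀N, hef₀⟩ := exists_direction_inner_neg hA hG hf hif
  obtain ⟨τ₂, hτ₂, p₂, e₂, hp₂, hp₂0, hp₂N, hef₂⟩ := exists_direction_inner_neg hA hG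
    (neg_ne_zero.2 hf) (by rw [inner_neg_right, hif, neg_zero])
  rw [inner_neg_right, neg_lt_zero] at hef₂
  have he₁ : ⟪e₁, e₁⟫ = 1 := by rw [real_inner_self_eq_norm_sq, hp₁.norm_e, one_pow]
  obtain ⟨ν, hν₀, hν₁, hν₂⟩ : ∃ ν : E, ⟪e₀, ν⟫ < 0 ∧ 0 < ⟪e₁, ν⟫ ∧ 0 < ⟪e₂, ν⟫ := by
    have hc : ∀ g : E, Tendsto (fun ε : ℝ => ⟪g, f + ε • e₁⟫) (𝓝[>] 0) (𝓝 ⟪g, f⟫) := by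
      intro g
      have : Continuous fun ε : ℝ => ⟪g, f + ε • e₁⟫ := by fun_prop
      have := (this.tendsto 0).mono_left (nhdsWithin_le_nhds (s := Set.Ioi 0))
      simpa using this
    obtain ⟨ε, ⟨h0, h2⟩, hε : 0 < ε⟩ := (((hc e₀).eventually_lt_const hef₀).and
      ((hc e₂).eventually_const_lt hef₂) |>.and self_mem_nhdsWithin).exists
    exact ⟨f + ε • e₁, h0, by rw [inner_add_right, hef, inner_smul_right, he₁]; linarith, h2⟩
  have hne : e₁ ≠ e₂ := by rintro rfl; exact hef₂.ne' hef
  have hlim : Tendsto (fun t : ℝ => t • (⟪e₂, ν⟫ • e₁ - ⟪e₁, ν⟫ • e₂)) (𝓝[>] 0) (𝓝 0) := by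
    have : Continuous fun t : ℝ => t • (⟪e₂, ν⟫ • e₁ - ⟪e₁, ν⟫ • e₂) := by fun_prop
    have := (this.tendsto 0).mono_left (nhdsWithin_le_nhds (s := Set.Ioi 0))
    simpa using this
  obtain ⟨t, ht, ht0 : 0 < t⟩ := ((hlim.eventually htr).and self_mem_nhdsWithin).exists
  set w := t • (⟪e₂, ν⟫ • e₁ - ⟪e₁, ν⟫ • e₂) with hw
  have hiw : ⟪H.n i, w⟫ = 0 := by
    rw [hw, inner_smul_right, inner_sub_right, inner_smul_right, inner_smul_right,
      hin _ hτ₁ _ _ hp₁, hin _ hτ₂ _ _ hp₂]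
    ring
  obtain ⟨hd, hreach⟩ := ht hiw
  have hq : ∀ τ ∈ H.active D i j N x y, ∀ p e, H.Straight D N τ p e → p 0 = x → p N = y →
      ∃ q, H.Straight D N τ q e ∧ q 0 = x + w ∧ q N = y + T.symm w := by
    intro τ hτ p e hp h0 h1
    refine hp.translate hA.pos (hreach τ hτ) hd ?_
    rw [hG.unfold_eq_of_le (by omega) hτ.2.1 hτ.2.2.1 hτ.2.2.2, h0, h1, add_sub_cancel_left,
      add_sub_cancel_left, T.apply_symm_apply]
  obtain ⟨q₀, hq₀, hq₀0, hq₀N⟩ := hq _ hτ₀ _ _ hp₀ hp₀0 hp₀N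
  obtain ⟨q₁, hq₁, hq₁0, hq₁N⟩ := hq _ hτ₁ _ _ hp₁ hp₁0 hp₁N
  obtain ⟨q₂, hq₂, hq₂0, hq₂N⟩ := hq _ hτ₂ _ _ hp₂ hp₂0 hp₂N
  refine ⟨N, i, j, T, x, y, w, ![τ₀, τ₁, τ₂], ![p₀, p₁, p₂], ![q₀, q₁, q₂], ![e₀, e₁, e₂],
    ⟨hA.pos, hG.simple_left, hG.d_eq, fun m hm τ h0 h1 h2 => hG.unfold_eq_of_le hm h0 h1 h2,
      ?_, ?_, ?_, ?_, ?_, ?_, ?_, ?_⟩, ν, t * ⟪e₂, ν⟫, t * ⟪e₁, ν⟫, by positivity, by positivity,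
      ?_, hν₀, hν₁, hν₂, ?_, hne, ?_⟩
  · intro r; fin_cases r; exacts [hτ₀.2.1, hτ₁.2.1, hτ₂.2.1]
  · intro r; fin_cases r; exacts [hτ₀.2.2.1, hτ₁.2.2.1, hτ₂.2.2.1]
  · intro r; fin_cases r; exacts [hp₀, hp₁, hp₂]
  · intro r; fin_cases r; exacts [hp₀0, hp₁0, hp₂0]
  · intro r; fin_cases r; exacts [hp₀N, hp₁N, hp₂N]
  · intro r; fin_cases r; exacts [hq₀, hq₁, hq₂]
  · intro r; fin_cases r; exacts [hq₀0, hq₁0, hq₂0]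
  · intro r; fin_cases r; exacts [hq₀N, hq₁N, hq₂N]
  · change w = (t * ⟪e₂, ν⟫) • e₁ - (t * ⟪e₁, ν⟫) • e₂
    rw [hw]; module
  · rw [hw, inner_smul_left, inner_sub_left, inner_smul_left, inner_smul_left]
    simp only [conj_trivial]
    ring
  · intro r; fin_cases r
    exacts [hin _ hτ₀ _ _ hp₀, hin _ hτ₁ _ _ hp₁, hin _ hτ₂ _ _ hp₂]

end HPolyhedron

namespace HPolyhedron

variable {ι : Type} [Finite ι] {H : HPolyhedron ι}

/-! ### Arc length parametrization of straight chains -/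

/-- The arc length parametrization of the straight chain `p` of direction `e`. -/
noncomputable def curve (H : HPolyhedron ι) (m : ℕ) (σ : ℕ → ι) (e : E) (p : ℕ → E) (s : ℝ) : E :=
  p 0 + ∑ k ∈ Finset.range m,
    max 0 (min ‖p (k + 1) - p k‖ (s - len k p)) • (H.unfold σ k).symm e

theorem continuous_curve (m : ℕ) (σ : ℕ → ι) (e : E) :
    Continuous fun z : (ℕ → E) × ℝ => H.curve m σ e z.1 z.2 := by
  unfold curve
  have := fun k => continuous_len k
  fun_prop

theorem len_succ (k : ℕ) (p : ℕ → E) : len (k + 1) p = len k p + ‖p (k + 1) - p k‖ :=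
  Finset.sum_range_succ _ _

theorem len_mono (p : ℕ → E) : Monotone fun k => len k p :=
  monotone_nat_of_le_succ fun k => by
    simp only [len_succ]; linarith [norm_nonneg (p (k + 1) - p k)]

theorem exists_len_le {m : ℕ} {p : ℕ → E} {s : ℝ} (hm : 0 < len m p) (h0 : 0 ≤ s)
    (h1 : s ≤ len m p) : ∃ k < m, len k p ≤ s ∧ s ≤ len (k + 1) p := by
  classical
  obtain ⟨n, rfl⟩ : ∃ n, m = n + 1 := by
    rcases m with _ | n
    · simp [len] at hm
    · exact ⟨n, rfl⟩
  have hex : ∃ k, s ≤ len (k + 1) p := ⟨n, h1⟩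
  refine ⟨Nat.find hex, Nat.lt_succ_of_le (Nat.find_min' hex h1), ?_, Nat.find_spec hex⟩
  rcases Nat.eq_zero_or_pos (Nat.find hex) with h | h
  · rw [h]; simpa [len] using h0
  · have := Nat.find_min hex (m := Nat.find hex - 1) (by omega)
    rw [Nat.sub_add_cancel h] at this
    exact (not_le.1 this).le

variable {D : ℝ} {m : ℕ} {σ : ℕ → ι} {p : ℕ → E} {e : E}

theorem Straight.step_symm (h : H.Straight D m σ p e) {k : ℕ} (hk : k < m) :
    p (k + 1) = p k + ‖p (k + 1) - p k‖ • (H.unfold σ k).symm e := by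
  rw [← map_smul, ← h.step k hk, LinearIsometryEquiv.symm_apply_apply, add_sub_cancel]

theorem Straight.eq_add_sum (h : H.Straight D m σ p e) {k : ℕ} (hk : k ≤ m) :
    p k = p 0 + ∑ r ∈ Finset.range k, ‖p (r + 1) - p r‖ • (H.unfold σ r).symm e := by
  induction k with
  | zero => simp
  | succ k ih =>
    rw [Finset.sum_range_succ, ← add_assoc, ← ih (by omega)]
    exact h.step_symm (by omega)

theorem Straight.curve_eq (h : H.Straight D m σ p e) {k : ℕ} (hk : k < m) {s : ℝ}
    (h0 : len k p ≤ s) (h1 : s ≤ len (k + 1) p) :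
    H.curve m σ e p s = p k + (s - len k p) • (H.unfold σ k).symm e := by
  rw [curve, ← Finset.sum_subset (Finset.range_mono (Nat.succ_le_of_lt hk)),
    Finset.sum_range_succ, ← add_assoc]
  · conv_rhs => rw [h.eq_add_sum hk.le]
    congr 2
    · refine Finset.sum_congr rfl fun r hr => ?_
      have h2 := len_mono p (Nat.succ_le_of_lt (Finset.mem_range.1 hr))
      simp only [Nat.succ_eq_add_one, len_succ] at h2
      rw [min_eq_left (by linarith), max_eq_right (norm_nonneg _)]
    · rw [len_succ] at h1
      rw [min_eq_right (by linarith), max_eq_right (by linarith)]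
  · intro r _ hr
    have h2 := len_mono p (not_lt.1 (fun h => hr (Finset.mem_range.2 h)) : k + 1 ≤ r)
    simp only at h2
    rw [max_eq_left ((min_le_right _ _).trans (by linarith)), zero_smul]

theorem Straight.curve_sub (h : H.Straight D m σ p e) {k : ℕ} (hk : k < m) {s : ℝ}
    (h0 : len k p ≤ s) (h1 : s ≤ len (k + 1) p) :
    H.unfold σ k (H.curve m σ e p s - p k) = (s - len k p) • e ∧
      H.unfold σ k (p (k + 1) - H.curve m σ e p s) = (len (k + 1) p - s) • e := by
  have h2 : H.unfold σ k (H.curve m σ e p s - p k) = (s - len k p) • e := by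
    rw [h.curve_eq hk h0 h1, add_sub_cancel_left, map_smul, LinearIsometryEquiv.apply_symm_apply]
  refine ⟨h2, ?_⟩
  rw [← sub_sub_sub_cancel_right _ _ (p k), map_sub, h2, h.step k hk, len_succ]
  module

theorem Straight.norm_curve_sub (h : H.Straight D m σ p e) {k : ℕ} (hk : k < m) {s : ℝ}
    (h0 : len k p ≤ s) (h1 : s ≤ len (k + 1) p) :
    ‖H.curve m σ e p s - p k‖ = s - len k p ∧
      ‖p (k + 1) - H.curve m σ e p s‖ = len (k + 1) p - s := by
  obtain ⟨h2, h3⟩ := h.curve_sub hk h0 h1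
  constructor
  · rw [← (H.unfold σ k).norm_map, h2, norm_smul, h.norm_e, mul_one,
      Real.norm_of_nonneg (by linarith)]
  · rw [← (H.unfold σ k).norm_map, h3, norm_smul, h.norm_e, mul_one,
      Real.norm_of_nonneg (by linarith)]

theorem Straight.curve_mem_facet (h : H.Straight D m σ p e) {k : ℕ} (hk : k < m) {s : ℝ}
    (h0 : len k p ≤ s) (h1 : s ≤ len (k + 1) p) : H.curve m σ e p s ∈ H.facet (σ k) := by
  rcases eq_or_lt_of_le (h0.trans h1) with h2 | h2
  · have : H.curve m σ e p s - p k = 0 := by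
      rw [← norm_eq_zero, (h.norm_curve_sub hk h0 h1).1]; linarith
    rw [sub_eq_zero.1 this]
    exact h.chain.1 k hk.le
  · have h3 : H.curve m σ e p s = ((len (k + 1) p - s) / (len (k + 1) p - len k p)) • p k +
        ((s - len k p) / (len (k + 1) p - len k p)) • p (k + 1) := by
      have hne : len (k + 1) p - len k p ≠ 0 := by linarith
      have h4 : ‖p (k + 1) - p k‖ = len (k + 1) p - len k p := by rw [len_succ]; ring
      rw [h.curve_eq hk h0 h1]
      conv_rhs => rw [h.step_symm hk, h4, smul_add, smul_smul, div_mul_cancel₀ _ hne, ← add_assoc,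
        ← add_smul, ← add_div, sub_add_sub_cancel, div_self hne, one_smul]
    rw [h3]
    refine H.convex_facet _ (h.chain.1 k hk.le) (h.chain.2 k hk) ?_ ?_ ?_
    · exact div_nonneg (by linarith) (by linarith)
    · exact div_nonneg (by linarith) (by linarith)
    · rw [← add_div, sub_add_sub_cancel, div_self (by linarith)]

theorem Straight.exists_curve_index (h : H.Straight D m σ p e) (hD : 0 < D) {s : ℝ}
    (hs : s ∈ Set.Icc 0 D) : ∃ k < m, len k p ≤ s ∧ s ≤ len (k + 1) p :=
  exists_len_le (h.len_eq ▸ hD) hs.1 (h.len_eq ▸ hs.2)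

theorem Straight.curve_mem_surface (h : H.Straight D m σ p e) (hD : 0 < D) {s : ℝ}
    (hs : s ∈ Set.Icc 0 D) : H.curve m σ e p s ∈ H.surface := by
  obtain ⟨k, hk, h0, h1⟩ := h.exists_curve_index hD hs
  exact ⟨_, h.curve_mem_facet hk h0 h1⟩

theorem Straight.curve_zero (h : H.Straight D m σ p e) (hD : 0 < D) :
    H.curve m σ e p 0 = p 0 := by
  obtain ⟨k, hk, h0, h1⟩ := h.exists_curve_index hD (Set.left_mem_Icc.2 hD.le)
  rw [curve, Finset.sum_eq_zero, add_zero]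
  intro r _
  rw [max_eq_left ((min_le_right _ _).trans (by linarith [len_nonneg r p])), zero_smul]

theorem Straight.curve_last (h : H.Straight D m σ p e) : H.curve m σ e p D = p m := by
  rw [curve, h.eq_add_sum le_rfl]
  congr 1
  refine Finset.sum_congr rfl fun r hr => ?_
  have h2 := len_mono p (Nat.succ_le_of_lt (Finset.mem_range.1 hr))
  simp only [Nat.succ_eq_add_one, len_succ, h.len_eq] at h2
  rw [min_eq_left (by linarith), max_eq_right (norm_nonneg _)]

theorem Straight.d_curve (h : H.Straight D m σ p e) (hD : 0 < D) (hd : H.d (p 0) (p m) = D)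
    {s : ℝ} (hs : s ∈ Set.Icc 0 D) : H.d (p 0) (H.curve m σ e p s) = s := by
  obtain ⟨k, hk, h0, h1⟩ := h.exists_curve_index hD hs
  have hz := h.curve_mem_facet hk h0 h1
  have hp0 := h.chain.mem_surface (Nat.zero_le m)
  have hpm := h.chain.mem_surface le_rfl
  have hpk := h.chain.mem_surface hk.le
  have hpk' := h.chain.mem_surface (Nat.succ_le_of_lt hk)
  have h2 := H.d_triangle hp0 hpk ⟨_, hz⟩
  have h3 := H.d_triangle ⟨_, hz⟩ hpk' hpm
  have h4 := H.d_triangle hp0 ⟨_, hz⟩ hpm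
  have h5 := h.chain.d_le_sum (Nat.zero_le k) hk.le
  rw [← Finset.range_eq_Ico] at h5
  change _ ≤ len k p at h5
  have h6 := h.chain.d_le_sum (Nat.succ_le_of_lt hk) le_rfl
  rw [Finset.sum_Ico_eq_sub _ (Nat.succ_le_of_lt hk)] at h6
  change _ ≤ len m p - len (k + 1) p at h6
  rw [h.len_eq] at h6
  obtain ⟨h7, h8⟩ := h.norm_curve_sub hk h0 h1
  rw [H.d_eq_of_mem_facet (h.chain.1 k hk.le) hz, norm_sub_rev, h7] at h2
  rw [H.d_eq_of_mem_facet hz (h.chain.2 k hk), norm_sub_rev, h8] at h3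
  simp only [Nat.succ_eq_add_one] at h3 h6
  linarith

/-- A straight chain starting near `x`, inside the facet, starts with a straight segment. -/
theorem Straight.curve_eq_of_simple (h : H.Straight D m σ p e) (hD : 0 < D) {i : ι} {x : E}
    {δ : ℝ} (hσ : σ 0 = i) (hδ : ∀ y, ‖y - x‖ ≤ δ → ∀ c, y ∈ H.facet c → H.n c = H.n i) {s : ℝ}
    (hs : s ∈ Set.Icc 0 D) (hxs : ‖p 0 - x‖ + s ≤ δ) : H.curve m σ e p s = p 0 + s • e := by
  obtain ⟨k, hk, h0, h1⟩ := h.exists_curve_index hD hs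
  have hn : ∀ r ≤ k, H.n (σ r) = H.n i := by
    intro r hr
    refine hδ (p r) ?_ _ (h.chain.1 r (by omega))
    have h2 : ‖p r - p 0‖ ≤ len r p := by
      rw [h.eq_add_sum (by omega : r ≤ m), add_sub_cancel_left]
      refine (norm_sum_le _ _).trans_eq (Finset.sum_congr rfl fun t ht => ?_)
      rw [norm_smul, LinearIsometryEquiv.norm_map, h.norm_e, mul_one, norm_norm]
    have h3 : len r p ≤ len k p := len_mono p hr
    calc ‖p r - x‖ = ‖(p r - p 0) + (p 0 - x)‖ := by rw [sub_add_sub_cancel]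
      _ ≤ ‖p r - p 0‖ + ‖p 0 - x‖ := norm_add_le _ _
      _ ≤ δ := by linarith
  have hT : ∀ r ≤ k, H.unfold σ r = LinearIsometryEquiv.refl ℝ E := fun r hr =>
    transport_of_const (fun r => H.n (σ r)) (fun _ => H.norm_n _) fun t ht => by
      simp only [hn t (by omega), hσ]
  rw [h.curve_eq hk h0 h1, hT k le_rfl, h.eq_add_sum hk.le,
    Finset.sum_congr rfl fun r hr => by rw [hT r (Finset.mem_range.1 hr).le]]
  change p 0 + ∑ r ∈ Finset.range k, ‖p (r + 1) - p r‖ • e + (s - len k p) • e = _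
  rw [← Finset.sum_smul]
  change p 0 + len k p • e + (s - len k p) • e = _
  module

/-! ### Switching between two chains -/

/-- The facets of a chain following `σ` up to index `k`, and then `σ'` from index `l` on. -/
def switch {α : Type*} (k l : ℕ) (σ σ' : ℕ → α) (r : ℕ) : α :=
  if r ≤ k then σ r else σ' (l + (r - (k + 1)))

theorem switch_of_le {α : Type*} {k l : ℕ} {σ σ' : ℕ → α} {r : ℕ} (h : r ≤ k) :
    switch k l σ σ' r = σ r := if_pos h

theorem switch_add {α : Type*} {k l : ℕ} {σ σ' : ℕ → α} (r : ℕ) :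
    switch k l σ σ' (k + 1 + r) = σ' (l + r) := by
  rw [switch, if_neg (by omega), Nat.add_sub_cancel_left]

theorem sum_switch {V : Type*} [AddCommGroup V] {k l m : ℕ} (hl : l < m) {F A B : ℕ → V} {a b : V}
    (hA : ∀ r < k, F r = A r) (ha : F k = a) (hb : F (k + 1) = b)
    (hB : ∀ r, l + (r + 1) < m → F (k + 1 + (r + 1)) = B (l + (r + 1))) :
    ∑ r ∈ Finset.range (k + 1 + (m - l)), F r =
      ∑ r ∈ Finset.range k, A r + a + (b + ∑ r ∈ Finset.Ico (l + 1) m, B r) := by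
  obtain ⟨n, rfl⟩ : ∃ n, m = l + 1 + n := ⟨m - (l + 1), by omega⟩
  rw [Finset.sum_range_add, show l + 1 + n - l = n + 1 by omega, Finset.sum_range_succ,
    Finset.sum_range_succ', Finset.sum_Ico_eq_sum_range, Nat.add_sub_cancel_left, ha, add_zero, hb,
    Finset.sum_congr rfl fun r hr => hA r (Finset.mem_range.1 hr), add_comm _ b]
  congr 2
  refine Finset.sum_congr rfl fun r hr => ?_
  have := Finset.mem_range.1 hr
  rw [hB r (by omega)]
  congr 1
  omega

end HPolyhedron

namespace HPolyhedron

variable {ι : Type} [Finite ι] {H : HPolyhedron ι}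

theorem unfold_switch_of_le {k l : ℕ} {σ σ' : ℕ → ι} {r : ℕ} (h : r ≤ k) :
    H.unfold (switch k l σ σ') r = H.unfold σ r :=
  transport_congr fun t ht => by simp only [switch_of_le (ht.trans h)]

theorem unfold_switch_add {k l n : ℕ} {σ σ' : ℕ → ι}
    (h : H.unfold (switch k l σ σ') (k + 1 + n) = H.unfold σ' (l + n)) (r : ℕ) :
    H.unfold (switch k l σ σ') (k + 1 + r) = H.unfold σ' (l + r) := by
  have h1 : ∀ r, H.unfold (switch k l σ σ') (k + 1 + r) =
      (transport (fun t => H.n (σ' (l + t))) r).trans (H.unfold (switch k l σ σ') (k + 1)) := by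
    intro r
    rw [unfold, transport_add]
    simp only [switch_add]
  have h2 : H.unfold (switch k l σ σ') (k + 1) = H.unfold σ' l := by
    have h3 : H.unfold σ' (l + n) =
        (transport (fun t => H.n (σ' (l + t))) n).trans (H.unfold σ' l) := transport_add _ l n
    rw [h1 n, h3] at h
    ext1 v
    have := congrArg (fun S : E ≃ₗᵢ[ℝ] E =>
      S ((transport (fun t => H.n (σ' (l + t))) n).symm v)) h
    simpa only [LinearIsometryEquiv.trans_apply, LinearIsometryEquiv.apply_symm_apply] using this
  rw [h1 r, h2]
  exact (transport_add _ l r).symm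

/-- Two straight chains with a common point give a chain which switches at that point. -/
theorem Straight.exists_switch {D : ℝ} {m : ℕ} {σ σ' : ℕ → ι} {p p' : ℕ → E} {e e' : E}
    (h : H.Straight D m σ p e) (h' : H.Straight D m σ' p' e') {k l : ℕ} (hk : k < m) (hl : l < m)
    {s s' : ℝ} (h0 : len k p ≤ s) (h1 : s ≤ len (k + 1) p) (h0' : len l p' ≤ s')
    (h1' : s' ≤ len (l + 1) p') (hz : H.curve m σ e p s = H.curve m σ' e' p' s') :
    ∃ P, H.IsChain (k + 1 + (m - l)) (switch k l σ σ') P ∧ P 0 = p 0 ∧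
      P (k + 1 + (m - l)) = p' m ∧ len (k + 1 + (m - l)) P = s + (D - s') ∧
      (H.unfold (switch k l σ σ') (k + 1 + (m - l)) = H.unfold σ' m →
        H.disp (k + 1 + (m - l)) (switch k l σ σ') P = s • e + (D - s') • e') := by
  set z := H.curve m σ e p s with hzdef
  have hzk := h.curve_mem_facet hk h0 h1
  have hzl : z ∈ H.facet (σ' l) := hz ▸ h'.curve_mem_facet hl h0' h1'
  set P : ℕ → E := fun r => if r = k + 1 then z else switch k l p p' r with hP
  have hPle : ∀ r ≤ k, P r = p r := fun r hr => by
    simp only [hP]; rw [if_neg (by omega), switch_of_le hr]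
  have hPz : P (k + 1) = z := by simp [hP]
  have hPadd : ∀ r, P (k + 1 + (r + 1)) = p' (l + (r + 1)) := fun r => by
    simp only [hP]; rw [if_neg (by omega), switch_add]
  have hPsucc : P (k + 1 + 1) = p' (l + 1) := hPadd 0
  refine ⟨P, ⟨fun r hr => ?_, fun r hr => ?_⟩, hPle 0 (Nat.zero_le _), ?_, ?_, fun hT => ?_⟩
  · rcases Nat.lt_or_ge k r with hkr | hkr
    · obtain ⟨t, rfl⟩ := Nat.exists_eq_add_of_le (Nat.succ_le_of_lt hkr)
      simp only [Nat.succ_eq_add_one] at hr ⊢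
      rw [switch_add]
      rcases t with _ | t
      · exact hPz ▸ hzl
      · rw [hPadd]; exact h'.chain.1 _ (by omega)
    · rw [hPle r hkr, switch_of_le hkr]
      exact h.chain.1 r (by omega)
  · rcases Nat.lt_or_ge k r with hkr | hkr
    · obtain ⟨t, rfl⟩ := Nat.exists_eq_add_of_le (Nat.succ_le_of_lt hkr)
      simp only [Nat.succ_eq_add_one] at hr ⊢
      rw [switch_add, add_assoc, hPadd]
      exact h'.chain.2 (l + t) (by omega)
    · rw [switch_of_le hkr]
      rcases eq_or_lt_of_le hkr with rfl | hkr'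
      · exact hPz ▸ hzk
      · rw [hPle (r + 1) hkr']; exact h.chain.2 r (by omega)
  · obtain ⟨n, hn⟩ : ∃ n, m - l = n + 1 := ⟨m - l - 1, by omega⟩
    rw [hn, hPadd, ← hn]
    congr 1
    omega
  · rw [len, sum_switch hl (A := fun r => ‖p (r + 1) - p r‖) (B := fun r => ‖p' (r + 1) - p' r‖)
      (a := ‖z - p k‖) (b := ‖p' (l + 1) - z‖)]
    · rw [(h.norm_curve_sub hk h0 h1).1, hz, (h'.norm_curve_sub hl h0' h1').2,
        Finset.sum_Ico_eq_sub _ (Nat.succ_le_of_lt hl)]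
      change len k p + _ + (_ + (len m p' - len (l + 1) p')) = _
      rw [h'.len_eq]
      ring
    · intro r hr; simp only [hPle r hr.le, hPle (r + 1) hr]
    · simp only [hPle k le_rfl, hPz]
    · rw [hPz, hPsucc]
    · intro r _; rw [add_assoc, hPadd, hPadd]; rfl
  · have hTr := unfold_switch_add (n := m - l) (hT.trans (by congr 1; omega))
    rw [disp, sum_switch hl (A := fun r => ‖p (r + 1) - p r‖ • e)
      (B := fun r => ‖p' (r + 1) - p' r‖ • e') (a := (s - len k p) • e)
      (b := (len (l + 1) p' - s') • e')]
    · rw [← Finset.sum_smul, ← Finset.sum_smul, Finset.sum_Ico_eq_sub _ (Nat.succ_le_of_lt hl)]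
      change len k p • e + _ + (_ + (len m p' - len (l + 1) p') • e') = _
      rw [h'.len_eq]
      module
    · intro r hr
      rw [unfold_switch_of_le hr.le, hPle r hr.le, hPle (r + 1) hr, h.step r (by omega)]
    · rw [unfold_switch_of_le le_rfl, hPle k le_rfl, hPz, (h.curve_sub hk h0 h1).1]
    · have := hTr 0
      rw [add_zero, add_zero] at this
      rw [this, hPz, hPsucc, hz, (h'.curve_sub hl h0' h1').2]
    · intro r hr
      rw [hTr, add_assoc (k + 1), hPadd, hPadd, ← h'.step _ hr]
      rfl

theorem eq_or_eq_of_norm_smul_add_smul {D s : ℝ} {e e' : E} (he : ‖e‖ = 1) (he' : ‖e'‖ = 1)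
    (h : ‖s • e + (D - s) • e'‖ = D) : e = e' ∨ s = 0 ∨ s = D := by
  have h1 : ‖s • e + (D - s) • e'‖ ^ 2 = D ^ 2 := by rw [h]
  rw [norm_add_sq_real, norm_smul, norm_smul, he, he', inner_smul_left, inner_smul_right, mul_one,
    mul_one, Real.norm_eq_abs, Real.norm_eq_abs, sq_abs, sq_abs, conj_trivial] at h1
  have h2 : s * ((D - s) * (⟪e, e'⟫ - 1)) = 0 := by linear_combination h1 / 2
  rcases mul_eq_zero.1 h2 with h3 | h3
  · exact Or.inr (Or.inl h3)
  rcases mul_eq_zero.1 h3 with h4 | h4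
  · exact Or.inr (Or.inr (sub_eq_zero.1 h4).symm)
  · exact Or.inl ((inner_eq_one_iff_of_norm_eq_one he he').1 (sub_eq_zero.1 h4))

/-- The interpolation of two chains. -/
noncomputable def interp (p q : ℕ → E) (t : ℝ) (k : ℕ) : E := (1 - t) • p k + t • q k

theorem continuous_interp (p q : ℕ → E) : Continuous fun t => interp p q t := by
  unfold interp; fun_prop

section

variable {D : ℝ} {N : ℕ} {i j : ι} {T : E ≃ₗᵢ[ℝ] E} {x y w : E} {σ : Fin 3 → ℕ → ι}
  {p q : Fin 3 → ℕ → E} {e : Fin 3 → E}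

theorem Config.straight_interp (C : H.Config D N i j T x y w σ p q e) (r : Fin 3) {t : ℝ}
    (ht0 : 0 ≤ t) (ht1 : t ≤ 1) : H.Straight D N (σ r) (interp (p r) (q r) t) (e r) :=
  ((C.straight r).convexComb (C.straight' r) ht0 ht1).1

theorem Config.interp_zero (C : H.Config D N i j T x y w σ p q e) (r : Fin 3) (t : ℝ) :
    interp (p r) (q r) t 0 = x + t • w := by
  rw [interp, C.zero, C.zero']; module

theorem Config.interp_last (C : H.Config D N i j T x y w σ p q e) (r : Fin 3) (t : ℝ) :
    interp (p r) (q r) t N = y + t • T.symm w := by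
  rw [interp, C.last, C.last']; module

/-- Intersections of the straight chains from `x` to `y` with slightly translated ones. -/
theorem Config.eventually_inter (C : H.Config D N i j T x y w σ p q e) (r r' : Fin 3) :
    ∀ᶠ t in 𝓝[>] (0 : ℝ), ∀ s ∈ Set.Icc 0 D, ∀ s' ∈ Set.Icc 0 D,
      H.curve N (σ r) (e r) (p r) s = H.curve N (σ r') (e r') (interp (p r') (q r') t) s' →
      ∃ u, s • e r - s' • e r' = t • w + u • (e r - e r') ∧ (e r = e r' ∨ u = 0 ∨ u = D) := by
  rw [Filter.Eventually, mem_iff_ultrafilter]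
  intro U hU
  by_contra hcon
  have hpos : ∀ᶠ t in (U : Filter ℝ), t ∈ Set.Ioo (0 : ℝ) 1 :=
    hU (Ioo_mem_nhdsGT one_pos)
  have hcon' : ∀ᶠ t in (U : Filter ℝ), ∃ z : ℝ × ℝ, z.1 ∈ Set.Icc 0 D ∧ z.2 ∈ Set.Icc 0 D ∧
      H.curve N (σ r) (e r) (p r) z.1 = H.curve N (σ r') (e r') (interp (p r') (q r') t) z.2 ∧
      ¬ ∃ u, z.1 • e r - z.2 • e r' = t • w + u • (e r - e r') ∧ (e r = e r' ∨ u = 0 ∨ u = D) := by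
    have := Ultrafilter.compl_mem_iff_notMem.2 hcon
    filter_upwards [this] with t ht
    simp only [Set.mem_compl_iff, Set.mem_ofPred_eq, not_forall] at ht
    obtain ⟨s, hs, s', hs', h1, h2⟩ := ht
    exact ⟨(s, s'), hs, hs', h1, h2⟩
  have hch : ∀ t, ∃ z : ℝ × ℝ, (∃ z : ℝ × ℝ, z.1 ∈ Set.Icc 0 D ∧ z.2 ∈ Set.Icc 0 D ∧
      H.curve N (σ r) (e r) (p r) z.1 = H.curve N (σ r') (e r') (interp (p r') (q r') t) z.2 ∧
      ¬ ∃ u, z.1 • e r - z.2 • e r' = t • w + u • (e r - e r') ∧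
        (e r = e r' ∨ u = 0 ∨ u = D)) → z.1 ∈ Set.Icc 0 D ∧ z.2 ∈ Set.Icc 0 D ∧
      H.curve N (σ r) (e r) (p r) z.1 = H.curve N (σ r') (e r') (interp (p r') (q r') t) z.2 ∧
      ¬ ∃ u, z.1 • e r - z.2 • e r' = t • w + u • (e r - e r') ∧
        (e r = e r' ∨ u = 0 ∨ u = D) := by
    intro t
    by_cases h : ∃ z : ℝ × ℝ, z.1 ∈ Set.Icc 0 D ∧ z.2 ∈ Set.Icc 0 D ∧
      H.curve N (σ r) (e r) (p r) z.1 = H.curve N (σ r') (e r') (interp (p r') (q r') t) z.2 ∧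
      ¬ ∃ u, z.1 • e r - z.2 • e r' = t • w + u • (e r - e r') ∧ (e r = e r' ∨ u = 0 ∨ u = D)
    · exact ⟨h.choose, fun _ => h.choose_spec⟩
    · exact ⟨0, fun h' => absurd h' h⟩
  choose f hf using hch
  have hf : ∀ᶠ t in (U : Filter ℝ), (f t).1 ∈ Set.Icc 0 D ∧ (f t).2 ∈ Set.Icc 0 D ∧
      H.curve N (σ r) (e r) (p r) (f t).1 =
        H.curve N (σ r') (e r') (interp (p r') (q r') t) (f t).2 ∧
      ¬ ∃ u, (f t).1 • e r - (f t).2 • e r' = t • w + u • (e r - e r') ∧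
        (e r = e r' ∨ u = 0 ∨ u = D) := hcon'.mono hf
  have hidx : ∃ a ∈ {a : ℕ × ℕ | a.1 < N ∧ a.2 < N}, ∀ᶠ t in (U : Filter ℝ),
      (len a.1 (p r) ≤ (f t).1 ∧ (f t).1 ≤ len (a.1 + 1) (p r)) ∧
      (len a.2 (interp (p r') (q r') t) ≤ (f t).2 ∧
        (f t).2 ≤ len (a.2 + 1) (interp (p r') (q r') t)) := by
    have hfin : {a : ℕ × ℕ | a.1 < N ∧ a.2 < N}.Finite :=
      ((Set.finite_Iio N).prod (Set.finite_Iio N)).subset fun a ha => ⟨ha.1, ha.2⟩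
    rw [← Ultrafilter.eventually_exists_mem_iff hfin]
    filter_upwards [hf, hpos] with t ht ht0
    obtain ⟨k, hk, h1, h2⟩ := (C.straight r).exists_curve_index C.pos ht.1
    obtain ⟨l, hl, h3, h4⟩ :=
      (C.straight_interp r' ht0.1.le ht0.2.le).exists_curve_index C.pos ht.2.1
    exact ⟨(k, l), ⟨hk, hl⟩, ⟨h1, h2⟩, h3, h4⟩
  obtain ⟨⟨k, l⟩, ⟨hk, hl⟩, hkl⟩ := hidx
  simp only at hk hl hkl
  obtain ⟨⟨s, s'⟩, hss, hlim⟩ := isCompact_iff_ultrafilter_le_nhds.1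
    (isCompact_Icc.prod isCompact_Icc : IsCompact (Set.Icc 0 D ×ˢ Set.Icc 0 D)) (U.map f)
    (by rw [le_principal_iff]; exact hf.mono fun t ht => ⟨ht.1, ht.2.1⟩)
  have hs1 : s ∈ Set.Icc 0 D := hss.1
  have hs2 : s' ∈ Set.Icc 0 D := hss.2
  replace hlim : Tendsto f U (𝓝 (s, s')) := hlim
  have hl1 : Tendsto (fun t => (f t).1) U (𝓝 s) := (continuous_fst.tendsto _).comp hlim
  have hl2 : Tendsto (fun t => (f t).2) U (𝓝 s') := (continuous_snd.tendsto _).comp hlim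
  have hp' : Tendsto (fun t => interp (p r') (q r') t) U (𝓝 (p r')) := by
    have h1 := (continuous_interp (p r') (q r')).tendsto 0
    have h2 : interp (p r') (q r') 0 = p r' := by funext k; simp [interp]
    rw [h2] at h1
    exact h1.mono_left (hU.trans nhdsWithin_le_nhds)
  have hc1 : Tendsto (fun t => H.curve N (σ r) (e r) (p r) (f t).1) U
      (𝓝 (H.curve N (σ r) (e r) (p r) s)) :=
    ((continuous_curve N (σ r) (e r)).tendsto (p r, s)).comp (tendsto_const_nhds.prodMk_nhds hl1)
  have hc2 : Tendsto (fun t => H.curve N (σ r') (e r') (interp (p r') (q r') t) (f t).2) U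
      (𝓝 (H.curve N (σ r') (e r') (p r') s')) :=
    ((continuous_curve N (σ r') (e r')).tendsto (p r', s')).comp (hp'.prodMk_nhds hl2)
  have hcs := tendsto_nhds_unique_of_eventuallyEq hc1 hc2 (hf.mono fun t ht => ht.2.2.1)
  have hlen : ∀ n, Tendsto (fun t => len n (interp (p r') (q r') t)) U (𝓝 (len n (p r'))) :=
    fun n => ((continuous_len n).tendsto _).comp hp'
  have hk0 : len k (p r) ≤ s := ge_of_tendsto hl1 (hkl.mono fun t ht => ht.1.1)
  have hk1 : s ≤ len (k + 1) (p r) := le_of_tendsto hl1 (hkl.mono fun t ht => ht.1.2)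
  have hl0 : len l (p r') ≤ s' := le_of_tendsto_of_tendsto (hlen l) hl2
    (hkl.mono fun t ht => ht.2.1)
  have hl1' : s' ≤ len (l + 1) (p r') := le_of_tendsto_of_tendsto hl2 (hlen (l + 1))
    (hkl.mono fun t ht => ht.2.2)
  have hss' : s = s' := by
    have h1 := (C.straight r).d_curve C.pos (by rw [C.zero, C.last, C.d_eq]) hs1
    have h2 := (C.straight r').d_curve C.pos (by rw [C.zero, C.last, C.d_eq]) hs2
    rw [C.zero] at h1 h2
    rw [← h1, ← h2, hcs]
  subst hss'
  obtain ⟨P, hP, hP0, hPm, hPl, hPd⟩ := (C.straight r).exists_switch (C.straight r') hk hl hk0 hk1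
    hl0 hl1' hcs
  rw [add_sub_cancel] at hPl
  set M := k + 1 + (N - l) with hM
  have hT' : H.unfold (σ r') N = T := C.unfold_eq N (by omega) _ (C.type_zero r') (C.type_last r')
    ⟨p r', (C.straight r').chain, C.zero r', C.last r', (C.straight r').len_eq.le⟩
  have hsM : switch k l (σ r) (σ r') M = j := by
    rw [hM, switch_add, ← C.type_last r']; congr 1; omega
  have hT : H.unfold (switch k l (σ r) (σ r')) M = T :=
    C.unfold_eq M (by omega) _ (by rw [switch_of_le (Nat.zero_le k), C.type_zero]) hsM
      ⟨P, hP, hP0.trans (C.zero r), hPm.trans (C.last r'), hPl.le⟩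
  have hPd := hPd (hT.trans hT'.symm)
  have hu : e r = e r' ∨ s = 0 ∨ s = D := by
    refine eq_or_eq_of_norm_smul_add_smul (C.straight r).norm_e (C.straight r').norm_e ?_
    have hd : H.d (P 0) (P M) = D := by rw [hP0, hPm, C.zero, C.last, C.d_eq]
    rw [← hPd, hP.norm_disp_eq (by rw [hd, hPl]), hd]
  obtain ⟨t, ⟨ht1, ht2⟩, ht3⟩ := ((hf.and hkl).and hpos).exists
  obtain ⟨hf1, hf2, hf3, hf4⟩ := ht1
  apply hf4
  have hst := C.straight_interp r' ht3.1.le ht3.2.le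
  obtain ⟨Q, hQ, hQ0, hQm, -, hQd⟩ := (C.straight r).exists_switch hst hk hl ht2.1.1 ht2.1.2
    ht2.2.1 ht2.2.2 hf3
  have hQd := hQd (hT.trans hT'.symm)
  refine ⟨s, ?_, hu⟩
  have h1 := hP.disp_eq hQ le_rfl
  rw [hPd, hQd, hQ0, hP0, hQm, hPm, sub_self, sub_zero, hT, C.interp_last, C.last,
    add_sub_cancel_left, map_smul, T.apply_symm_apply] at h1
  rw [← sub_eq_zero, ← sub_eq_zero.2 h1]
  module

end

end HPolyhedron

/-- Two paths with common endpoints, concatenated to a periodic function. -/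
theorem exists_periodic_concat {X : Type*} [TopologicalSpace X] {D : ℝ} (hD : 0 < D)
    {c c' : ℝ → X} (hc : Continuous c) (hc' : Continuous c') (h0 : c 0 = c' 0) (h1 : c D = c' D) :
    ∃ A : ℝ → X, Continuous A ∧ A.Periodic (2 * D) ∧ (∀ s ∈ Set.Icc 0 D, A s = c s) ∧
      ∀ s ∈ Set.Icc 0 D, A (-s) = c' s := by
  have : Fact (0 < 2 * D) := ⟨by linarith⟩
  set g : ℝ → X := fun s => if 0 ≤ s then c s else c' (-s) with hg
  have hgc : Continuous g := by
    refine Continuous.if_le hc (hc'.comp continuous_neg) continuous_const continuous_id ?_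
    rintro s rfl
    simpa using h0
  have hpos : ∀ s, 0 ≤ s → g s = c s := fun s hs => if_pos hs
  have hneg : ∀ s, 0 ≤ s → g (-s) = c' s := by
    intro s hs
    rcases hs.eq_or_lt with rfl | hs
    · simp [hg, h0]
    · simp [hg, hs.not_ge]
  have hD' : g (-D) = g (-D + 2 * D) := by
    rw [hneg D hD.le, show -D + 2 * D = D by ring, hpos D hD.le, h1]
  have hco := AddCircle.liftIco_continuous (p := 2 * D) (a := -D) hD' hgc.continuousOn
  have hper : (fun s : ℝ => AddCircle.liftIco (2 * D) (-D) g (s : AddCircle (2 * D))).Periodic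
      (2 * D) := fun s => by simp only [AddCircle.coe_add_period]
  have hval : ∀ s ∈ Set.Ico (-D) D, AddCircle.liftIco (2 * D) (-D) g (s : AddCircle (2 * D)) =
      g s := fun s hs => AddCircle.liftIco_coe_apply (by
        rwa [show -D + 2 * D = D by ring])
  refine ⟨_, hco.comp (AddCircle.continuous_mk' _), hper, fun s hs => ?_, fun s hs => ?_⟩
  · rcases hs.2.eq_or_lt with rfl | hs'
    · have := hper (-s)
      rw [show -s + 2 * s = s by ring] at this
      exact this.trans ((hval _ ⟨le_rfl, by linarith⟩).trans ((hneg s hs.1).trans h1.symm))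
    · exact (hval s ⟨by linarith [hs.1], hs'⟩).trans (hpos s hs.1)
  · exact (hval (-s) ⟨by linarith [hs.2], by linarith [hs.1]⟩).trans (hneg s hs.1)

/-- The cone over a segment has dimension at most two. -/
theorem dimH_range_smul_line_le (p v : E) :
    dimH (Set.range fun z : ℝ × ℝ => z.1 • (p + z.2 • v)) ≤ 2 := by
  have h : ContDiff ℝ 1 fun z : ℝ × ℝ => z.1 • (p + z.2 • v) := by fun_prop
  refine h.dimH_range_le.trans ?_
  rw [Module.finrank_prod, Module.finrank_self]
  norm_num

namespace HPolyhedron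

variable {ι : Type} [Finite ι] {H : HPolyhedron ι}

theorem Straight.dimH_cone_le {D : ℝ} {m : ℕ} {σ : ℕ → ι} {p : ℕ → E} {e : E}
    (h : H.Straight D m σ p e) (hD : 0 < D) (z : E) :
    dimH {u | ∃ c : ℝ, ∃ s ∈ Set.Icc 0 D, u = c • (H.curve m σ e p s - z)} ≤ 2 := by
  have hsub : {u | ∃ c : ℝ, ∃ s ∈ Set.Icc 0 D, u = c • (H.curve m σ e p s - z)} ⊆
      ⋃ k ∈ Finset.range m, Set.range fun a : ℝ × ℝ =>
        a.1 • ((p k - z) + a.2 • (H.unfold σ k).symm e) := by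
    rintro u ⟨c, s, hs, rfl⟩
    obtain ⟨k, hk, h0, h1⟩ := h.exists_curve_index hD hs
    refine Set.mem_iUnion₂.2 ⟨k, Finset.mem_range.2 hk, (c, s - len k p), ?_⟩
    simp only
    rw [h.curve_eq hk h0 h1]
    module
  refine (dimH_mono hsub).trans ?_
  rw [← Finset.set_biUnion_coe, dimH_bUnion (Finset.countable_toSet _)]
  exact iSup₂_le fun k _ => dimH_range_smul_line_le _ _

theorem eq_zero_of_smul_eq_smul {e e' ν : E} (he : ‖e‖ = 1) (he' : ‖e'‖ = 1) (hν : 0 < ⟪e, ν⟫)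
    (hν' : 0 < ⟪e', ν⟫) (hne : e ≠ e') {x y : ℝ} (h : x • e = y • e') : x = 0 ∧ y = 0 := by
  have h1 : |x| = |y| := by
    have := congrArg norm h
    rwa [norm_smul, norm_smul, he, he', mul_one, mul_one] at this
  have h2 : x * ⟪e, ν⟫ = y * ⟪e', ν⟫ := by
    have := congrArg (fun v => ⟪v, ν⟫) h
    simpa [inner_smul_left] using this
  rcases abs_eq_abs.1 h1 with rfl | rfl
  · by_contra h3
    exact hne (smul_right_injective _ (fun h4 => h3 ⟨h4, h4⟩) h)
  · have h4 : y * (⟪e, ν⟫ + ⟪e', ν⟫) = 0 := by linear_combination -h2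
    have h5 : y = 0 := (mul_eq_zero.1 h4).resolve_right (by positivity)
    simp [h5]

/-- Two closed curves in the surface which cross at a single point. -/
structure Crossing (H : HPolyhedron ι) (i : ι) (z e e' : E) (L δ : ℝ) (A B : ℝ → E) : Prop where
  pos : 0 < L
  delta_pos : 0 < δ
  simple : H.Simple i z
  inner_left : ⟪H.n i, e⟫ = 0
  inner_right : ⟪H.n i, e'⟫ = 0
  linearIndependent : LinearIndependent ℝ ![e, e']
  continuous_left : Continuous A
  continuous_right : Continuous B
  periodic_left : A.Periodic L
  periodic_right : B.Periodic L
  mem_left : ∀ s, A s ∈ H.surface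
  mem_right : ∀ s, B s ∈ H.surface
  left_eq : ∀ s, |s| < δ → A s = z + s • e
  right_eq : ∀ s, |s| < δ → B s = z + s • e'
  inter : ∀ s t, A s = B t → ∃ m n : ℤ, s = m * L ∧ t = n * L
  dimH_left : dimH {u | ∃ c s : ℝ, u = c • (A s - z)} ≤ 2
  dimH_right : dimH {u | ∃ c s : ℝ, u = c • (B s - z)} ≤ 2

theorem dimH_cone_periodic_le {D : ℝ} (hD : 0 < D) {A c c' : ℝ → E} {z : E}
    (hper : A.Periodic (2 * D)) (h : ∀ s ∈ Set.Icc 0 D, A s = c s)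
    (h' : ∀ s ∈ Set.Icc 0 D, A (-s) = c' s)
    (hdim : dimH {u | ∃ a : ℝ, ∃ s ∈ Set.Icc 0 D, u = a • (c s - z)} ≤ 2)
    (hdim' : dimH {u | ∃ a : ℝ, ∃ s ∈ Set.Icc 0 D, u = a • (c' s - z)} ≤ 2) (t : ℝ) :
    dimH {u | ∃ a s : ℝ, u = a • (A (s + t) - z)} ≤ 2 := by
  refine (dimH_mono ?_).trans ((dimH_union _ _).trans_le (max_le hdim hdim'))
  rintro u ⟨a, s, rfl⟩
  obtain ⟨y, hy, hy'⟩ := hper.exists_mem_Ico (by linarith) (s + t) (-D)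
  rw [hy']
  rcases le_total 0 y with h0 | h0
  · have hy1 : y ∈ Set.Icc 0 D := ⟨h0, by linarith [hy.2]⟩
    exact Or.inl ⟨a, y, hy1, by rw [h y hy1]⟩
  · have hy1 : -y ∈ Set.Icc 0 D := ⟨by linarith, by linarith [hy.1]⟩
    exact Or.inr ⟨a, -y, hy1, by rw [← h' _ hy1, neg_neg]⟩

theorem mem_of_periodic {X : Type*} {S : Set X} {D : ℝ} (hD : 0 < D) {A c c' : ℝ → X}
    (hper : A.Periodic (2 * D)) (h : ∀ s ∈ Set.Icc 0 D, A s = c s)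
    (h' : ∀ s ∈ Set.Icc 0 D, A (-s) = c' s) (hc : ∀ s ∈ Set.Icc 0 D, c s ∈ S)
    (hc' : ∀ s ∈ Set.Icc 0 D, c' s ∈ S) (t : ℝ) : A t ∈ S := by
  obtain ⟨y, hy, hy'⟩ := hper.exists_mem_Ico (by linarith) t (-D)
  rw [hy']
  rcases le_total 0 y with h0 | h0
  · have hy1 : y ∈ Set.Icc 0 D := ⟨h0, by linarith [hy.2]⟩
    rw [h y hy1]; exact hc y hy1
  · have hy1 : -y ∈ Set.Icc 0 D := ⟨by linarith, by linarith [hy.1]⟩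
    rw [← neg_neg y, h' _ hy1]; exact hc' _ hy1

theorem inter_of_periodic {X : Type*} {D : ℝ} (hD : 0 < D) {A B : ℝ → X}
    (hA : A.Periodic (2 * D)) (hB : B.Periodic (2 * D)) {a b : ℝ}
    (h : ∀ s ∈ Set.Icc (-D) D, ∀ t ∈ Set.Icc (-D) D, A s = B t → s = a ∧ t = b) (s t : ℝ)
    (hst : A (s + a) = B (t + b)) : ∃ m n : ℤ, s = m * (2 * D) ∧ t = n * (2 * D) := by
  have hp : 0 < 2 * D := by linarith
  obtain ⟨m, hm, -⟩ := existsUnique_add_zsmul_mem_Ico hp (s + a) (-D)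
  obtain ⟨n, hn, -⟩ := existsUnique_add_zsmul_mem_Ico hp (t + b) (-D)
  have hI : Set.Ico (-D) (-D + 2 * D) ⊆ Set.Icc (-D) D := fun x hx => ⟨hx.1, by linarith [hx.2]⟩
  have h1 := h _ (hI hm) _ (hI hn) (by rw [hA.zsmul m, hB.zsmul n, hst])
  rw [zsmul_eq_mul, zsmul_eq_mul] at h1
  refine ⟨-m, -n, ?_, ?_⟩ <;> push_cast <;> linarith [h1.1, h1.2]

theorem eventually_norm_smul_lt (v : E) {δ : ℝ} (hδ : 0 < δ) :
    ∀ᶠ t in 𝓝[>] (0 : ℝ), ‖t • v‖ < δ := by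
  have : Tendsto (fun t : ℝ => ‖t • v‖) (𝓝[>] 0) (𝓝 ‖(0 : ℝ) • v‖) :=
    (Continuous.tendsto (by fun_prop) 0).mono_left nhdsWithin_le_nhds
  exact this.eventually_lt_const (by simpa using hδ)

end HPolyhedron

namespace HPolyhedron

variable {ι : Type} [Finite ι] {H : HPolyhedron ι}

theorem Config.exists_crossing {D : ℝ} {N : ℕ} {i j : ι} {T : E ≃ₗᵢ[ℝ] E} {x y w : E}
    {σ : Fin 3 → ℕ → ι} {p q : Fin 3 → ℕ → E} {e : Fin 3 → E}
    (C : H.Config D N i j T x y w σ p q e) {ν : E} {a b : ℝ} (ha : 0 < a) (hb : 0 < b)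
    (hw : w = a • e 1 - b • e 2) (h0 : ⟪e 0, ν⟫ < 0) (h1 : 0 < ⟪e 1, ν⟫) (h2 : 0 < ⟪e 2, ν⟫)
    (hwν : ⟪w, ν⟫ = 0) (hne : e 1 ≠ e 2) (hn : ∀ r, ⟪H.n i, e r⟫ = 0) :
    ∃ z L δ A B, H.Crossing i z (e 1) (e 2) L δ A B := by
  have hD := C.pos
  have he : ∀ r, ‖e r‖ = 1 := fun r => (C.straight r).norm_e
  have hlin : ∀ {s t : ℝ}, s • e 1 = t • e 2 → s = 0 ∧ t = 0 :=
    fun h => eq_zero_of_smul_eq_smul (he 1) (he 2) h1 h2 hne h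
  have hw0 : w ≠ 0 := fun h => ha.ne' (hlin (sub_eq_zero.1 (hw.symm.trans h))).1
  obtain ⟨δ, hδ, hball⟩ := Metric.eventually_nhds_iff.1 (H.eventually_forall_of_inner_lt x)
  obtain ⟨δ', hδ', hball'⟩ := Metric.eventually_nhds_iff.1 C.simple.eventually
  have hsm : ∀ z, ‖z - x‖ ≤ δ / 2 → ∀ c, z ∈ H.facet c → H.n c = H.n i := by
    intro z hz c hc
    refine C.simple.2 c ⟨C.simple.1.1, ?_⟩
    by_contra h
    have := hball (by rw [dist_eq_norm]; linarith) c (lt_of_le_of_ne (C.simple.1.1 c) h)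
    exact this.ne hc.2
  have hev : ∀ c : ℝ, 0 < c → ∀ᶠ t in 𝓝[>] (0 : ℝ), t < c := fun c hc =>
    eventually_nhdsWithin_of_eventually_nhds (eventually_lt_nhds hc)
  obtain ⟨t, ⟨⟨⟨⟨⟨⟨⟨⟨⟨⟨h10, h12⟩, h00⟩, h02⟩, ht0⟩, ht1⟩, hta⟩, htb⟩, hta'⟩, htw⟩, htw'⟩⟩ :=
    (((((((((((C.eventually_inter 1 0).and (C.eventually_inter 1 2)).and
      (C.eventually_inter 0 0)).and (C.eventually_inter 0 2)).and
      (eventually_mem_nhdsWithin (a := (0 : ℝ)) (s := Set.Ioi 0))).and (hev 1 one_pos)).and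
      (hev (min D (δ / 8) / a) (by positivity))).and
      (hev (min D (δ / 8) / b) (by positivity))).and
      (hev (δ' / a) (by positivity))).and
      (eventually_norm_smul_lt w (show 0 < δ / 8 by positivity))).and
      (eventually_norm_smul_lt w hδ')).exists
  replace ht0 : 0 < t := ht0
  rw [lt_div_iff₀ ha, lt_min_iff] at hta
  rw [lt_div_iff₀ hb, lt_min_iff] at htb
  rw [lt_div_iff₀ ha] at hta'
  have hta0 : 0 < t * a := mul_pos ht0 ha
  have htb0 : 0 < t * b := mul_pos ht0 hb
  have hS := fun r => C.straight_interp r ht0.le ht1.le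
  have hc0 : ∀ r, H.curve N (σ r) (e r) (p r) 0 = x := fun r => by
    rw [(C.straight r).curve_zero hD, C.zero]
  have hcD : ∀ r, H.curve N (σ r) (e r) (p r) D = y := fun r => by
    rw [(C.straight r).curve_last, C.last]
  have hi0 : ∀ r, H.curve N (σ r) (e r) (interp (p r) (q r) t) 0 = x + t • w := fun r => by
    rw [(hS r).curve_zero hD, C.interp_zero]
  have hiD : ∀ r, H.curve N (σ r) (e r) (interp (p r) (q r) t) D = y + t • T.symm w := fun r => by
    rw [(hS r).curve_last, C.interp_last]
  have hcc : ∀ r P, Continuous (H.curve N (σ r) (e r) P) := fun r P =>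
    (continuous_curve N (σ r) (e r)).comp (continuous_const.prodMk continuous_id)
  obtain ⟨A, hAc, hAp, hA1, hA0⟩ := exists_periodic_concat hD (hcc 1 (p 1)) (hcc 0 (p 0))
    ((hc0 1).trans (hc0 0).symm) ((hcD 1).trans (hcD 0).symm)
  obtain ⟨B, hBc, hBp, hB2, hB0⟩ := exists_periodic_concat hD
    (hcc 2 (interp (p 2) (q 2) t)) (hcc 0 (interp (p 0) (q 0) t))
    ((hi0 2).trans (hi0 0).symm) ((hiD 2).trans (hiD 0).symm)
  have hwt : t • w ≠ 0 := smul_ne_zero ht0.ne' hw0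
  have hinn : ∀ {r r' : Fin 3} {s s' u : ℝ}, s • e r - s' • e r' = t • w + u • (e r - e r') →
      (s - u) * ⟪e r, ν⟫ = (s' - u) * ⟪e r', ν⟫ := by
    intro r r' s s' u h
    have := congrArg (fun v => ⟪v, ν⟫) h
    simp only [inner_sub_left, inner_add_left, inner_smul_left, hwν, conj_trivial] at this
    linear_combination this
  have hopp : ∀ {s s' u : ℝ} {r r' : Fin 3}, s ∈ Set.Icc 0 D → s' ∈ Set.Icc 0 D →
      s • e r - s' • e r' = t • w + u • (e r - e r') → (e r = e r' ∨ u = 0 ∨ u = D) →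
      ⟪e r, ν⟫ * ⟪e r', ν⟫ < 0 → False := by
    intro s s' u r r' hs hs' h hu hsign
    have h3 := hinn h
    have hprod : (s - u) * (s' - u) ≥ 0 := by
      rcases hu with hu | rfl | rfl
      · rw [hu] at hsign
        exact absurd hsign (not_lt.2 (mul_self_nonneg _))
      · nlinarith [hs.1, hs'.1]
      · nlinarith [hs.2, hs'.2]
    have h4 : (s - u) ^ 2 * ⟪e r, ν⟫ ^ 2 = (s - u) * (s' - u) * (⟪e r, ν⟫ * ⟪e r', ν⟫) := by
      linear_combination (s - u) * ⟪e r, ν⟫ * h3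
    have h5 : ⟪e r, ν⟫ ≠ 0 := left_ne_zero_of_mul hsign.ne
    have h5' : ⟪e r', ν⟫ ≠ 0 := right_ne_zero_of_mul hsign.ne
    have h6 : (s - u) ^ 2 * ⟪e r, ν⟫ ^ 2 = 0 :=
      le_antisymm (h4.trans_le (mul_nonpos_of_nonneg_of_nonpos hprod hsign.le)) (by positivity)
    have h7 : s - u = 0 := by
      rcases mul_eq_zero.1 h6 with h | h
      · exact pow_eq_zero_iff two_ne_zero |>.1 h
      · exact absurd h (by positivity)
    rw [h7, zero_mul] at h3
    have h8 : s' - u = 0 := (mul_eq_zero.1 h3.symm).resolve_right h5'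
    apply hwt
    rw [sub_eq_zero] at h7 h8
    calc t • w = (t • w + u • (e r - e r')) - u • (e r - e r') := by module
      _ = 0 := by rw [← h, h7, h8]; module
  have hinter : ∀ s ∈ Set.Icc (-D) D, ∀ s' ∈ Set.Icc (-D) D, A s = B s' →
      s = t * a ∧ s' = t * b := by
    intro s hs s' hs' h
    rcases le_total 0 s with hs0 | hs0 <;> rcases le_total 0 s' with hs0' | hs0'
    · have hI : s ∈ Set.Icc 0 D := ⟨hs0, hs.2⟩
      have hI' : s' ∈ Set.Icc 0 D := ⟨hs0', hs'.2⟩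
      rw [hA1 s hI, hB2 s' hI'] at h
      obtain ⟨u, h3, hu⟩ := h12 s hI s' hI' h
      have h4 : (s - t * a - u) • e 1 = (s' - t * b - u) • e 2 := by
        rw [hw] at h3
        rw [← sub_eq_zero, ← sub_eq_zero.2 h3]
        module
      obtain ⟨h5, h6⟩ := hlin h4
      rcases hu.resolve_left hne with rfl | rfl
      · exact ⟨by linarith, by linarith⟩
      · linarith [hI.2]
    · have hI : s ∈ Set.Icc 0 D := ⟨hs0, hs.2⟩
      have hI' : -s' ∈ Set.Icc 0 D := ⟨by linarith, by linarith [hs'.1]⟩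
      rw [hA1 s hI, ← neg_neg s', hB0 _ hI'] at h
      obtain ⟨u, h3, hu⟩ := h10 s hI _ hI' h
      exact (hopp hI hI' h3 hu (mul_neg_of_pos_of_neg h1 h0)).elim
    · have hI : -s ∈ Set.Icc 0 D := ⟨by linarith, by linarith [hs.1]⟩
      have hI' : s' ∈ Set.Icc 0 D := ⟨hs0', hs'.2⟩
      rw [← neg_neg s, hA0 _ hI, hB2 _ hI'] at h
      obtain ⟨u, h3, hu⟩ := h02 _ hI _ hI' h
      exact (hopp hI hI' h3 hu (mul_neg_of_neg_of_pos h0 h2)).elim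
    · have hI : -s ∈ Set.Icc 0 D := ⟨by linarith, by linarith [hs.1]⟩
      have hI' : -s' ∈ Set.Icc 0 D := ⟨by linarith, by linarith [hs'.1]⟩
      rw [← neg_neg s, hA0 _ hI, ← neg_neg s', hB0 _ hI'] at h
      obtain ⟨u, h3, hu⟩ := h00 _ hI _ hI' h
      have h4 := mul_right_cancel₀ h0.ne (hinn h3)
      rw [sub_self, smul_zero, add_zero, sub_left_injective h4, sub_self] at h3
      exact (hwt h3.symm).elim
  have hz : x + t • w + (t * b) • e 2 = x + (t * a) • e 1 := by rw [hw]; module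
  have hmin : 0 < min (min (t * a) (t * b)) (min (min (D - t * a) (D - t * b)) (δ / 8)) :=
    lt_min (lt_min hta0 htb0) (lt_min (lt_min (by linarith) (by linarith)) (by positivity))
  refine ⟨x + (t * a) • e 1, 2 * D, _, fun s => A (s + t * a), fun s => B (s + t * b),
  { pos := by linarith
    delta_pos := hmin
    simple := ?_
    inner_left := hn 1
    inner_right := hn 2
    linearIndependent := ?_
    continuous_left := by fun_prop
    continuous_right := by fun_prop
    periodic_left := fun s => ?_
    periodic_right := fun s => ?_
    mem_left := fun s => ?_
    mem_right := fun s => ?_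
    left_eq := fun s hs => ?_
    right_eq := fun s hs => ?_
    inter := inter_of_periodic hD hAp hBp hinter
    dimH_left := ?_
    dimH_right := ?_ }⟩
  · refine hball' ?_ ?_
    · rw [dist_eq_norm, add_sub_cancel_left, norm_smul, he, mul_one, Real.norm_of_nonneg hta0.le]
      exact hta'
    · rw [add_sub_cancel_left, inner_smul_right, hn, mul_zero]
  · rw [LinearIndependent.pair_iff]
    intro s s' h
    have := hlin (s := s) (t := -s') (by rw [neg_smul]; exact eq_neg_of_add_eq_zero_left h)
    exact ⟨this.1, neg_eq_zero.1 this.2⟩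
  · simp only [add_right_comm s]; exact hAp _
  · simp only [add_right_comm s]; exact hBp _
  · exact mem_of_periodic hD hAp hA1 hA0 (fun s hs => (C.straight 1).curve_mem_surface hD hs)
      (fun s hs => (C.straight 0).curve_mem_surface hD hs) _
  · exact mem_of_periodic hD hBp hB2 hB0 (fun s hs => (hS 2).curve_mem_surface hD hs)
      (fun s hs => (hS 0).curve_mem_surface hD hs) _
  · simp only [lt_min_iff, abs_lt] at hs
    have hI : s + t * a ∈ Set.Icc 0 D := ⟨by linarith, by linarith⟩
    rw [hA1 _ hI, (C.straight 1).curve_eq_of_simple hD (C.type_zero 1) hsm hI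
      (by rw [C.zero, sub_self, norm_zero]; linarith), C.zero]
    module
  · simp only [lt_min_iff, abs_lt] at hs
    have hI : s + t * b ∈ Set.Icc 0 D := ⟨by linarith, by linarith⟩
    rw [hB2 _ hI, (hS 2).curve_eq_of_simple hD (C.type_zero 2) hsm hI
      (by rw [C.interp_zero, add_sub_cancel_left]; linarith), C.interp_zero, ← hz]
    module
  · exact dimH_cone_periodic_le hD hAp hA1 hA0 ((C.straight 1).dimH_cone_le hD _)
      ((C.straight 0).dimH_cone_le hD _) _
  · exact dimH_cone_periodic_le hD hBp hB2 hB0 ((hS 2).dimH_cone_le hD _)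
      ((hS 0).dimH_cone_le hD _) _

theorem IsAntipodal.exists_crossing {D : ℝ} (hA : H.IsAntipodal D) :
    ∃ i z e e' L δ A B, H.Crossing i z e e' L δ A B := by
  have := Fintype.ofFinite ι
  obtain ⟨N, i, j, T, x, y, w, σ, p, q, e, C, ν, a, b, ha, hb, hw, h0, h1, h2, hwν, hne, hn⟩ :=
    exists_config hA
  obtain ⟨z, L, δ, A, B, h⟩ := C.exists_crossing ha hb hw h0 h1 h2 hwν hne hn
  exact ⟨i, z, _, _, L, δ, A, B, h⟩

end HPolyhedron

theorem sub_eq_sub_of_exp_eq {φ ψ : ℝ → ℂ} {a b : ℝ} (hab : a ≤ b)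
    (hφ : ContinuousOn φ (Set.Icc a b)) (hψ : ContinuousOn ψ (Set.Icc a b))
    (h : ∀ s ∈ Set.Icc a b, Complex.exp (φ s) = Complex.exp (ψ s)) :
    φ b - φ a = ψ b - ψ a := by
  have hpi : (2 * Real.pi * Complex.I : ℂ) ≠ 0 := Complex.two_pi_I_ne_zero
  have hc : ContinuousOn (fun s => ((φ s - ψ s) / (2 * Real.pi * Complex.I)).re)
      (Set.Icc a b) :=
    Complex.continuous_re.comp_continuousOn ((hφ.sub hψ).div_const _)
  have hval : ∀ s ∈ Set.Icc a b, ∃ n : ℤ, φ s - ψ s = n * (2 * Real.pi * Complex.I) := by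
    intro s hs
    rw [← Complex.exp_eq_one_iff, Complex.exp_sub, h s hs, div_self (Complex.exp_ne_zero _)]
  have hre : ∀ {s : ℝ} {n : ℤ}, φ s - ψ s = n * (2 * Real.pi * Complex.I) →
      ((φ s - ψ s) / (2 * Real.pi * Complex.I)).re = n := by
    intro s n hn
    rw [hn, mul_div_cancel_right₀ _ hpi, Complex.intCast_re]
  have hdisc : IsDiscrete (Set.range ((↑) : ℤ → ℝ)) :=
    isDiscrete_iff_discreteTopology.2
      Int.isClosedEmbedding_coe_real.isEmbedding.toHomeomorph.symm.isEmbedding.discreteTopology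
  have hb := Set.right_mem_Icc.2 hab
  have ha := Set.left_mem_Icc.2 hab
  have := isPreconnected_Icc.constant_of_mapsTo hdisc hc (fun s hs => by
    obtain ⟨n, hn⟩ := hval s hs
    exact ⟨n, (hre hn).symm⟩) hb ha
  obtain ⟨m, hm⟩ := hval b hb
  obtain ⟨n, hn⟩ := hval a ha
  simp only [hre hm, hre hn, Int.cast_inj] at this
  subst this
  linear_combination hm - hn

theorem sub_im_eq_arg_sub_arg {g f : ℝ → ℂ} {c : ℂ}
    (hg : ContinuousOn g (Set.Icc 0 1)) (hf : ContinuousOn f (Set.Icc 0 1))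
    (h : ∀ u ∈ Set.Icc (0 : ℝ) 1, Complex.exp (g u) = f u)
    (hc : ∀ u ∈ Set.Icc (0 : ℝ) 1, c * f u ∈ Complex.slitPlane) :
    (g 1 - g 0).im = (c * f 1).arg - (c * f 0).arg := by
  have hc0 : c ≠ 0 := by
    rintro rfl
    simpa using Complex.slitPlane_ne_zero (hc 0 (by simp))
  have h1 := sub_eq_sub_of_exp_eq (ψ := fun u => Complex.log (c * f u) - Complex.log c)
    zero_le_one hg (((continuousOn_const.mul hf).clog hc).sub continuousOn_const)
    (fun u hu => by
      rw [Complex.exp_sub, Complex.exp_log (Complex.slitPlane_ne_zero (hc u hu)),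
        Complex.exp_log hc0, mul_div_cancel_left₀ _ hc0, h u hu])
  rw [h1]
  simp [Complex.log_im]

/-- Two closed curves in the plane cannot cross transversally at a single point. -/
theorem false_of_planar_crossing {L δ : ℝ} (hL : 0 < L) (hδ : 0 < δ) {α β : ℝ → ℂ}
    (hα : Continuous α) (hβ : Continuous β) (hαp : α.Periodic L) (hβp : β.Periodic L)
    (h : ∀ s t, α s = β t → ∃ m n : ℤ, s = m * L ∧ t = n * L)
    (hαδ : ∀ s, |s| < δ → ∃ r : ℝ, 0 < r ∧ α s = (r * s : ℝ))
    (hβδ : ∀ s, |s| < δ → ∃ r : ℝ, 0 < r ∧ β s = (r * s : ℝ) * Complex.I) : False := by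
  set U : Set (ℝ × ℝ) := {x | 0 < x.1 + x.2 ∧ x.1 + x.2 < 2 * L ∧ x.1 - x.2 < L ∧
    x.2 - x.1 < L} with hU
  have hUo : IsOpen U := by
    have h1 : Continuous fun x : ℝ × ℝ => x.1 + x.2 := by fun_prop
    have h2 : Continuous fun x : ℝ × ℝ => x.1 - x.2 := by fun_prop
    have h3 : Continuous fun x : ℝ × ℝ => x.2 - x.1 := by fun_prop
    exact (isOpen_lt continuous_const h1).inter ((isOpen_lt h1 continuous_const).inter
      ((isOpen_lt h2 continuous_const).inter (isOpen_lt h3 continuous_const)))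
  have hUc : Convex ℝ U := by
    rintro ⟨x, y⟩ ⟨h1, h2, h3, h4⟩ ⟨x', y'⟩ ⟨h1', h2', h3', h4'⟩ a b ha hb hab
    simp only at h1 h2 h3 h4 h1' h2' h3' h4'
    obtain rfl : a = 1 - b := by linarith
    have hlt : ∀ {u v c : ℝ}, u < c → v < c → (1 - b) * u + b * v < c := by
      intro u v c hu hv
      nlinarith [mul_nonneg ha (sub_nonneg.2 hu.le), mul_nonneg hb (sub_nonneg.2 hv.le),
        min_le_left (c - u) (c - v), min_le_right (c - u) (c - v),
        lt_min (sub_pos.2 hu) (sub_pos.2 hv),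
        mul_le_mul_of_nonneg_left (min_le_left (c - u) (c - v)) ha,
        mul_le_mul_of_nonneg_left (min_le_right (c - u) (c - v)) hb]
    have k1 := hlt (neg_lt_zero.2 h1) (neg_lt_zero.2 h1')
    have k2 := hlt h2 h2'
    have k3 := hlt h3 h3'
    have k4 := hlt h4 h4'
    refine ⟨?_, ?_, ?_, ?_⟩ <;> simp only [Prod.smul_mk, Prod.mk_add_mk, smul_eq_mul] <;> linarith
  have hUs : IsSimplyConnected U := by
    have : ContractibleSpace U := hUc.contractibleSpace ⟨(L / 2, L / 2), by
      refine ⟨?_, ?_, ?_, ?_⟩ <;> simp only <;> linarith⟩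
    exact (inferInstance : SimplyConnectedSpace U)
  have hF : Continuous fun x : ℝ × ℝ => α x.1 - β x.2 := by fun_prop
  obtain ⟨G, hGc, hG⟩ := Complex.exists_continuousOn_eqOn_exp_comp hUs hUo hF.continuousOn (by
    rintro ⟨⟨s, t⟩, ⟨h1, h2, h3, h4⟩, h5⟩
    obtain ⟨m, n, rfl, rfl⟩ := h s t (sub_eq_zero.1 h5)
    simp only at h1 h2 h3 h4
    rw [← add_mul] at h1 h2
    rw [← sub_mul] at h3 h4
    have h1 : 0 < m + n := by exact_mod_cast pos_of_mul_pos_left h1 hL.le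
    have h2 : m + n < 2 := by exact_mod_cast lt_of_mul_lt_mul_right h2 hL.le
    have h3 : m - n < 1 := by
      exact_mod_cast lt_of_mul_lt_mul_right (h3.trans_eq (one_mul L).symm) hL.le
    have h4 : n - m < 1 := by
      exact_mod_cast lt_of_mul_lt_mul_right (h4.trans_eq (one_mul L).symm) hL.le
    omega)
  simp only [Set.EqOn, Function.comp_apply] at hG
  have corner : ∀ (p q : ℝ → ℝ) (m n : ℤ) (c : ℂ) (θ : ℝ), Continuous p → Continuous q →
      (∀ u ∈ Set.Icc (0 : ℝ) 1, |p u| < δ ∧ |q u| < δ ∧ (p u + m * L, q u + n * L) ∈ U ∧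
        ∀ r r' : ℝ, 0 < r → 0 < r' →
          c * ((r * p u : ℝ) - (r' * q u : ℝ) * Complex.I) ∈ Complex.slitPlane) →
      (∀ r r' : ℝ, 0 < r → 0 < r' →
        (c * ((r * p 0 : ℝ) - (r' * q 0 : ℝ) * Complex.I)).arg = 0 ∧
        (c * ((r * p 1 : ℝ) - (r' * q 1 : ℝ) * Complex.I)).arg = θ) →
      (G (p 1 + m * L, q 1 + n * L) - G (p 0 + m * L, q 0 + n * L)).im = θ := by
    intro p q m n c θ hp hq hpq harg
    have hval : ∀ u ∈ Set.Icc (0 : ℝ) 1, ∃ r r' : ℝ, 0 < r ∧ 0 < r' ∧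
        α (p u + m * L) - β (q u + n * L) = (r * p u : ℝ) - (r' * q u : ℝ) * Complex.I := by
      intro u hu
      obtain ⟨r, hr, h1⟩ := hαδ _ (hpq u hu).1
      obtain ⟨r', hr', h2⟩ := hβδ _ (hpq u hu).2.1
      exact ⟨r, r', hr, hr', by rw [hαp.int_mul m, hβp.int_mul n, h1, h2]⟩
    have h1 := sub_im_eq_arg_sub_arg (c := c) (g := fun u => G (p u + m * L, q u + n * L))
      (f := fun u => α (p u + m * L) - β (q u + n * L))
      (hGc.comp (by fun_prop) fun u hu => (hpq u hu).2.2.1) (by fun_prop)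
      (fun u hu => hG (hpq u hu).2.2.1)
      (fun u hu => by
        obtain ⟨r, r', hr, hr', h2⟩ := hval u hu
        simp only [h2]
        exact (hpq u hu).2.2.2 r r' hr hr')
    obtain ⟨r, r', hr, hr', h2⟩ := hval 0 (by simp)
    obtain ⟨R, R', hR, hR', h3⟩ := hval 1 (by simp)
    simp only [h2, h3] at h1
    rw [h1, (harg r r' hr hr').1, (harg R R' hR hR').2, sub_zero]
  have hpos : ∀ {x : ℝ}, 0 < x → (x : ℂ).arg = 0 := fun hx =>
    Complex.arg_ofReal_of_nonneg hx.le
  have hI : ∀ {x : ℝ}, 0 < x → ((x : ℂ) * Complex.I).arg = Real.pi / 2 := fun {x} hx => by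
    rw [Complex.arg_real_mul _ hx, Complex.arg_I]
  have hnI : ∀ {x : ℝ}, 0 < x → ((x : ℂ) * -Complex.I).arg = -(Real.pi / 2) := fun {x} hx => by
    rw [Complex.arg_real_mul _ hx, Complex.arg_neg_I]
  obtain ⟨d, hd, hdδ, hdL⟩ : ∃ d, 0 < d ∧ d < δ ∧ 4 * d < L := by
    refine ⟨min (δ / 2) (L / 8), by positivity, ?_, ?_⟩
    · linarith [min_le_left (δ / 2) (L / 8)]
    · linarith [min_le_right (δ / 2) (L / 8)]
  have hu0 : ∀ u ∈ Set.Icc (0 : ℝ) 1, 0 ≤ d * u ∧ 0 ≤ d * (1 - u) ∧ d * u + d * (1 - u) = d ∧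
      (0 < d * u ∨ 0 < d * (1 - u)) := fun u hu => by
    have h1 := mul_nonneg hd.le hu.1
    have h2 := mul_nonneg hd.le (sub_nonneg.2 hu.2)
    have h3 : d * u + d * (1 - u) = d := by ring
    exact ⟨h1, h2, h3, by by_contra! h4; linarith⟩
  have c1 := corner (fun u => d * (1 - u)) (fun u => d * u) 0 0 1 (-(Real.pi / 2)) (by fun_prop)
    (by fun_prop) (fun u hu => by
      obtain ⟨h1, h2, h3, h4⟩ := hu0 u hu
      refine ⟨by rw [abs_lt]; constructor <;> linarith, by rw [abs_lt]; constructor <;> linarith,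
        ⟨?_, ?_, ?_, ?_⟩, fun r r' hr hr' => Complex.mem_slitPlane_iff.2 ?_⟩
      iterate 4 (push_cast; linarith)
      rcases h4 with h4 | h4
      · exact Or.inr (by simpa [hd.ne', hr'.ne'] using (mul_pos hr' h4).ne')
      · exact Or.inl (by simpa [hd, hr] using mul_pos hr h4))
    (fun r r' hr hr' => ⟨by simpa using hpos (mul_pos hr hd), by
      simpa using hnI (mul_pos hr' hd)⟩)
  have c2 := corner (fun u => -(d * (1 - u))) (fun u => d * u) 1 0 (-1) (Real.pi / 2) (by fun_prop)
    (by fun_prop) (fun u hu => by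
      obtain ⟨h1, h2, h3, h4⟩ := hu0 u hu
      refine ⟨by rw [abs_lt]; constructor <;> linarith, by rw [abs_lt]; constructor <;> linarith,
        ⟨?_, ?_, ?_, ?_⟩, fun r r' hr hr' => Complex.mem_slitPlane_iff.2 ?_⟩
      iterate 4 (push_cast; linarith)
      rcases h4 with h4 | h4
      · exact Or.inr (by simpa [hd.ne', hr'.ne'] using (mul_pos hr' h4).ne')
      · exact Or.inl (by simpa [hd, hr] using mul_pos hr h4))
    (fun r r' hr hr' => ⟨by simpa using hpos (mul_pos hr hd), by
      simpa using hI (mul_pos hr' hd)⟩)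
  have c3 := corner (fun u => -(d * u)) (fun u => -(d * (1 - u))) 1 1 (-Complex.I) (Real.pi / 2)
    (by fun_prop) (by fun_prop) (fun u hu => by
      obtain ⟨h1, h2, h3, h4⟩ := hu0 u hu
      refine ⟨by rw [abs_lt]; constructor <;> linarith, by rw [abs_lt]; constructor <;> linarith,
        ⟨?_, ?_, ?_, ?_⟩, fun r r' hr hr' => Complex.mem_slitPlane_iff.2 ?_⟩
      iterate 4 (push_cast; linarith)
      rcases h4 with h4 | h4
      · exact Or.inr (by simpa [hd.ne', hr.ne'] using (mul_pos hr h4).ne')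
      · exact Or.inl (by simpa [hd, hr'] using mul_pos hr' h4))
    (fun r r' hr hr' => ⟨by
      convert hpos (mul_pos hr' hd) using 2
      apply Complex.ext <;> simp, by
      convert hI (mul_pos hr hd) using 2
      apply Complex.ext <;> simp⟩)
  have c4 := corner (fun u => d * (1 - u)) (fun u => -(d * u)) 0 1 1 (Real.pi / 2) (by fun_prop)
    (by fun_prop) (fun u hu => by
      obtain ⟨h1, h2, h3, h4⟩ := hu0 u hu
      refine ⟨by rw [abs_lt]; constructor <;> linarith, by rw [abs_lt]; constructor <;> linarith,
        ⟨?_, ?_, ?_, ?_⟩, fun r r' hr hr' => Complex.mem_slitPlane_iff.2 ?_⟩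
      iterate 4 (push_cast; linarith)
      rcases h4 with h4 | h4
      · exact Or.inr (by simpa [hd.ne', hr'.ne'] using (mul_pos hr' h4).ne')
      · exact Or.inl (by simpa [hd, hr] using mul_pos hr h4))
    (fun r r' hr hr' => ⟨by simpa using hpos (mul_pos hr hd), by
      simpa using hI (mul_pos hr' hd)⟩)
  have hmem : ∀ s ∈ Set.Icc d (L - d), (s, 0) ∈ U ∧ (s, L) ∈ U ∧ (0, s) ∈ U ∧ (L, s) ∈ U := by
    intro s hs
    refine ⟨⟨?_, ?_, ?_, ?_⟩, ⟨?_, ?_, ?_, ?_⟩, ⟨?_, ?_, ?_, ?_⟩, ?_, ?_, ?_, ?_⟩ <;> simp only <;>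
      linarith [hs.1, hs.2]
  have e1 := sub_eq_sub_of_exp_eq (a := d) (b := L - d) (φ := fun s => G (s, 0))
    (ψ := fun s => G (s, L)) (by linarith)
    (hGc.comp (by fun_prop) fun s hs => (hmem s hs).1)
    (hGc.comp (by fun_prop) fun s hs => (hmem s hs).2.1)
    (fun s hs => by rw [hG (hmem s hs).1, hG (hmem s hs).2.1, hβp.eq])
  have e2 := sub_eq_sub_of_exp_eq (a := d) (b := L - d) (φ := fun s => G (0, s))
    (ψ := fun s => G (L, s)) (by linarith)
    (hGc.comp (by fun_prop) fun s hs => (hmem s hs).2.2.1)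
    (hGc.comp (by fun_prop) fun s hs => (hmem s hs).2.2.2)
    (fun s hs => by rw [hG (hmem s hs).2.2.1, hG (hmem s hs).2.2.2, hαp.eq])
  replace e1 := congrArg Complex.im e1
  replace e2 := congrArg Complex.im e2
  simp only [Complex.sub_im] at c1 c2 c3 c4 e1 e2
  norm_num at c1 c2 c3 c4 e1 e2
  ring_nf at c1 c2 c3 c4 e1 e2
  linarith [Real.pi_pos]

/-- Two points with the same stereographic projection are on the same ray. -/
theorem eq_smul_of_stereographic_eq {a b c a' b' c' n n' : ℝ} (hn : n ^ 2 = a ^ 2 + b ^ 2 + c ^ 2)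
    (hn' : n' ^ 2 = a' ^ 2 + b' ^ 2 + c' ^ 2) (hp : 0 < n + a) (hp' : 0 < n' + a')
    (hb : b / (n + a) = b' / (n' + a')) (hc : c / (n + a) = c' / (n' + a')) :
    ∃ r : ℝ, 0 < r ∧ a' = r * a ∧ b' = r * b ∧ c' = r * c := by
  have h1 : (n - a) / (n + a) = (b / (n + a)) ^ 2 + (c / (n + a)) ^ 2 := by
    field_simp; linear_combination hn
  have h2 : (n' - a') / (n' + a') = (b' / (n' + a')) ^ 2 + (c' / (n' + a')) ^ 2 := by
    field_simp; linear_combination hn'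
  have h3 : (n - a) / (n + a) = (n' - a') / (n' + a') := by rw [h1, h2, hb, hc]
  refine ⟨(n' + a') / (n + a), by positivity, ?_, ?_, ?_⟩
  · field_simp at h3 ⊢; linarith
  · field_simp at hb ⊢; linarith
  · field_simp at hc ⊢; linarith

namespace HPolyhedron

variable {ι : Type} [Finite ι] {H : HPolyhedron ι}

theorem le_one_of_smul_mem_surface {o ξ : E} (ho : ∀ k, ⟪H.n k, o⟫ < H.h k) {c : ℝ} (hc : 0 < c)
    (h : o + ξ ∈ H.surface) (h' : o + c • ξ ∈ H.surface) : 1 ≤ c := by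
  by_contra! hc1
  obtain ⟨k, hk⟩ := h'
  have h1 := (H.mem_body_of_mem_surface h) k
  have h2 := hk.2
  have h3 := ho k
  rw [inner_add_right] at h1 h2
  rw [inner_smul_right] at h2
  nlinarith

theorem eq_of_smul_mem_surface {o ξ : E} (ho : ∀ k, ⟪H.n k, o⟫ < H.h k) {c : ℝ} (hc : 0 < c)
    (h : o + ξ ∈ H.surface) (h' : o + c • ξ ∈ H.surface) : c = 1 := by
  refine le_antisymm ?_ (le_one_of_smul_mem_surface ho hc h h')
  have := le_one_of_smul_mem_surface ho (inv_pos.2 hc) h'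
    (by rwa [smul_smul, inv_mul_cancel₀ hc.ne', one_smul])
  exact (one_le_inv₀ hc).1 this

theorem Simple.exists_inner_lt {i : ι} {z u : E} (h : H.Simple i z) (hu : ⟪H.n i, u⟫ < 0) :
    ∃ ε : ℝ, 0 < ε ∧ ∀ k, ⟪H.n k, z + ε • u⟫ < H.h k := by
  have hc : Tendsto (fun t : ℝ => z + t • u) (𝓝[>] 0) (𝓝 z) := by
    have : Tendsto (fun t : ℝ => z + t • u) (𝓝 0) (𝓝 (z + (0 : ℝ) • u)) :=
      Continuous.tendsto (by fun_prop) 0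
    rw [zero_smul, add_zero] at this
    exact this.mono_left nhdsWithin_le_nhds
  obtain ⟨ε, h1, hε⟩ := ((hc.eventually (H.eventually_forall_of_inner_lt z)).and
    self_mem_nhdsWithin).exists
  replace hε : 0 < ε := hε
  refine ⟨ε, hε, fun k => ?_⟩
  rcases (h.1.1 k).lt_or_eq with hk | hk
  · exact h1 k hk
  · rw [inner_add_right, hk, inner_smul_right, h.2 k ⟨h.1.1, hk⟩]
    linarith [mul_neg_of_pos_of_neg hε hu]

theorem Crossing.false {i : ι} {z e e' : E} {L δ : ℝ} {A B : ℝ → E}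
    (h : H.Crossing i z e e' L δ A B) : False := by
  have hdense : Dense ({u | ∃ c s : ℝ, u = c • (A s - z)} ∪ {u | ∃ c s : ℝ, u = c • (B s - z)})ᶜ := by
    refine dense_compl_of_dimH_lt_finrank ?_
    rw [dimH_union, finrank_euclideanSpace_fin]
    exact (max_le h.dimH_left h.dimH_right).trans_lt (by norm_num)
  obtain ⟨u, hu, hucone⟩ := hdense.inter_open_nonempty {u | ⟪H.n i, u⟫ < 0}
    (isOpen_lt (by fun_prop) continuous_const)
    ⟨-H.n i, by simp [H.norm_n i]⟩
  replace hu : ⟪H.n i, u⟫ < 0 := hu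
  simp only [Set.mem_compl_iff, Set.mem_union, Set.mem_ofPred_eq, not_or, not_exists] at hucone
  obtain ⟨ε, hε, ho⟩ := h.simple.exists_inner_lt hu
  set o := z + ε • u with hodef
  set v := -(ε • u) with hv
  have hvn : ⟪H.n i, v⟫ ≠ 0 := by
    rw [hv, inner_neg_right, inner_smul_right]
    exact neg_ne_zero.2 (mul_neg_of_pos_of_neg hε hu).ne
  have hli : LinearIndependent ℝ ![v, e, e'] := by
    rw [Fintype.linearIndependent_iff]
    intro g hg
    simp only [Fin.sum_univ_three, Matrix.cons_val_zero, Matrix.cons_val_one,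
      Matrix.cons_val] at hg
    have h0 : g 0 = 0 := by
      have := congrArg (fun w => ⟪H.n i, w⟫) hg
      simp only [inner_add_right, inner_smul_right, h.inner_left, h.inner_right, mul_zero,
        add_zero, inner_zero_right] at this
      exact (mul_eq_zero.1 this).resolve_right hvn
    rw [h0, zero_smul, zero_add] at hg
    obtain ⟨h1, h2⟩ := LinearIndependent.pair_iff.1 h.linearIndependent _ _ hg
    intro k
    fin_cases k <;> assumption
  set b := basisOfLinearIndependentOfCardEqFinrank hli (by simp) with hb
  have hb0 : b 0 = v := by simp [hb]
  have hb1 : b 1 = e := by simp [hb]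
  have hb2 : b 2 = e' := by simp [hb]
  have hac : ∀ k, Continuous fun ξ => b.repr ξ k := fun k =>
    (b.coord k).continuous_of_finiteDimensional
  set N : E → ℝ := fun ξ => √(b.repr ξ 0 ^ 2 + b.repr ξ 1 ^ 2 + b.repr ξ 2 ^ 2) with hN
  have hNc : Continuous N := by
    have := hac 0; have := hac 1; have := hac 2
    fun_prop
  have hNsq : ∀ ξ, N ξ ^ 2 = b.repr ξ 0 ^ 2 + b.repr ξ 1 ^ 2 + b.repr ξ 2 ^ 2 := fun ξ =>
    Real.sq_sqrt (by positivity)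
  have hrepr : ∀ ξ, ξ = b.repr ξ 0 • v + b.repr ξ 1 • e + b.repr ξ 2 • e' := fun ξ => by
    conv_lhs => rw [← b.sum_repr ξ, Fin.sum_univ_three, hb0, hb1, hb2]
  have hden : ∀ ζ, (∀ c : ℝ, u ≠ c • (ζ - z)) → 0 < N (ζ - o) + b.repr (ζ - o) 0 := by
    intro ζ hζ
    have hle : |b.repr (ζ - o) 0| ≤ N (ζ - o) := Real.abs_le_sqrt (by nlinarith [sq_nonneg (b.repr (ζ - o) 1), sq_nonneg (b.repr (ζ - o) 2)])
    rcases (by linarith [neg_abs_le (b.repr (ζ - o) 0)] : 0 ≤ N (ζ - o) + b.repr (ζ - o) 0).lt_or_eq with h0 | h0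
    · exact h0
    exfalso
    have h1 := hNsq (ζ - o)
    rw [show N (ζ - o) = -b.repr (ζ - o) 0 by linarith] at h1
    have h2 : b.repr (ζ - o) 1 = 0 := by
      have : b.repr (ζ - o) 1 ^ 2 = 0 := by nlinarith [sq_nonneg (b.repr (ζ - o) 1), sq_nonneg (b.repr (ζ - o) 2)]
      exact pow_eq_zero_iff two_ne_zero |>.1 this
    have h3 : b.repr (ζ - o) 2 = 0 := by
      have : b.repr (ζ - o) 2 ^ 2 = 0 := by nlinarith [sq_nonneg (b.repr (ζ - o) 1), sq_nonneg (b.repr (ζ - o) 2)]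
      exact pow_eq_zero_iff two_ne_zero |>.1 this
    have h4 : b.repr (ζ - o) 0 ≤ 0 := by linarith [Real.sqrt_nonneg (b.repr (ζ - o) 0 ^ 2 + b.repr (ζ - o) 1 ^ 2 + b.repr (ζ - o) 2 ^ 2)]
    have h5 := hrepr (ζ - o)
    rw [h2, h3, zero_smul, zero_smul, add_zero, add_zero] at h5
    have h6 : 0 < ε * (1 - b.repr (ζ - o) 0) := mul_pos hε (by linarith)
    refine hζ (ε * (1 - b.repr (ζ - o) 0))⁻¹ ?_
    rw [eq_inv_smul_iff₀ h6.ne', show ζ - z = (ζ - o) + ε • u by rw [hodef]; module]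
    generalize b.repr (ζ - o) 0 = a at *
    rw [h5, hv]
    module
  set f : E → ℂ := fun ξ => (b.repr ξ 1 / (N ξ + b.repr ξ 0) : ℝ) +
    (b.repr ξ 2 / (N ξ + b.repr ξ 0) : ℝ) * Complex.I with hf
  have hfc : ∀ {γ : ℝ → E}, Continuous γ → (∀ s, ∀ c : ℝ, u ≠ c • (γ s - z)) →
      Continuous fun s => f (γ s - o) := by
    intro γ hγ hγu
    have hd : ∀ s, N (γ s - o) + b.repr (γ s - o) 0 ≠ 0 := fun s => (hden _ (hγu s)).ne'
    have hk : ∀ k, Continuous fun s => b.repr (γ s - o) k := fun k =>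
      (hac k).comp (hγ.sub continuous_const)
    have hNk : Continuous fun s => N (γ s - o) := hNc.comp (hγ.sub continuous_const)
    have h1 := hk 0; have h2 := hk 1; have h3 := hk 2
    simp only [hf]
    exact (Complex.continuous_ofReal.comp (h2.div (hNk.add h1) hd)).add
      ((Complex.continuous_ofReal.comp (h3.div (hNk.add h1) hd)).mul continuous_const)
  have hA : ∀ s, ∀ c : ℝ, u ≠ c • (A s - z) := fun s c => hucone.1 c s
  have hB : ∀ s, ∀ c : ℝ, u ≠ c • (B s - z) := fun s c => hucone.2 c s
  have hrepr' : ∀ s t : ℝ, b.repr (v + s • e + t • e') 0 = 1 ∧ b.repr (v + s • e + t • e') 1 = s ∧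
      b.repr (v + s • e + t • e') 2 = t := by
    intro s t
    simp [← hb0, ← hb1, ← hb2]
  refine false_of_planar_crossing h.pos h.delta_pos (hfc h.continuous_left hA)
    (hfc h.continuous_right hB) (fun s => by simp only [h.periodic_left s])
    (fun s => by simp only [h.periodic_right s]) (fun s t hst => h.inter s t ?_)
    (fun s hs => ?_) (fun s hs => ?_)
  · obtain ⟨hre, him⟩ := Complex.ext_iff.1 hst
    simp only [hf, Complex.add_re, Complex.add_im, Complex.ofReal_re, Complex.ofReal_im,
      Complex.re_ofReal_mul, Complex.im_ofReal_mul, Complex.I_re, Complex.I_im, mul_zero, add_zero,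
      mul_one, zero_add] at hre him
    obtain ⟨r, hr, h0, h1, h2⟩ := eq_smul_of_stereographic_eq (hNsq _) (hNsq _)
      (hden _ (hA s)) (hden _ (hB t)) hre him
    have h3 : B t - o = r • (A s - o) := by
      rw [hrepr (B t - o), h0, h1, h2]
      conv_rhs => rw [hrepr (A s - o)]
      module
    have h4 := eq_of_smul_mem_surface ho hr (ξ := A s - o)
      (by rw [add_sub_cancel]; exact h.mem_left s)
      (by rw [← h3, add_sub_cancel]; exact h.mem_right t)
    rw [h4, one_smul] at h3
    exact (sub_left_injective h3).symm
  · have h1 := hden _ (hA s)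
    have h2 : A s - o = v + s • e + (0 : ℝ) • e' := by rw [h.left_eq s hs]; module
    simp only [h2] at h1 ⊢
    refine ⟨_, inv_pos.2 h1, ?_⟩
    simp only [hf, (hrepr' s 0).2.1, (hrepr' s 0).2.2]
    simp [div_eq_inv_mul]
  · have h1 := hden _ (hB s)
    have h2 : B s - o = v + (0 : ℝ) • e + s • e' := by rw [h.right_eq s hs]; module
    simp only [h2] at h1 ⊢
    refine ⟨_, inv_pos.2 h1, ?_⟩
    simp only [hf, (hrepr' 0 s).2.1, (hrepr' 0 s).2.2]
    simp [div_eq_inv_mul]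

theorem not_isAntipodal (D : ℝ) : ¬ H.IsAntipodal D := fun hA => by
  obtain ⟨i, z, e, e', L, δ, A, B, h⟩ := hA.exists_crossing
  exact h.false

end HPolyhedron

namespace HPolyhedron

variable {ι : Type} [Finite ι] {H : HPolyhedron ι}

theorem exists_ne_mem_surface : ∃ x ∈ H.surface, ∃ y ∈ H.surface, x ≠ y := by
  obtain ⟨u, hu⟩ := exists_ne (0 : E)
  obtain ⟨t, ht, hx⟩ := H.exists_ray_mem_surface hu
  obtain ⟨s, hs, hy⟩ := H.exists_ray_mem_surface (neg_ne_zero.2 hu)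
  refine ⟨_, hx, _, hy, fun h => ?_⟩
  have h1 : (t + s) • u = 0 := by
    rw [smul_neg] at h
    rw [add_smul, add_left_cancel h, neg_add_cancel]
  exact (smul_ne_zero (by positivity) hu) h1

theorem continuousOn_d_facet {x : E} (hx : x ∈ H.surface) (i : ι) :
    ContinuousOn (H.d x) (H.facet i) := by
  refine (LipschitzOnWith.of_dist_le_mul (K := 1) fun y hy y' hy' => ?_).continuousOn
  have h1 := H.d_triangle hx ⟨i, hy⟩ ⟨i, hy'⟩
  have h2 := H.d_triangle hx ⟨i, hy'⟩ ⟨i, hy⟩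
  rw [H.d_comm y' y] at h2
  rw [H.d_eq_of_mem_facet hy hy'] at h1 h2
  rw [NNReal.coe_one, one_mul, Real.dist_eq, dist_eq_norm, abs_le]
  constructor <;> linarith

/-- Every point of the surface has a farthest point. -/
theorem exists_forall_d_le {x : E} (hx : x ∈ H.surface) :
    ∃ y ∈ H.surface, ∀ y' ∈ H.surface, H.d x y' ≤ H.d x y := by
  have hfar : ∀ i, ∃ y ∈ H.surface, ∀ y' ∈ H.facet i, H.d x y' ≤ H.d x y := fun i => by
    rcases (H.facet i).eq_empty_or_nonempty with h | h
    · exact ⟨x, hx, by simp [h]⟩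
    · obtain ⟨y, hy, hmax⟩ := (H.isCompact_facet i).exists_isMaxOn h (continuousOn_d_facet hx i)
      exact ⟨y, ⟨i, hy⟩, fun y' hy' => hmax hy'⟩
  choose y hy hmax using hfar
  obtain ⟨j, -⟩ := hx
  have : Nonempty ι := ⟨j⟩
  obtain ⟨i, hi⟩ := Finite.exists_max fun i => H.d x (y i)
  exact ⟨y i, hy i, fun y' ⟨k, hk⟩ => (hmax k y' hk).trans (hi k)⟩

theorem ofReal_d {x y : E} (hx : x ∈ H.surface) (hy : y ∈ H.surface) :
    ENNReal.ofReal (H.d x y) = rho H.surface x y :=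
  ENNReal.ofReal_toReal (H.rho_ne_top hx hy)

theorem intrinsicRad_lt_intrinsicDiam (H : HPolyhedron ι) :
    intrinsicRad H.surface < intrinsicDiam H.surface := by
  by_contra! hle
  choose! f hf hmax using fun x (hx : x ∈ H.surface) => exists_forall_d_le hx
  have hsup : ∀ x ∈ H.surface, ⨆ y ∈ H.surface, rho H.surface x y = ENNReal.ofReal (H.d x (f x)) := by
    intro x hx
    refine le_antisymm (iSup₂_le fun y hy => ?_) ?_
    · rw [← ofReal_d hx hy]
      exact ENNReal.ofReal_le_ofReal (hmax x hx y hy)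
    · rw [ofReal_d hx (hf x hx)]
      exact le_iSup₂_of_le (f x) (hf x hx) le_rfl
  have heq : ∀ x ∈ H.surface, ∀ x' ∈ H.surface, H.d x (f x) ≤ H.d x' (f x') := by
    intro x hx x' hx'
    rw [← ENNReal.ofReal_le_ofReal_iff (H.d_nonneg _ _), ← hsup x hx, ← hsup x' hx']
    exact (le_iSup₂_of_le x hx le_rfl).trans (hle.trans (iInf₂_le x' hx'))
  obtain ⟨x, hx, y, hy, hxy⟩ := H.exists_ne_mem_surface
  refine H.not_isAntipodal (H.d x (f x)) ⟨?_, fun a ha b hb => ?_, fun a ha => ?_⟩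
  · exact (norm_pos_iff.2 (sub_ne_zero.2 hxy)).trans_le
      ((H.norm_sub_le_d hx hy).trans (hmax x hx y hy))
  · exact (hmax a ha b hb).trans (heq a ha x hx)
  · exact ⟨f a, hf a ha, le_antisymm (heq a ha x hx) (heq x hx a ha)⟩

end HPolyhedron

end IntrinsicMetric

theorem stmt3 (V : Set (EuclideanSpace ℝ (Fin 3))) (hV : V.Finite)
    (K : Set (EuclideanSpace ℝ (Fin 3))) (hK : K = convexHull ℝ V)
    (hint : (interior K).Nonempty)
    (P : Set (EuclideanSpace ℝ (Fin 3))) (hP : P = frontier K) :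
    intrinsicRad P < intrinsicDiam P ∧ intrinsicDiam P ≤ 2 * intrinsicRad P := by
  subst hK hP
  obtain ⟨ι, _, H, hH⟩ := IntrinsicMetric.exists_hPolyhedron hV hint
  refine ⟨?_, IntrinsicMetric.intrinsicDiam_le_two_mul_intrinsicRad _⟩
  rw [← hH, H.frontier_body]
  exact H.intrinsicRad_lt_intrinsicDiam
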